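/- Let g be a semisimple Lie algebra over an algebraically closed field F of characteristic zero, μ ∈ ℕ^ℓ, and A = F[t₁,…,t_ℓ]/(t₁^{μ₁+1},…,t_ℓ^{μ_ℓ+1}). Then the orbit under the adjoint group of every regular element of g⊗A intersects t = x₊⊗1 + g^{x₋}⊗A at exactly one point, and this intersection is transversal: g⊗A = (g^{x₋}⊗A) ⊕ [g⊗A, X] for all X ∈ t. -/

import Mathlib

open scoped TensorProduct

/-- The ideal `⟨t^ω : ω ≰ μ⟩` of `F[t₁,…,t_ℓ]`. -/
noncomputable def truncIdeal (F : Type*) [Field F] {ℓ : ℕ} (μ : Fin ℓ → ℕ) :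
    Ideal (MvPolynomial (Fin ℓ) F) :=
  Ideal.span ((fun ω : Fin ℓ → ℕ =>
    MvPolynomial.monomial (Finsupp.equivFunOnFinite.symm ω) (1 : F)) '' {ω | ¬ ω ≤ μ})

/-- The truncated polynomial algebra `A = F[t₁,…,t_ℓ]/⟨t^ω : ω ≰ μ⟩`. -/
noncomputable abbrev trunc (F : Type*) [Field F] {ℓ : ℕ} (μ : Fin ℓ → ℕ) : Type _ :=
  MvPolynomial (Fin ℓ) F ⧸ truncIdeal F μ

/-- The Lie algebra structure over `F` on `A ⊗[F] g`. -/
noncomputable instance tensorLieAlgebra {F : Type*} [Field F] {A : Type*} [CommRing A]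
    [Algebra F A] {g : Type*} [LieRing g] [LieAlgebra F g] :
    LieAlgebra F (A ⊗[F] g) where
  lie_smul t x y := by
    rw [← algebraMap_smul A t y, lie_smul, algebraMap_smul]

/-- The centralizer `L^x = {y ∈ L : ⁅x, y⁆ = 0}` of an element `x` of a Lie algebra. -/
noncomputable def cent (F : Type*) [Field F] (L : Type*) [LieRing L] [LieAlgebra F L]
    (x : L) : Submodule F L where
  carrier := {y | ⁅x, y⁆ = 0}
  add_mem' := by
    intro a b ha hb
    simp only [Set.mem_setOf_eq] at *
    rw [lie_add, ha, hb, add_zero]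
  zero_mem' := by simp
  smul_mem' := by
    intro c a ha
    simp only [Set.mem_setOf_eq] at *
    rw [lie_smul, ha, smul_zero]

/-- An element of a finite-dimensional Lie algebra is regular if its centralizer has the
minimal possible dimension. -/
def isRegular (F : Type*) [Field F] (L : Type*) [LieRing L] [LieAlgebra F L]
    (x : L) : Prop :=
  Module.finrank F (cent F L x) = sInf (Set.range fun z : L => Module.finrank F (cent F L z))

/-- The exponential of a (nilpotent) endomorphism of a finite-dimensional space in
characteristic zero: `exp N = ∑_{n ≤ dim} N^n / n!` (when `N` is nilpotent, all terms of
the series beyond the dimension vanish). -/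
noncomputable def expEnd {F : Type*} [Field F] {M : Type*} [AddCommGroup M] [Module F M]
    (N : Module.End F M) : Module.End F M :=
  ∑ n ∈ Finset.range (Module.finrank F M + 1), ((n.factorial : F)⁻¹) • N ^ n

/-- `reach F L X Y` holds if `Y` is obtained from `X` by applying an element of the
adjoint group of `L`, i.e. a finite composition of automorphisms `exp (ad N)` with
`ad N` nilpotent. -/
def reach (F : Type*) [Field F] (L : Type*) [LieRing L] [LieAlgebra F L]
    (X Y : L) : Prop :=
  ∃ l : List L, (∀ N ∈ l, IsNilpotent ((LieAlgebra.ad F L N : Module.End F L)))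
    ∧ l.foldr (fun N v => expEnd (LieAlgebra.ad F L N : Module.End F L) v) X = Y

/-- The subspace `g^{x₋} ⊗ A` of `A ⊗ g`. -/
noncomputable def centSub (F : Type*) [Field F] {A : Type*} [CommRing A] [Algebra F A]
    {g : Type*} [LieRing g] [LieAlgebra F g] (xm : g) : Submodule F (A ⊗[F] g) :=
  LinearMap.range (TensorProduct.map (LinearMap.id : A →ₗ[F] A) (cent F g xm).subtype)

/-- The transversal slice `t = x₊ ⊗ 1 + g^{x₋} ⊗ A ⊆ g ⊗ A`. -/
def tSlice (F : Type*) [Field F] {A : Type*} [CommRing A] [Algebra F A]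
    {g : Type*} [LieRing g] [LieAlgebra F g] (xp xm : g) : Set (A ⊗[F] g) :=
  {Z | Z - (1 : A) ⊗ₜ[F] xp ∈ centSub F xm}

open LieAlgebra renaming ad_apply → adp
open Module.End renaming mul_apply → ema, mem_eigenspace_iff → mei, mem_maxGenEigenspace → mge
open LinearMap renaming smul_apply → lsm, sum_apply → lsu, comp_apply → lco, sub_apply → lsb, add_apply → lad
open Submodule renaming smul_mem → ssm, sum_mem → ssu, subset_span → sss, mem_span_range_iff_exists_fun → mse, mem_iSup_of_mem → mis, span_le → sle
open LieAlgebra.ExtendScalars renaming bracket_tmul → btm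
open Matrix renaming smul_apply → xsm, sum_apply → xsu
open Finsupp renaming smul_apply → fsm
open Algebra renaming algebraMap_eq_smul_one → aes
open Int renaming eq_ofNat_of_zero_le → izl
open Module (finrank End)
open LieAlgebra (ad)

section sl2ops
variable {F : Type*} [Field F] [CharZero F] {V : Type*} [AddCommGroup V] [Module F V]
  [FiniteDimensional F V]

theorem nilp_of_shift (h T : End F V) (c : F) (hc : c ≠ 0) (hT : h * T - T * h = c • T) :
    IsNilpotent T := by
  by_contra hn
  have hne : ∀ n : ℕ, T ^ n ≠ 0 := fun n hh => hn ⟨n, hh⟩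
  set A : End F (End F V) := LinearMap.mulLeft F h - LinearMap.mulRight F h
  have hpow : ∀ n : ℕ, h * T ^ n - T ^ n * h = ((n : F) * c) • T ^ n := by
    intro n
    induction n with
    | zero => simp
    | succ n ih =>
      have : h * T ^ (n+1) - T ^ (n+1) * h = (h * T ^ n - T ^ n * h) * T + T ^ n * (h * T - T * h) := by
        rw [pow_succ]; noncomm_ring
      rw [this, ih, hT, pow_succ]
      push_cast
      simp only [smul_mul_assoc, mul_smul_comm]
      rw [← add_smul]; ring_nf
  have hev : ∀ n : ℕ, A.HasEigenvalue ((n : F) * c) := by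
    intro n
    refine Module.End.hasEigenvalue_of_hasEigenvector (x := T ^ n) ⟨?_, hne n⟩
    rw [mei]
    simpa [A] using hpow n
  have hfin : Set.Finite {μ : F | A.HasEigenvalue μ} := Module.End.finite_hasEigenvalue A
  refine Set.infinite_of_injective_forall_mem (f := fun n : ℕ => (n : F) * c) ?_ hev hfin
  intro a b hab
  exact_mod_cast mul_right_cancel₀ hc hab

variable {e h f : End F V}

theorem sl2_comm_pow (hhf : h * f - f * h = (-2 : F) • f) (hef : e * f - f * e = h) (n : ℕ) :
    e * f ^ (n + 1) = f ^ (n + 1) * e + ((n : F) + 1) • (f ^ n * (h - (n : F) • 1)) := by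
  induction n with
  | zero => simp [← hef]
  | succ n ih =>
    have h1 : h * f = f * h + (-2 : F) • f := by rw [← hhf]; abel
    have h2 : e * f = f * e + h := by rw [← hef]; abel
    rw [pow_succ f (n+1), ← mul_assoc, ih, add_mul, mul_assoc _ e f, h2, smul_mul_assoc, mul_assoc _ _ f,
      sub_mul, h1, pow_succ f n]
    simp only [mul_add, mul_sub, smul_mul_assoc, mul_smul_comm, one_mul, mul_one, mul_assoc, pow_succ]
    push_cast
    simp only [smul_add, smul_sub, smul_smul, mul_assoc]
    module

theorem sl2_prim_pow (hhe : h * e - e * h = (2 : F) • e) (hhf : h * f - f * h = (-2 : F) • f)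
    (hef : e * f - f * e = h) (n : ℕ) (w : V) (hw : e w = 0) :
    (e ^ n * f ^ n) w = (n.factorial : F) • (Polynomial.aeval h (∏ k ∈ Finset.range n,
      (Polynomial.X - Polynomial.C (k : F)))) w := by
  induction n generalizing w with
  | zero => simp
  | succ n ih =>
    have hew : e (h w) = 0 := by
      have := congrArg (fun T : End F V => T w) hhe
      simpa [hw] using this
    have h1 := congrArg (fun T : End F V => T w) (sl2_comm_pow hhf hef n)
    have h2 := ih ((h - (n : F) • 1) w) (by simp [hw, hew])
    rw [pow_succ e n, mul_assoc, ema, h1]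
    simp only [lad, ema, lsm, map_smul, hw,
      map_zero, zero_add] at h2 ⊢
    rw [h2, Finset.prod_range_succ, map_mul, smul_smul, Nat.factorial_succ]
    push_cast
    have h3 : (Polynomial.aeval h) (Polynomial.X - Polynomial.C (n : F)) = h - (n : F) • 1 := by
      rw [map_sub, Polynomial.aeval_X, Polynomial.aeval_C, aes]
    rw [h3, ema]

theorem sl2_prim (hhe : h * e - e * h = (2 : F) • e) (hhf : h * f - f * h = (-2 : F) • f)
    (hef : e * f - f * e = h) (i : F) (w : V) (hw : e w = 0) (hw0 : w ≠ 0)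
    (hi : w ∈ h.maxGenEigenspace i) : (∃ n : ℕ, i = n) ∧ h w = i • w := by
  obtain ⟨N, hN⟩ := nilp_of_shift h f (-2) (by norm_num) hhf
  obtain ⟨M, hM⟩ := (mge _ _ _).1 hi
  have hP := sl2_prim_pow hhe hhf hef N w hw
  rw [hN] at hP
  simp only [mul_zero, LinearMap.zero_apply] at hP
  have hP := (smul_eq_zero.1 hP.symm).resolve_left (by exact_mod_cast N.factorial_ne_zero)
  have hM' : Polynomial.aeval h ((Polynomial.X - Polynomial.C i) ^ M) w = 0 := by
    simpa [aes] using hM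
  have key : ∀ (Q : Polynomial F) (u : V), IsCoprime ((Polynomial.X - Polynomial.C i) ^ M) Q →
      Polynomial.aeval h ((Polynomial.X - Polynomial.C i) ^ M) u = 0 →
      Polynomial.aeval h Q u = 0 → u = 0 := by
    rintro Q u ⟨a, b, hab⟩ h1 h2
    have := congrArg (fun P => Polynomial.aeval h P u) hab
    simp only [map_add, map_mul, lad, ema, h1, h2, map_zero,
      map_one, Module.End.one_apply, add_zero] at this
    exact this.symm
  have cop : ∀ s : Finset ℕ, (∀ k ∈ s, i ≠ k) → IsCoprime ((Polynomial.X - Polynomial.C i) ^ M)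
      (∏ k ∈ s, (Polynomial.X - Polynomial.C (k : F))) := by
    intro s hs
    refine IsCoprime.prod_right fun k hk => IsCoprime.pow_left ?_
    exact Polynomial.isCoprime_X_sub_C_of_isUnit_sub (sub_ne_zero.2 (hs k hk)).isUnit
  have hex : ∃ k ∈ Finset.range N, i = k := by
    by_contra hcon
    push Not at hcon
    exact hw0 (key _ _ (cop _ hcon) hM' hP)
  obtain ⟨k, hk, rfl⟩ := hex
  refine ⟨⟨k, rfl⟩, ?_⟩
  rw [← Finset.mul_prod_erase _ _ hk, mul_comm, map_mul, ema] at hP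
  have := key _ _ (cop ((Finset.range N).erase k) ?_) ?_ hP
  · rw [map_sub, Polynomial.aeval_X, Polynomial.aeval_C, aes,
      lsb, lsm, Module.End.one_apply, sub_eq_zero] at this
    exact this
  · intro j hj hkj
    exact (Finset.ne_of_mem_erase hj) (by exact_mod_cast hkj.symm)
  · rw [← ema, ← map_mul, mul_comm, map_mul, ema, hM', map_zero]

theorem sl2_diag [IsAlgClosed F] (hhe : h * e - e * h = (2 : F) • e)
    (hhf : h * f - f * h = (-2 : F) • f)
    (hef : e * f - f * e = h) : ⨆ n : ℤ, h.eigenspace (n : F) = ⊤ := by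
  set Om : End F V := (4 : F) • (f * e) + h * h + (2 : F) • h with hOm
  have h1 : h * e = e * h + (2 : F) • e := by rw [← hhe]; abel
  have h1f : h * f = f * h + (-2 : F) • f := by rw [← hhf]; abel
  have h2 : e * f = f * e + h := by rw [← hef]; abel
  have hOh : Commute Om h := by
    change Om * h = h * Om
    have : h * (f * e) = f * e * h := by
      rw [← mul_assoc, h1f, add_mul, mul_assoc, h1]; simp [mul_add, mul_assoc]
    simp only [hOm, add_mul, mul_add, smul_mul_assoc, mul_smul_comm, this, mul_assoc]
  have hOe : Commute Om e := by
    change Om * e = e * Om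
    have a1 : e * (f * e) = f * e * e + h * e := by rw [← mul_assoc, h2]; simp [add_mul]
    have a2 : e * h = h * e - (2 : F) • e := by rw [h1]; abel
    have a3 : e * (h * h) = h * h * e - (4 : F) • (h * e) + (4 : F) • e := by
      rw [← mul_assoc, a2, sub_mul, mul_assoc, a2, smul_mul_assoc, a2]
      simp only [mul_sub, mul_smul_comm, smul_sub, smul_smul, mul_assoc]
      module
    simp only [hOm, add_mul, mul_add, smul_mul_assoc, mul_smul_comm, a1, a3]
    rw [a2]
    module
  obtain ⟨Ne, hNe⟩ := nilp_of_shift h e 2 (by norm_num) hhe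
  have shift : ∀ (i : F) (w : V), w ∈ h.maxGenEigenspace i → e w ∈ h.maxGenEigenspace (i + 2) := by
    intro i w hw
    obtain ⟨k, hk⟩ := (mge _ _ _).1 hw
    refine (mge _ _ _).2 ⟨k, ?_⟩
    have hc : (h - (i + 2) • (1 : End F V)) * e = e * (h - i • 1) := by
      rw [sub_mul, h1, mul_sub, smul_mul_assoc, one_mul, mul_smul_comm, mul_one]; module
    have hc' : ∀ k, (h - (i + 2) • (1 : End F V)) ^ k * e = e * (h - i • 1) ^ k := by
      intro k
      induction k with
      | zero => simp
      | succ k ih => rw [pow_succ, mul_assoc, hc, ← mul_assoc, ih, mul_assoc, ← pow_succ]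
    rw [← ema, hc', ema, hk, map_zero]
  have fact1 : ∀ (c i : F) (w : V), w ∈ Om.maxGenEigenspace c → w ∈ h.maxGenEigenspace i →
      w ≠ 0 → e w = 0 → ∃ n : ℕ, i = n ∧ c = n * (n + 2) ∧ h w = i • w := by
    intro c i w hc hi hw0 hw
    obtain ⟨⟨n, hn⟩, hh⟩ := sl2_prim hhe hhf hef i w hw hw0 hi
    refine ⟨n, hn, ?_, hh⟩
    have hOw : Om w = ((n : F) * (n + 2)) • w := by
      simp only [hOm, lad, lsm, ema, hw, hh,
        map_smul, map_zero, smul_zero, hn]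
      module
    obtain ⟨k, hk⟩ := (mge _ _ _).1 hc
    have : ∀ k, ((Om - c • (1 : End F V)) ^ k) w = ((n : F) * (n + 2) - c) ^ k • w := by
      intro k
      induction k with
      | zero => simp
      | succ k ih =>
        rw [pow_succ', ema, ih, map_smul]
        simp only [lsb, lsm, Module.End.one_apply, hOw]
        rw [← sub_smul, smul_smul, pow_succ]
    rw [this] at hk
    have := (smul_eq_zero.1 hk).resolve_right hw0
    exact (sub_eq_zero.1 (eq_zero_of_pow_eq_zero this)).symm
  have fact2 : ∀ (c : F) (k : ℕ) (i : F) (w : V), w ∈ Om.maxGenEigenspace c →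
      w ∈ h.maxGenEigenspace i → w ≠ 0 → (e ^ k) w = 0 →
      h w = i • w ∧ ∃ (n m : ℕ), i + 2 * m = n ∧ c = n * (n + 2) ∧ (e w ≠ 0 → m ≠ 0) := by
    intro c k
    induction k with
    | zero => intro i w _ _ hw0 hk; exact absurd (by simpa using hk) hw0
    | succ k ih =>
      intro i w hc hi hw0 hk
      by_cases hew : e w = 0
      · obtain ⟨n, hn, hcn, hh⟩ := fact1 c i w hc hi hw0 hew
        exact ⟨hh, n, 0, by simp [hn], hcn, fun h => absurd hew h⟩
      · have hc' : e w ∈ Om.maxGenEigenspace c :=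
          Module.End.mapsTo_maxGenEigenspace_of_comm hOe c hc
        obtain ⟨hh, n, m, hnm, hcn, -⟩ := ih (i + 2) (e w) hc' (shift i w hi) hew
          (by rwa [pow_succ] at hk)
        refine ⟨?_, n, m + 1, by rw [← hnm]; push_cast; ring, hcn, fun _ => by simp⟩
        by_contra hne
        set u := h w - i • w with hu
        have hu0 : u ≠ 0 := sub_ne_zero.2 hne
        have heu : e u = 0 := by
          have := congrArg (fun T : End F V => T w) h1
          simp only [ema, lad, lsm] at this
          rw [hu, map_sub, map_smul]
          rw [hh] at this
          rw [eq_sub_of_add_eq this.symm]; module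
        have huc : u ∈ Om.maxGenEigenspace c := sub_mem
          (Module.End.mapsTo_maxGenEigenspace_of_comm hOh c hc) (ssm _ _ hc)
        have hui : u ∈ h.maxGenEigenspace i := sub_mem
          (Module.End.mapsTo_maxGenEigenspace_of_comm (Commute.refl h) i hi)
          (ssm _ _ hi)
        obtain ⟨n', hn', hcn', -⟩ := fact1 c i u huc hui hu0 heu
        rw [hn'] at hnm
        have e1 : n' + 2 + 2 * m = n := by exact_mod_cast hnm
        have e2 : n * (n + 2) = n' * (n' + 2) := by
          have := hcn.symm.trans hcn'
          exact_mod_cast this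
        nlinarith
  have htop : ∀ c, Om.maxGenEigenspace c ≤ ⨆ n : ℤ, h.eigenspace (n : F) := by
    intro c
    rw [Submodule.eq_iSup_inf_genEigenspace (f := h) (p := Om.maxGenEigenspace c) ⊤
      (fun x hx => Module.End.mapsTo_maxGenEigenspace_of_comm hOh c hx)
      (Module.End.iSup_maxGenEigenspace_eq_top h)]
    refine iSup_le fun i w hw => ?_
    by_cases hw0 : w = 0
    · rw [hw0]; exact zero_mem _
    obtain ⟨hh, n, m, hnm, -, -⟩ := fact2 c Ne i w hw.1 hw.2 hw0 (by simp [hNe])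
    have : i = ((n - 2 * m : ℤ) : F) := by push_cast; rw [← hnm]; ring
    refine mis (n - 2 * m : ℤ) ?_
    rw [mei, hh, this]
  rw [eq_top_iff, ← Module.End.iSup_maxGenEigenspace_eq_top Om]
  exact iSup_le htop

end sl2ops

section sl2ops2
variable {F : Type*} [Field F] [CharZero F] {V : Type*} [AddCommGroup V] [Module F V]
  [FiniteDimensional F V] {e h f : End F V}

theorem sl2_neg (hhe : h * e - e * h = (2 : F) • e) (hhf : h * f - f * h = (-2 : F) • f)
    (hef : e * f - f * e = h) :
    (-h) * f - f * (-h) = (2 : F) • f ∧ (-h) * e - e * (-h) = (-2 : F) • e ∧ f * e - e * f = -h := by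
  refine ⟨?_, ?_, ?_⟩
  · rw [neg_mul, mul_neg, neg_sub_neg, ← neg_sub, hhf]; module
  · rw [neg_mul, mul_neg, neg_sub_neg, ← neg_sub, hhe]; module
  · rw [← hef]; abel

theorem eig_neg (h : End F V) (m : ℤ) (w : V) :
    w ∈ (-h).eigenspace ((m : ℤ) : F) ↔ w ∈ h.eigenspace ((-m : ℤ) : F) := by
  rw [mei, mei]
  push_cast
  rw [LinearMap.neg_apply, neg_smul, neg_eq_iff_eq_neg]

theorem sl2_e_mem (hhe : h * e - e * h = (2 : F) • e) (m : ℤ) (w : V)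
    (hw : w ∈ h.eigenspace (m : F)) : e w ∈ h.eigenspace ((m + 2 : ℤ) : F) := by
  rw [mei] at hw ⊢
  have := congrArg (fun T : End F V => T w) hhe
  simp only [lsb, ema, hw, lsm, map_smul] at this
  rw [sub_eq_iff_eq_add] at this
  rw [this]; push_cast; module

theorem sl2_f_mem (hhf : h * f - f * h = (-2 : F) • f) (m : ℤ) (w : V)
    (hw : w ∈ h.eigenspace (m : F)) : f w ∈ h.eigenspace ((m - 2 : ℤ) : F) := by
  rw [mei] at hw ⊢
  have := congrArg (fun T : End F V => T w) hhf
  simp only [lsb, ema, hw, lsm, map_smul] at this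
  rw [sub_eq_iff_eq_add] at this
  rw [this]; push_cast; module

/-- on weights `m ≤ -1`, `f e` is injective -/
theorem sl2_fe_inj (hhe : h * e - e * h = (2 : F) • e) (hhf : h * f - f * h = (-2 : F) • f)
    (hef : e * f - f * e = h) (m : ℤ) (hm : m ≤ -1) (w : V)
    (hw : w ∈ h.eigenspace (m : F)) (h0 : f (e w) = 0) : w = 0 := by
  obtain ⟨N, hN⟩ := nilp_of_shift h f (-2) (by norm_num) hhf
  rw [mei] at hw
  have key : ∀ n : ℕ, e ((f ^ (n + 1)) w) = (((n : F) + 1) * (m - n)) • (f ^ n) w := by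
    intro n
    have h1 := congrArg (fun T : End F V => T w) (sl2_comm_pow hhf hef n)
    have h2 : (f ^ (n + 1)) (e w) = 0 := by rw [pow_succ, ema, h0, map_zero]
    simp only [ema, lad, lsm, h2,
      lsb, hw, Module.End.one_apply, zero_add] at h1
    rw [h1, ← sub_smul, map_smul, smul_smul]
  have : ∀ n : ℕ, (f ^ n) w = 0 → w = 0 := by
    intro n
    induction n with
    | zero => simp
    | succ n ih =>
      intro hn
      have h1 := key n
      rw [hn, map_zero] at h1
      refine ih ((smul_eq_zero.1 h1.symm).resolve_left ?_)
      refine mul_ne_zero (by exact_mod_cast n.succ_ne_zero) ?_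
      have : (m - n : ℤ) ≠ 0 := by omega
      exact_mod_cast this
  exact this N (by rw [hN]; rfl)

/-- on weights `m ≤ -1`, `f e` is surjective -/
theorem sl2_fe_surj (hhe : h * e - e * h = (2 : F) • e) (hhf : h * f - f * h = (-2 : F) • f)
    (hef : e * f - f * e = h) (m : ℤ) (hm : m ≤ -1) (w : V)
    (hw : w ∈ h.eigenspace (m : F)) : ∃ y ∈ h.eigenspace (m : F), f (e y) = w := by
  have hmap : ∀ x ∈ h.eigenspace (m : F), (f * e) x ∈ h.eigenspace (m : F) := by
    intro x hx
    have := sl2_f_mem hhf _ _ (sl2_e_mem hhe m x hx)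
    simpa using this
  have hinj : Function.Injective ((f * e).restrict hmap) := by
    rw [injective_iff_map_eq_zero]
    rintro ⟨x, hx⟩ h0
    have : f (e x) = 0 := by simpa using congrArg Subtype.val h0
    exact Subtype.ext (sl2_fe_inj hhe hhf hef m hm x hx this)
  obtain ⟨⟨y, hy⟩, h2⟩ := LinearMap.surjective_of_injective hinj ⟨w, hw⟩
  exact ⟨y, hy, by simpa using congrArg Subtype.val h2⟩

theorem sl2_e_inj (hhe : h * e - e * h = (2 : F) • e) (hhf : h * f - f * h = (-2 : F) • f)
    (hef : e * f - f * e = h) (m : ℤ) (hm : m ≤ -1) (w : V)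
    (hw : w ∈ h.eigenspace (m : F)) (h0 : e w = 0) : w = 0 :=
  sl2_fe_inj hhe hhf hef m hm w hw (by rw [h0, map_zero])

theorem sl2_f_surj (hhe : h * e - e * h = (2 : F) • e) (hhf : h * f - f * h = (-2 : F) • f)
    (hef : e * f - f * e = h) (m : ℤ) (hm : m ≤ -1) (w : V)
    (hw : w ∈ h.eigenspace (m : F)) : ∃ y ∈ h.eigenspace ((m + 2 : ℤ) : F), f y = w := by
  obtain ⟨y, hy, h1⟩ := sl2_fe_surj hhe hhf hef m hm w hw
  exact ⟨e y, sl2_e_mem hhe m y hy, h1⟩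

theorem sl2_f_inj (hhe : h * e - e * h = (2 : F) • e) (hhf : h * f - f * h = (-2 : F) • f)
    (hef : e * f - f * e = h) (m : ℤ) (hm : 1 ≤ m) (w : V)
    (hw : w ∈ h.eigenspace (m : F)) (h0 : f w = 0) : w = 0 := by
  obtain ⟨a, b, c⟩ := sl2_neg hhe hhf hef
  exact sl2_e_inj a b c (-m) (by omega) w ((eig_neg h _ w).2 (by simpa using hw)) h0

theorem sl2_e_surj (hhe : h * e - e * h = (2 : F) • e) (hhf : h * f - f * h = (-2 : F) • f)
    (hef : e * f - f * e = h) (m : ℤ) (hm : 1 ≤ m) (w : V)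
    (hw : w ∈ h.eigenspace (m : F)) : ∃ y ∈ h.eigenspace ((m - 2 : ℤ) : F), e y = w := by
  obtain ⟨a, b, c⟩ := sl2_neg hhe hhf hef
  obtain ⟨y, hy, h1⟩ :=
    sl2_f_surj a b c (-m) (by omega) w ((eig_neg h _ w).2 (by simpa using hw))
  refine ⟨y, ?_, h1⟩
  have := (eig_neg h _ y).1 hy
  convert this using 3; ring

/-- slice decomposition in weights `k ≤ 0` -/
theorem sl2_slice (hhe : h * e - e * h = (2 : F) • e) (hhf : h * f - f * h = (-2 : F) • f)
    (hef : e * f - f * e = h) (k : ℤ) (hk : k ≤ 0) (w : V)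
    (hw : w ∈ h.eigenspace (k : F)) : ∃ y ∈ h.eigenspace ((k - 2 : ℤ) : F), f (w - e y) = 0 := by
  obtain ⟨y, hy, h1⟩ := sl2_fe_surj hhe hhf hef (k - 2) (by omega) (f w) (sl2_f_mem hhf _ _ hw)
  exact ⟨y, hy, by rw [map_sub, h1, sub_self]⟩

/-- if `ker e` and `ker h` have the same dimension, then odd weights vanish. -/
theorem sl2_even (hhe : h * e - e * h = (2 : F) • e) (hhf : h * f - f * h = (-2 : F) • f)
    (hef : e * f - f * e = h)
    (hd : finrank F (LinearMap.ker e) ≤ finrank F (LinearMap.ker h))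
    (k : ℤ) (w : V) (hw : w ∈ h.eigenspace ((2 * k + 1 : ℤ) : F)) : w = 0 := by
  have h1 : h.eigenspace ((1 : ℤ) : F) = ⊥ := by
    set P : Submodule F V := ⨆ n : ℕ, h.eigenspace (((n : ℤ) + 2 : ℤ) : F) with hP
    set V0 := h.eigenspace ((0 : ℤ) : F)
    set V1 := h.eigenspace ((1 : ℤ) : F)
    have ind : iSupIndep fun n : ℤ => h.eigenspace (n : F) :=
      (Module.End.eigenspaces_iSupIndep h).comp (f := fun n : ℤ => (n : F)) Int.cast_injective
    have d1 : V1 ⊓ P = ⊥ := by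
      refine (ind 1).mono_right ?_ |>.eq_bot
      exact iSup_le fun n => le_iSup₂_of_le ((n : ℤ) + 2) (by omega) le_rfl
    have d0 : V0 ⊓ (V1 ⊔ P) = ⊥ := by
      refine (ind 0).mono_right ?_ |>.eq_bot
      refine sup_le (le_iSup₂_of_le 1 (by omega) le_rfl) ?_
      exact iSup_le fun n => le_iSup₂_of_le ((n : ℤ) + 2) (by omega) le_rfl
    have f1 := Submodule.finrank_sup_add_finrank_inf_eq V1 P
    have f0 := Submodule.finrank_sup_add_finrank_inf_eq V0 (V1 ⊔ P)
    rw [d1, finrank_bot] at f1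
    rw [d0, finrank_bot] at f0
    set Q := V0 ⊔ (V1 ⊔ P)
    have hmap : Q ≤ P.comap e := by
      refine sup_le ?_ (sup_le ?_ ?_)
      · intro x hx
        exact mis 0 (by simpa using sl2_e_mem hhe _ x hx)
      · intro x hx
        refine mis 1 ?_
        have := sl2_e_mem hhe _ x hx
        convert this using 3
        norm_num
      · refine iSup_le fun n x hx => ?_
        refine mis (n + 2) ?_
        have := sl2_e_mem hhe _ x hx
        convert this using 3
        push_cast; ring
    have hr := LinearMap.finrank_range_add_finrank_ker (e.restrict (p := Q) (q := P) hmap)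
    have hr1 := Submodule.finrank_le (LinearMap.range (e.restrict (p := Q) (q := P) hmap))
    have hr2 : finrank F (LinearMap.ker (e.restrict (p := Q) (q := P) hmap)) ≤
        finrank F (LinearMap.ker e) := by
      refine LinearMap.finrank_le_finrank_of_injective (f := LinearMap.codRestrict _
        (Q.subtype ∘ₗ (LinearMap.ker (e.restrict (p := Q) (q := P) hmap)).subtype) ?_) ?_
      · rintro ⟨x, hx⟩
        have := congrArg Subtype.val (LinearMap.mem_ker.1 hx)
        simpa using this
      · intro a b hab
        have := congrArg Subtype.val hab
        exact Subtype.ext (Subtype.ext this)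
    have hk0 : finrank F (LinearMap.ker h) = finrank F V0 := by
      have : LinearMap.ker h = V0 := by
        ext x; rw [LinearMap.mem_ker, mei]; simp
      rw [this]
    have : finrank F V1 = 0 := by omega
    exact Submodule.finrank_eq_zero.1 this
  have pos : ∀ n : ℕ, ∀ w ∈ h.eigenspace ((2 * n + 1 : ℤ) : F), w = 0 := by
    intro n
    induction n with
    | zero =>
      intro w hw
      have hw' : w ∈ h.eigenspace ((1 : ℤ) : F) := by convert hw using 3; norm_num
      rw [h1] at hw'; exact hw'
    | succ n ih =>
      intro w hw
      obtain ⟨y, hy, hyw⟩ := sl2_e_surj hhe hhf hef _ (by omega) w hw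
      rw [← hyw, ih y, map_zero]
      convert hy using 3; push_cast; ring
  have neg : ∀ n : ℕ, ∀ w ∈ h.eigenspace ((1 - 2 * n : ℤ) : F), w = 0 := by
    intro n
    induction n with
    | zero =>
      intro w hw
      have hw' : w ∈ h.eigenspace ((1 : ℤ) : F) := by convert hw using 3; norm_num
      rw [h1] at hw'; exact hw'
    | succ n ih =>
      intro w hw
      refine sl2_e_inj hhe hhf hef _ (by push_cast; omega) w hw (ih _ ?_)
      have := sl2_e_mem hhe _ w hw
      convert this using 3; push_cast; ring
  rcases le_total 0 k with hk | hk
  · obtain ⟨n, rfl⟩ := izl hk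
    exact pos n w hw
  · obtain ⟨n, hn⟩ := izl (neg_nonneg.2 hk)
    refine neg n w ?_
    convert hw using 3; omega

end sl2ops2

section cartan
variable {F : Type*} [Field F] [CharZero F] [IsAlgClosed F]
    {g : Type*} [LieRing g] [LieAlgebra F g] [FiniteDimensional F g]

theorem mem_cent {F : Type*} [Field F] {L : Type*} [LieRing L] [LieAlgebra F L] {x y : L} :
    y ∈ cent F L x ↔ ⁅x, y⁆ = 0 := Iff.rfl

theorem isRegular_le {x : g} (hx : isRegular F g x) (z : g) :
    finrank F (cent F g x) ≤ finrank F (cent F g z) := by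
  rw [hx]; exact Nat.sInf_le ⟨z, rfl⟩

theorem ad_sl2 {e h f : g} (hhe : ⁅h, e⁆ = 2 • e) (hhf : ⁅h, f⁆ = -(2 • f)) (hef : ⁅e, f⁆ = h) :
    ad F g h * ad F g e - ad F g e * ad F g h
      = (2 : F) • ad F g e ∧
    ad F g h * ad F g f - ad F g f * ad F g h
      = (-2 : F) • ad F g f ∧
    ad F g e * ad F g f - ad F g f * ad F g e
      = ad F g h := by
  refine ⟨?_, ?_, ?_⟩ <;> ext y <;> simp only [lsb, ema,
    adp, lsm]
  · rw [← lie_lie, hhe, two_smul, two_smul, add_lie]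
  · rw [← lie_lie, hhf, neg_lie, neg_smul, two_smul, two_smul, add_lie]
  · rw [← lie_lie, hef]

theorem gen_eq_eig {V : Type*} [AddCommGroup V] [Module F V] (T : End F V)
    (hdiag : ⨆ n : ℤ, T.eigenspace (n : F) = ⊤) : T.maxGenEigenspace 0 = T.eigenspace 0 := by
  have ind := Module.End.independent_maxGenEigenspace T
  have hle : (fun μ : F => T.eigenspace μ) ≤ fun μ => T.maxGenEigenspace μ := fun μ =>
    (T.genEigenspace μ).monotone le_top
  have htop : ⨆ μ : F, T.eigenspace μ = ⊤ := by
    rw [eq_top_iff, ← hdiag]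
    exact iSup_le fun n => le_iSup (fun μ : F => T.eigenspace μ) (n : F)
  exact (congr_fun ((ind.le_iff_eq_of_iSup_eq_top htop).1 hle) 0).symm

set_option maxHeartbeats 1000000 in
theorem cartan_exists [LieAlgebra.IsSemisimple F g] {h : g}
    (hdiag : ⨆ n : ℤ, (ad F g h).eigenspace (n : F) = ⊤)
    (hreg : isRegular F g h) :
    ∃ H : LieSubalgebra F g, H.IsCartanSubalgebra ∧ ∀ y, y ∈ H ↔ ⁅h, y⁆ = 0 := by
  have hmem : ∀ y, y ∈ LieSubalgebra.engel F h ↔ ⁅h, y⁆ = 0 := by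
    intro y
    constructor
    · intro hy
      have hy' : y ∈ (ad F g h).maxGenEigenspace 0 := hy
      rw [gen_eq_eig _ hdiag, mei, zero_smul] at hy'
      exact hy'
    · intro hy
      rw [LieSubalgebra.mem_engel_iff]
      exact ⟨1, by simpa using hy⟩
  have heng : finrank F (LieSubalgebra.engel F h) = finrank F (cent F g h) := by
    have : (LieSubalgebra.engel F h).toSubmodule = cent F g h := by
      ext y; exact hmem y
    rw [← this]; rfl
  haveI : Infinite F := inferInstance
  have card : (finrank F g : Cardinal) ≤ Cardinal.mk F :=
    Cardinal.natCast_le_aleph0.trans <| Cardinal.infinite_iff.mp ‹Infinite F›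
  have key : ∀ x : g, LieAlgebra.IsRegular F x →
      (LieSubalgebra.engel F x).IsCartanSubalgebra := by
    intro x hx
    refine ⟨?_, LieSubalgebra.normalizer_engel _ _⟩
    apply LieSubalgebra.isNilpotent_of_forall_le_engel
    intro y hy
    set Ex : {LieSubalgebra.engel F z | z ∈ LieSubalgebra.engel F x} :=
      ⟨LieSubalgebra.engel F x, x, LieSubalgebra.self_mem_engel _ _, rfl⟩
    suffices IsBot Ex from @this ⟨LieSubalgebra.engel F y, y, hy, rfl⟩
    apply LieAlgebra.engel_isBot_of_isMin card (LieSubalgebra.engel F x) Ex le_rfl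
    rintro ⟨_, y, hy, rfl⟩ hyx
    suffices finrank F (LieSubalgebra.engel F x) ≤ finrank F (LieSubalgebra.engel F y) by
      suffices LieSubalgebra.engel F y = LieSubalgebra.engel F x from this.ge
      apply LieSubalgebra.toSubmodule_injective
      exact Submodule.eq_of_le_of_finrank_le hyx this
    rw [(LieAlgebra.isRegular_iff_finrank_engel_eq_rank F x).mp hx]
    apply LieAlgebra.rank_le_finrank_engel
  refine ⟨_, key h ?_, hmem⟩
  rw [LieAlgebra.isRegular_iff_finrank_engel_eq_rank]
  refine le_antisymm ?_ (LieAlgebra.rank_le_finrank_engel F h)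
  obtain ⟨x, hx⟩ := LieAlgebra.exists_isRegular F g
  haveI := key x hx
  rw [heng]
  refine (isRegular_le hreg x).trans ?_
  rw [← (LieAlgebra.isRegular_iff_finrank_engel_eq_rank F x).1 hx]
  refine Submodule.finrank_mono (s := cent F g x) (t := (LieSubalgebra.engel F x).toSubmodule) ?_
  intro y hy
  change y ∈ LieSubalgebra.engel F x
  rw [LieSubalgebra.mem_engel_iff]
  exact ⟨1, by simpa using mem_cent.1 hy⟩

theorem weight_decomp [LieAlgebra.IsSemisimple F g] (H : LieSubalgebra F g) [H.IsCartanSubalgebra]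
    (y : g) : ∃ c : LieModule.Weight F H g → g,
      (∀ χ, ∀ z : H, ⁅(z : g), c χ⁆ = χ z • c χ) ∧ ∑ χ, c χ = y := by
  have htop := LieModule.iSup_genWeightSpace_eq_top' F H g
  have hy : y ∈ ⨆ χ : LieModule.Weight F H g, (LieModule.genWeightSpace g χ).toSubmodule := by
    have := LieSubmodule.iSup_toSubmodule (fun χ : LieModule.Weight F H g => LieModule.genWeightSpace g χ)
    rw [← this, htop]; exact Submodule.mem_top
  obtain ⟨c, hc, hs⟩ := (Submodule.mem_iSup_iff_exists_finsupp _ _).1 hy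
  refine ⟨c, fun χ z => ?_, ?_⟩
  · exact LieAlgebra.IsKilling.lie_eq_smul_of_mem_rootSpace (hc χ) z
  · rw [← hs, Finsupp.sum_fintype c (fun _ xi => xi) (fun _ => rfl)]

theorem coroot_ne [LieAlgebra.IsSemisimple F g] (H : LieSubalgebra F g) [H.IsCartanSubalgebra]
    (α : H → F) (x y : g) (hx : ∀ z : H, ⁅(z : g), x⁆ = α z • x)
    (hy : ∀ z : H, ⁅(z : g), y⁆ = -α z • y) (hxy : ⁅x, y⁆ ∈ H) (h0 : α ⟨⁅x, y⁆, hxy⟩ = 0) :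
    ⁅x, y⁆ = 0 := by
  have mem : ∀ (β : H → F) (x : g), (∀ z : H, ⁅(z : g), x⁆ = β z • x) → x ∈ LieAlgebra.rootSpace H β := by
    intro β x hx
    rw [LieModule.mem_genWeightSpace]
    intro z
    refine ⟨1, ?_⟩
    have := hx z
    rw [pow_one, lsb, sub_eq_zero]
    exact this
  have := LieAlgebra.IsKilling.eq_zero_of_apply_eq_zero_of_mem_corootSpace (K := F) (L := g) (H := H)
    ⟨⁅x, y⁆, hxy⟩ α h0 ?_
  · exact congrArg Subtype.val this
  · rw [LieAlgebra.mem_corootSpace]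
    exact sss ⟨x, mem α x hx, y, mem (-α) y hy, rfl⟩

end cartan

/-- facts about a principal triple, in Lie-theoretic form. -/
structure PT (F : Type*) [Field F] {g : Type*} [LieRing g] [LieAlgebra F g] (e h f : g) : Prop where
  he : ⁅h, e⁆ = (2 : F) • e
  hf : ⁅h, f⁆ = (-2 : F) • f
  ef : ⁅e, f⁆ = h
  e_inj : ∀ (m : ℤ) (w : g), m ≤ -1 → ⁅h, w⁆ = (m : F) • w → ⁅e, w⁆ = 0 → w = 0
  f_inj : ∀ (m : ℤ) (w : g), 1 ≤ m → ⁅h, w⁆ = (m : F) • w → ⁅f, w⁆ = 0 → w = 0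
  e_surj : ∀ (m : ℤ) (w : g), 1 ≤ m → ⁅h, w⁆ = (m : F) • w →
    ∃ y, ⁅h, y⁆ = ((m - 2 : ℤ) : F) • y ∧ ⁅e, y⁆ = w
  f_surj : ∀ (m : ℤ) (w : g), m ≤ -1 → ⁅h, w⁆ = (m : F) • w →
    ∃ y, ⁅h, y⁆ = ((m + 2 : ℤ) : F) • y ∧ ⁅f, y⁆ = w
  slice : ∀ (k : ℤ) (w : g), k ≤ 0 → ⁅h, w⁆ = (k : F) • w →
    ∃ y, ⁅h, y⁆ = ((k - 2 : ℤ) : F) • y ∧ ⁅f, w - ⁅e, y⁆⁆ = 0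
  even : ∀ (k : ℤ) (w : g), ⁅h, w⁆ = ((2 * k + 1 : ℤ) : F) • w → w = 0
  diag : ∀ P : Submodule F g, (∀ (m : ℤ) (w : g), ⁅h, w⁆ = (m : F) • w → w ∈ P) → P = ⊤
  comm0 : ∀ y z : g, ⁅h, y⁆ = 0 → ⁅h, z⁆ = 0 → ⁅y, z⁆ = 0
  inj0 : ∀ z : g, ⁅h, z⁆ = 0 → ⁅e, z⁆ = 0 → z = 0

section pt
variable {F : Type*} [Field F] [CharZero F] [IsAlgClosed F]
    {g : Type*} [LieRing g] [LieAlgebra F g] [FiniteDimensional F g]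

theorem PT.of [LieAlgebra.IsSemisimple F g] {e h f : g} (hhe : ⁅h, e⁆ = 2 • e)
    (hhf : ⁅h, f⁆ = -(2 • f)) (hef : ⁅e, f⁆ = h) (re : isRegular F g e) (rh : isRegular F g h) :
    PT F e h f := by
  obtain ⟨a, b, c⟩ := ad_sl2 (F := F) hhe hhf hef
  have mem : ∀ (m : ℤ) (w : g), w ∈ (ad F g h).eigenspace (m : F) ↔ ⁅h, w⁆ = (m : F) • w :=
    fun m w => mei
  have hdiag := sl2_diag a b c
  have d : ∀ P : Submodule F g, (∀ (m : ℤ) (w : g), ⁅h, w⁆ = (m : F) • w → w ∈ P) → P = ⊤ := by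
    intro P hP
    rw [eq_top_iff, ← hdiag]
    exact iSup_le fun n w hw => hP n w ((mem n w).1 hw)
  have ei : ∀ (m : ℤ) (w : g), m ≤ -1 → ⁅h, w⁆ = (m : F) • w → ⁅e, w⁆ = 0 → w = 0 :=
    fun m w hm hw h0 => sl2_e_inj a b c m hm w ((mem m w).2 hw) h0
  have es : ∀ (m : ℤ) (w : g), 1 ≤ m → ⁅h, w⁆ = (m : F) • w →
    ∃ y, ⁅h, y⁆ = ((m - 2 : ℤ) : F) • y ∧ ⁅e, y⁆ = w := fun m w hm hw => by
      obtain ⟨y, hy, h1⟩ := sl2_e_surj a b c m hm w ((mem m w).2 hw)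
      exact ⟨y, (mem _ y).1 hy, h1⟩
  have fs : ∀ (m : ℤ) (w : g), m ≤ -1 → ⁅h, w⁆ = (m : F) • w →
    ∃ y, ⁅h, y⁆ = ((m + 2 : ℤ) : F) • y ∧ ⁅f, y⁆ = w := fun m w hm hw => by
      obtain ⟨y, hy, h1⟩ := sl2_f_surj a b c m hm w ((mem m w).2 hw)
      exact ⟨y, (mem _ y).1 hy, h1⟩
  have ker : ∀ x : g, LinearMap.ker (ad F g x) = cent F g x := fun x => by
    ext y; simp [mem_cent]
  have ev : ∀ (k : ℤ) (w : g), ⁅h, w⁆ = ((2 * k + 1 : ℤ) : F) • w → w = 0 := fun k w hw =>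
    sl2_even a b c (by rw [ker, ker]; exact isRegular_le re h) k w ((mem _ w).2 hw)
  obtain ⟨H, hH, hHm⟩ := cartan_exists hdiag rh
  have comm : ∀ y z : g, ⁅h, y⁆ = 0 → ⁅h, z⁆ = 0 → ⁅y, z⁆ = 0 := fun y z hy hz => by
    have := LieAlgebra.IsKilling.instIsLieAbelianOfIsCartanSubalgebra F g H
    have := trivial_lie_zero H H ⟨y, (hHm y).2 hy⟩ ⟨z, (hHm z).2 hz⟩
    exact congrArg Subtype.val this
  refine ⟨by rw [hhe, two_smul, two_smul], by rw [hhf, neg_smul, two_smul, two_smul], hef, ei,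
    fun m w hm hw h0 => sl2_f_inj a b c m hm w ((mem m w).2 hw) h0, es, fs, fun k w hk hw => ?_, ev, d,
    comm, fun z hz hez => ?_⟩
  · obtain ⟨y, hy, h1⟩ := sl2_slice a b c k hk w ((mem k w).2 hw)
    exact ⟨y, (mem _ y).1 hy, h1⟩
  · have hfz : ⁅f, z⁆ = 0 := by
      refine ei (-2) _ (by norm_num) ?_ ?_
      · rw [leibniz_lie, hz, lie_zero, add_zero, hhf, neg_lie, nsmul_lie, ← Nat.cast_smul_eq_nsmul F]
        push_cast; module
      · rw [leibniz_lie, hef, hez, lie_zero, hz, add_zero]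
    have key : ∀ n : ℕ, (∀ w : g, ⁅h, w⁆ = ((2 * n : ℤ) : F) • w → ⁅z, w⁆ = 0) ∧
        (∀ w : g, ⁅h, w⁆ = ((-(2 * n) : ℤ) : F) • w → ⁅z, w⁆ = 0) := by
      intro n
      induction n with
      | zero => exact ⟨fun w hw => comm z w hz (by simpa using hw), fun w hw => comm z w hz (by simpa using hw)⟩
      | succ n ih =>
        refine ⟨fun w hw => ?_, fun w hw => ?_⟩
        · obtain ⟨y, hy, rfl⟩ := es _ w (by push_cast; omega) hw
          rw [leibniz_lie, ih.1 y (by rw [hy]; congr 2; push_cast; ring), ← lie_skew z e, hez]; simp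
        · obtain ⟨y, hy, rfl⟩ := fs _ w (by push_cast; omega) hw
          rw [leibniz_lie, ih.2 y (by rw [hy]; congr 2; push_cast; ring), ← lie_skew z f, hfz]; simp
    have hall : cent F g z = ⊤ := by
      apply d
      intro m w hw
      rw [mem_cent]
      rcases Int.even_or_odd' m with ⟨k, rfl | rfl⟩
      · rcases Int.eq_nat_or_neg k with ⟨n, rfl | rfl⟩
        · exact (key n).1 w hw
        · exact (key n).2 w (by rw [hw]; congr 2; ring)
      · rw [ev k w hw, lie_zero]
    have : z ∈ LieAlgebra.center F g := by
      rw [LieModule.mem_maxTrivSubmodule]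
      intro x
      rw [← lie_skew, mem_cent.1 (by rw [hall]; trivial : x ∈ cent F g z), neg_zero]
    rwa [LieAlgebra.center_eq_bot, LieSubmodule.mem_bot] at this

end pt

section pd
variable {F : Type*} [Field F] [CharZero F] [IsAlgClosed F]
    {g : Type*} [LieRing g] [LieAlgebra F g] [FiniteDimensional F g]

theorem wt_li [LieAlgebra.IsSemisimple F g] (H : LieSubalgebra F g) [H.IsCartanSubalgebra]
    (x : LieModule.Weight F H g → g) (hx : ∀ χ, ∀ z : H, ⁅(z : g), x χ⁆ = χ z • x χ)
    (s : Finset (LieModule.Weight F H g))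
    (h0 : ∑ χ ∈ s, x χ = 0) (χ) (hχ : χ ∈ s) : x χ = 0 := by
  have ind := LieModule.iSupIndep_genWeightSpace' F H g
  rw [← LieSubmodule.iSupIndep_toSubmodule, iSupIndep_iff_finsetSum_eq_zero_imp_eq_zero] at ind
  refine ind s x (fun i _ => ?_) h0 χ hχ
  change x i ∈ LieModule.genWeightSpace g i
  rw [LieModule.mem_genWeightSpace]
  intro z
  refine ⟨1, ?_⟩
  rw [pow_one, lsb, sub_eq_zero]
  exact hx i z

set_option maxHeartbeats 1000000 in
theorem pd1 [LieAlgebra.IsSemisimple F g] {e h f : g} (T : PT F e h f) (rh : isRegular F g h) :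
    ∃ (r : ℕ) (w ee ff : Fin r → g), (∀ i, ⁅h, w i⁆ = 0) ∧
      (∀ i j, ⁅w i, ee j⁆ = if i = j then ee j else 0) ∧
      (∀ i j, ⁅w i, ff j⁆ = if i = j then - ff j else 0) ∧ (∀ i, ee i ≠ 0) ∧
      (∑ i, ee i = e) ∧ (∑ i, ff i = f) ∧ (h = (2 : F) • ∑ i, w i) ∧
      (∀ y, ⁅h, y⁆ = 0 → y ∈ Submodule.span F (Set.range w)) ∧
      (∀ y, ⁅h, y⁆ = (2 : F) • y → y ∈ Submodule.span F (Set.range ee)) ∧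
      (∀ i, ⁅⁅ee i, ff i⁆, ee i⁆ = 0 → ⁅ee i, ff i⁆ = 0) := by
  have hdiag : ⨆ n : ℤ, (ad F g h).eigenspace (n : F) = ⊤ :=
    T.diag _ fun m y hy => mis m (mei.2 hy)
  obtain ⟨H, hH, hHm⟩ := cartan_exists hdiag rh
  have hh : h ∈ H := (hHm h).2 (lie_self h)
  obtain ⟨c, hc, hce⟩ := weight_decomp H e
  obtain ⟨c', hc', hcf⟩ := weight_decomp H f
  have c2 : ∀ χ, c χ ≠ 0 → χ ⟨h, hh⟩ = 2 := by
    intro χ hχ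
    have := wt_li H (fun χ => (χ ⟨h, hh⟩ - 2) • c χ) (fun χ z => by
      rw [lie_smul, hc, smul_comm]) Finset.univ (by
      simp_rw [sub_smul, Finset.sum_sub_distrib, ← hc _ ⟨h, hh⟩, ← Finset.smul_sum, ← lie_sum, hce, T.he, sub_self])
      χ (Finset.mem_univ _)
    simpa [hχ, sub_eq_zero] using this
  have c2' : ∀ χ, c' χ ≠ 0 → χ ⟨h, hh⟩ = -2 := by
    intro χ hχ
    have := wt_li H (fun χ => (χ ⟨h, hh⟩ - (-2)) • c' χ) (fun χ z => by
      rw [lie_smul, hc', smul_comm]) Finset.univ (by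
      simp_rw [sub_smul, Finset.sum_sub_distrib, ← hc' _ ⟨h, hh⟩, ← Finset.smul_sum, ← lie_sum, hcf, T.hf, sub_self])
      χ (Finset.mem_univ _)
    simpa [hχ, add_eq_zero_iff_eq_neg] using this
  classical
  let I := {χ : LieModule.Weight F H g // c χ ≠ 0}
  let σ : Fin (Fintype.card I) ≃ I := (Fintype.equivFin I).symm
  let α : Fin (Fintype.card I) → LieModule.Weight F H g := fun i => (σ i).1
  have αinj : Function.Injective α := Subtype.val_injective.comp σ.injective
  let ee : Fin (Fintype.card I) → g := fun i => c (α i)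
  have ee0 : ∀ i, ee i ≠ 0 := fun i => (σ i).2
  have hee : ∀ i, ∀ z : H, ⁅(z : g), ee i⁆ = α i z • ee i := fun i z => hc _ z
  have see : ∑ i, ee i = e := by
    rw [← hce]
    refine (Equiv.sum_comp σ (fun x : I => c x.1)).trans ?_
    rw [← Finset.sum_filter_ne_zero (s := Finset.univ) (f := c)]
    exact (Finset.sum_subtype _ (by simp) _).symm
  have lin : ∀ a b : Fin (Fintype.card I) → F, ∑ i, a i • ee i = ∑ i, b i • ee i → ∀ i, a i = b i := by
    intro a b hab i
    have h1 : ∑ i, (a i - b i) • ee i = 0 := by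
      simp_rw [sub_smul, Finset.sum_sub_distrib, hab, sub_self]
    have := wt_li H (fun χ => ∑ i, if α i = χ then (a i - b i) • ee i else 0) (fun χ z => by
      rw [lie_sum, Finset.smul_sum]
      refine Finset.sum_congr rfl fun i _ => ?_
      split_ifs with h
      · rw [lie_smul, hee, smul_comm, h]
      · simp) Finset.univ (by
      rw [Finset.sum_comm]
      refine Eq.trans (Finset.sum_congr rfl fun i _ => by simp) h1) (α i) (Finset.mem_univ _)
    simp only [αinj.eq_iff, Finset.sum_ite_eq', Finset.mem_univ, if_true] at this
    exact sub_eq_zero.1 ((smul_eq_zero.1 this).resolve_right (ee0 i))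
  have zee : ∀ z : H, ⁅(z : g), e⁆ = ∑ i, α i z • ee i := fun z => by
    rw [← see, lie_sum]; exact Finset.sum_congr rfl fun i _ => hee i z
  have surj2 : ∀ y, ⁅h, y⁆ = (2 : F) • y → ∃ z : H, ⁅(z : g), e⁆ = y := by
    intro y hy
    obtain ⟨z, hz, h1⟩ := T.e_surj 2 y (by norm_num) (by simpa using hy)
    have hz0 : ⁅h, z⁆ = 0 := by simpa using hz
    exact ⟨⟨-z, (hHm _).2 (by rw [lie_neg, hz0, neg_zero])⟩, by
      change ⁅-z, e⁆ = y; rw [neg_lie, lie_skew, h1]⟩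
  have hee2 : ∀ i, ⁅h, ee i⁆ = (2 : F) • ee i := fun i => by
    rw [← c2 (α i) (ee0 i)]; exact hee i ⟨h, hh⟩
  choose w hw using fun i => surj2 (ee i) (hee2 i)
  have αw : ∀ i j, α j (w i) = if i = j then 1 else 0 := fun i j => by
    refine lin (fun j => α j (w i)) (fun j => if i = j then 1 else 0) ?_ j
    rw [← zee, hw]; simp
  have hH0 : ∀ z : H, ⁅h, (z : g)⁆ = 0 := fun z => (hHm _).1 z.2
  have zw : ∀ z : H, (z : g) = ∑ i, α i z • (w i : g) := by
    intro z
    rw [← sub_eq_zero]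
    refine T.inj0 _ ?_ ?_
    · rw [lie_sub, hH0, lie_sum]; simp [hH0]
    · rw [← lie_skew, sub_lie, sum_lie, zee, neg_eq_zero, sub_eq_zero]
      refine Finset.sum_congr rfl fun i _ => ?_
      rw [smul_lie, hw]
  have hhw : h = (2 : F) • ∑ i, (w i : g) := by
    have := zw ⟨h, hh⟩
    simp only [c2 _ (ee0 _)] at this
    rw [Finset.smul_sum]; exact this
  have zero : ∀ (x y : g) (a b : H → F), (∀ z : H, ⁅(z : g), x⁆ = a z • x) →
      (∀ z : H, ⁅(z : g), y⁆ = b z • y) → ⁅h, ⁅x, y⁆⁆ = 0 → (∃ z, a z + b z ≠ 0) → ⁅x, y⁆ = 0 := by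
    rintro x y a b hx hy h0 ⟨z, hz⟩
    have := T.comm0 z _ (hH0 z) h0
    rw [leibniz_lie, hx, hy, smul_lie, lie_smul, ← add_smul] at this
    exact (smul_eq_zero.1 this).resolve_left hz
  have neg2 : ∀ i χ, c' χ ≠ 0 → ⁅h, ⁅ee i, c' χ⁆⁆ = 0 := fun i χ hχ => by
    rw [leibniz_lie, hee2, show ⁅h, c' χ⁆ = (-2 : F) • c' χ by
      rw [← c2' χ hχ]; exact hc' χ ⟨h, hh⟩, smul_lie, lie_smul, ← add_smul]; simp
  have cneg : ∀ χ, c' χ ≠ 0 → ∃ i, ∀ z : H, χ z = - α i z := by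
    intro χ hχ
    by_contra! hcon
    have : ⁅e, c' χ⁆ = 0 := by
      rw [← see, sum_lie]
      refine Finset.sum_eq_zero fun i _ => zero _ _ (α i) χ (hee i) (hc' χ) (neg2 i χ hχ) ?_
      obtain ⟨z, hz⟩ := hcon i
      exact ⟨z, fun h => hz (eq_neg_of_add_eq_zero_right h)⟩
    refine hχ (T.e_inj (-2) _ (by norm_num) ?_ this)
    have := hc' χ ⟨h, hh⟩
    rw [c2' χ hχ] at this; push_cast; exact this
  let ff : Fin (Fintype.card I) → g := fun i => -⁅(w i : g), f⁆
  have hff' : ∀ i, ff i = ∑ χ, (-(χ (w i))) • c' χ := fun i => by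
    simp only [ff]; rw [← hcf, lie_sum, ← Finset.sum_neg_distrib]
    exact Finset.sum_congr rfl fun χ _ => by rw [hc', neg_smul]
  have cw : ∀ χ, c' χ ≠ 0 → ∃ i, ∀ j, χ (w j) = if j = i then -1 else 0 := fun χ hχ => by
    obtain ⟨i, hi⟩ := cneg χ hχ
    refine ⟨i, fun j => ?_⟩
    rw [hi, αw]; split_ifs <;> simp
  have hff : ∀ i, ∀ z : H, ⁅(z : g), ff i⁆ = -α i z • ff i := by
    intro i z
    rw [hff', lie_sum, Finset.smul_sum]
    refine Finset.sum_congr rfl fun χ _ => ?_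
    by_cases h0 : c' χ = 0
    · simp [h0]
    · obtain ⟨j, hj⟩ := cneg χ h0
      rw [lie_smul, hc', smul_smul, smul_smul, hj, hj, αw]
      split_ifs with hij
      · subst hij; congr 1; ring
      · simp
  have sff : ∑ i, ff i = f := by
    simp_rw [hff']
    rw [Finset.sum_comm, ← hcf]
    refine Finset.sum_congr rfl fun χ _ => ?_
    by_cases h0 : c' χ = 0
    · simp [h0]
    · obtain ⟨i, hi⟩ := cw χ h0
      simp [hi, ← Finset.sum_smul]
  refine ⟨_, fun i => w i, ee, ff, fun i => hH0 _, fun i j => ?_, fun i j => ?_, ee0, see, sff, hhw, ?_, ?_, ?_⟩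
  · rw [hee, αw]; split_ifs <;> simp
  · rw [hff, αw]; split_ifs <;> simp
  · intro y hy
    have := zw ⟨y, (hHm y).2 hy⟩
    change y = _ at this
    rw [this]
    exact ssu _ fun i _ => ssm _ _ (sss ⟨i, rfl⟩)
  · intro y hy
    obtain ⟨z, rfl⟩ := surj2 y hy
    rw [zee]
    exact ssu _ fun i _ => ssm _ _ (sss ⟨i, rfl⟩)
  · intro i h0
    have hm : ⁅ee i, ff i⁆ ∈ H := (hHm _).2 (by
      rw [leibniz_lie, hee2, show ⁅h, ff i⁆ = (-2 : F) • ff i by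
        have := hff i ⟨h, hh⟩
        rw [c2 _ (ee0 i)] at this; exact this, smul_lie, lie_smul, ← add_smul]; simp)
    refine coroot_ne H (α i) (ee i) (ff i) (hee i) (hff i) hm ?_
    have := hee i ⟨_, hm⟩
    change ⁅⁅ee i, ff i⁆, ee i⁆ = _ at this
    rw [h0] at this
    exact (smul_eq_zero.1 this.symm).resolve_right (ee0 i)

end pd

/-- Chevalley-type data attached to a principal triple. -/
structure PD (F : Type*) [Field F] {g : Type*} [LieRing g] [LieAlgebra F g] (e h f : g) where
  r : ℕ
  n : ℕ
  w : Fin r → g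
  ee : Fin r → g
  ff : Fin r → g
  C : Fin r → Fin r → ℤ
  d : Fin r → F
  B : Module.Basis (Fin n) F g
  wt : Fin n → Fin r → ℤ
  pt : PT F e h f
  hw : ∀ i, ⁅h, w i⁆ = 0
  li : LinearIndependent F w
  w_span : ∀ y, ⁅h, y⁆ = 0 → y ∈ Submodule.span F (Set.range w)
  we : ∀ i j, ⁅w i, ee j⁆ = if i = j then ee j else 0
  wf : ∀ i j, ⁅w i, ff j⁆ = if i = j then - ff j else 0
  ef : ∀ i j, ⁅ee i, ff j⁆ = if i = j then ∑ k, (C i k : F) • w k else 0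
  ee0 : ∀ i, ee i ≠ 0
  d0 : ∀ i, d i ≠ 0
  e_eq : e = ∑ i, ee i
  f_eq : f = ∑ i, d i • ff i
  h_eq : h = (2 : F) • ∑ i, w i
  Cii : ∀ i, C i i = 2
  Cdet : (Matrix.of C).det ≠ 0
  wB : ∀ i b, ⁅w i, B b⁆ = (wt b i : F) • B b
  sgn : ∀ b, (∀ i, 0 ≤ wt b i) ∨ (∀ i, wt b i ≤ 0)
  simple : ∀ b j, (∀ i, i ≠ j → wt b i = 0) → 0 < wt b j → wt b j = 1 ∧ B b ∈ Submodule.span F {ee j}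

section pd2
variable {F : Type*} [Field F] [CharZero F] [IsAlgClosed F]
    {g : Type*} [LieRing g] [LieAlgebra F g] [FiniteDimensional F g]

theorem eig_int {V : Type*} [AddCommGroup V] [Module F V] (T : End F V)
    (hdiag : ⨆ n : ℤ, T.eigenspace (n : F) = ⊤) (c : F) (v : V) (hv : T v = c • v) (v0 : v ≠ 0) :
    ∃ n : ℤ, c = n := by
  by_contra! hcon
  have ind := (Module.End.eigenspaces_iSupIndep T) c
  rw [disjoint_iff_inf_le] at ind
  refine v0 ((Submodule.mem_bot F).1 (ind ⟨mei.2 hv, ?_⟩))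
  have : ⨆ n : ℤ, T.eigenspace (n : F) ≤ ⨆ j, ⨆ (_ : j ≠ c), T.eigenspace j :=
    iSup_le fun n => le_iSup₂_of_le (n : F) (hcon n).symm le_rfl
  exact this (by rw [hdiag]; trivial)

set_option maxHeartbeats 1000000 in
theorem PD.exist [LieAlgebra.IsSemisimple F g] {e h f : g} (T : PT F e h f) (rh : isRegular F g h) :
    Nonempty (PD F e h f) := by
  obtain ⟨r, w, ee, ff, hw, we, wf, ee0, se, sf, hh, wsp, esp, cor⟩ := pd1 T rh
  have he2 : ∀ i, ⁅h, ee i⁆ = (2 : F) • ee i := fun i => by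
    rw [hh, smul_lie, sum_lie]; simp [we]
  have hf2 : ∀ i, ⁅h, ff i⁆ = (-2 : F) • ff i := fun i => by
    rw [hh, smul_lie, sum_lie]; simp [wf]
  have h0 : ∀ i j, ⁅h, ⁅ee i, ff j⁆⁆ = 0 := fun i j => by
    rw [leibniz_lie, he2, hf2, smul_lie, lie_smul, ← add_smul]; simp
  have ef0 : ∀ i j, i ≠ j → ⁅ee i, ff j⁆ = 0 := fun i j hij => by
    have := T.comm0 (w i) _ (hw i) (h0 i j)
    rw [leibniz_lie, we, wf, if_pos rfl, if_neg hij, lie_zero, add_zero] at this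
    exact this
  have eif : ∀ i, ⁅ee i, f⁆ = ⁅ee i, ff i⁆ := fun i => by
    rw [← sf, lie_sum, Finset.sum_eq_single i (fun j _ hj => ef0 i j hj.symm) (by simp)]
  have efj : ∀ i, ⁅e, ff i⁆ = ⁅ee i, ff i⁆ := fun i => by
    rw [← se, sum_lie, Finset.sum_eq_single i (fun j _ hj => ef0 j i hj) (by simp)]
  have li : LinearIndependent F w := by
    rw [Fintype.linearIndependent_iff]
    intro a ha i
    have := congrArg (fun y => ⁅y, ee i⁆) ha
    simp only [sum_lie, smul_lie, we, zero_lie, smul_ite, smul_zero, Finset.sum_ite_eq',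
      Finset.mem_univ, if_true] at this
    exact (smul_eq_zero.1 this).resolve_right (ee0 i)
  have exC : ∀ y, ⁅h, y⁆ = 0 → ∃ a : Fin r → F, y = ∑ k, a k • w k := fun y hy => by
    obtain ⟨a, ha⟩ := (mse F).1 (wsp y hy)
    exact ⟨a, ha.symm⟩
  choose a ha using fun i => exC _ (h0 i i)
  have aee : ∀ i j, ⁅⁅ee i, ff i⁆, ee j⁆ = a i j • ee j := fun i j => by
    rw [ha, sum_lie]; simp [we]
  have aff : ∀ i j, ⁅⁅ee i, ff i⁆, ff j⁆ = -a i j • ff j := fun i j => by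
    rw [ha, sum_lie]; simp [wf]
  have aii : ∀ i, a i i ≠ 0 := by
    intro i h1
    have h2 := cor i (by rw [aee, h1, zero_smul])
    refine ee0 i (T.f_inj 2 _ (by norm_num) (by rw [he2]; norm_num) ?_)
    rw [← lie_skew, eif, h2, neg_zero]
  have ff0 : ∀ i, ff i ≠ 0 := fun i h1 => by
    have := aee i i
    rw [h1, lie_zero, zero_lie] at this
    exact (smul_ne_zero (aii i) (ee0 i)) this.symm
  -- integrality
  have hint : ∀ i j, ∃ m : ℤ, 2 / a i i * a i j = m := by
    intro i j
    obtain ⟨A1, A2, A3⟩ := ad_sl2 (F := F) (e := ee i) (h := (2 / a i i) • ⁅ee i, ff i⁆)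
      (f := (2 / a i i) • ff i) (by
        rw [smul_lie, aee, smul_smul, div_mul_cancel₀ _ (aii i), two_smul, two_smul]) (by
        have := aii i
        rw [smul_lie, lie_smul, aff, ← Nat.cast_smul_eq_nsmul F, smul_smul, smul_smul, smul_smul, ← neg_smul]
        congr 1; push_cast; field_simp) (by rw [lie_smul])
    refine eig_int _ (sl2_diag A1 A2 A3) _ (ee j) ?_ (ee0 j)
    rw [adp, smul_lie, aee, smul_smul]
  choose C hC using hint
  have ef : ∀ i j, ⁅ee i, (2 / a i i) • ff j⁆ = if i = j then ∑ k, (C i k : F) • w k else 0 := by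
    intro i j
    split_ifs with hij
    · subst hij
      simp_rw [lie_smul, ← hC, mul_smul, ← Finset.smul_sum]
      rw [← ha]
    · rw [lie_smul, ef0 i j hij, smul_zero]
  -- spanning
  let Good : g → Prop := fun y => ∃ v : Fin r → ℤ, (∀ i, ⁅w i, y⁆ = (v i : F) • y) ∧
    ((∀ i, 0 ≤ v i) ∨ (∀ i, v i ≤ 0)) ∧
    (∀ j, y ≠ 0 → (∀ i, i ≠ j → v i = 0) → 0 < v j → v j = 1 ∧ y ∈ Submodule.span F {ee j})
  have pos : ∀ k : ℕ, ∀ y, ⁅h, y⁆ = ((2 * (k + 1 : ℕ) : ℤ) : F) • y →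
      y ∈ Submodule.span F {y | ∃ v : Fin r → ℤ, (∀ i, ⁅w i, y⁆ = (v i : F) • y) ∧ (∀ i, 0 ≤ v i) ∧
        ∑ i, v i = (k + 1 : ℕ) ∧ (∀ j, y ≠ 0 → (∀ i, i ≠ j → v i = 0) → v j = 1 ∧ y ∈ Submodule.span F {ee j})} := by
    intro k
    induction k with
    | zero =>
      intro y hy
      refine Submodule.span_mono ?_ (esp y (by simpa using hy))
      rintro _ ⟨i, rfl⟩
      refine ⟨Pi.single i 1, fun j => ?_, fun j => ?_, by simp, fun j _ hj => ?_⟩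
      · rw [we, Pi.single_apply]; split_ifs <;> simp
      · rw [Pi.single_apply]; split_ifs <;> simp
      · by_cases hij : i = j
        · subst hij; exact ⟨by simp, Submodule.mem_span_singleton_self _⟩
        · have := hj i hij; simp at this
    | succ k ih =>
      intro y hy
      obtain ⟨y, hy', rfl⟩ := T.e_surj _ y (by push_cast; omega) hy
      have := ih y (by rw [hy']; congr 2; push_cast; ring)
      clear hy hy'
      induction this using Submodule.span_induction with
      | zero => simp
      | add x y _ _ hx hy => rw [lie_add]; exact Submodule.add_mem _ hx hy
      | smul c x _ hx => rw [lie_smul]; exact ssm _ _ hx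
      | mem y hy =>
        obtain ⟨v, h1, h2, h3, h4⟩ := hy
        rw [← se, sum_lie]
        refine ssu _ fun i _ => sss
          ⟨v + Pi.single i 1, fun j => ?_, fun j => ?_, ?_, fun j hy0 hj => ?_⟩
        · rw [leibniz_lie, we, h1, Pi.add_apply, Pi.single_apply, lie_smul]
          split_ifs
          · push_cast; module
          · simp
        · rw [Pi.add_apply, Pi.single_apply]; have := h2 j; split_ifs <;> omega
        · simp [Finset.sum_add_distrib, h3]
        · exfalso
          have hij : i = j := by
            by_contra hij
            have := hj i hij; have := h2 i; simp at *; omega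
          subst hij
          have hv : ∀ k, k ≠ i → v k = 0 := fun k hk => by simpa [hk] using hj k hk
          have := (h4 i (fun h => hy0 (by rw [h, lie_zero])) hv).2
          obtain ⟨c, rfl⟩ := Submodule.mem_span_singleton.1 this
          exact hy0 (by simp)
  have neg : ∀ k : ℕ, ∀ y : g, ⁅h, y⁆ = ((-(2 * (k : ℕ)) : ℤ) : F) • y →
      y ∈ Submodule.span F {y | ∃ v : Fin r → ℤ, (∀ i, ⁅w i, y⁆ = (v i : F) • y) ∧ (∀ i, v i ≤ 0)} := by
    intro k
    induction k with
    | zero =>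
      intro y hy
      refine Submodule.span_mono ?_ (wsp y (by simpa using hy))
      rintro _ ⟨i, rfl⟩
      exact ⟨0, fun j => by simp [T.comm0 _ _ (hw j) (hw i)], fun j => le_rfl⟩
    | succ k ih =>
      intro y hy
      obtain ⟨y, hy', rfl⟩ := T.f_surj _ y (by push_cast; omega) hy
      have := ih y (by rw [hy']; congr 2; push_cast; ring)
      clear hy hy'
      induction this using Submodule.span_induction with
      | zero => simp
      | add x y _ _ hx hy => rw [lie_add]; exact Submodule.add_mem _ hx hy
      | smul c x _ hx => rw [lie_smul]; exact ssm _ _ hx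
      | mem y hy =>
        obtain ⟨v, h1, h2⟩ := hy
        rw [← sf, sum_lie]
        refine ssu _ fun i _ => sss
          ⟨v - Pi.single i 1, fun j => ?_, fun j => ?_⟩
        · rw [leibniz_lie, wf, h1, Pi.sub_apply, Pi.single_apply, lie_smul]
          split_ifs
          · rw [neg_lie]; push_cast; module
          · simp
        · rw [Pi.sub_apply, Pi.single_apply]; have := h2 j; split_ifs <;> omega
  have hspan : Submodule.span F {y | Good y} = ⊤ := by
    apply T.diag
    intro m y hy
    rcases Int.even_or_odd' m with ⟨k, rfl | rfl⟩
    · rcases lt_or_ge 0 k with hk | hk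
      · obtain ⟨k, rfl⟩ := izl hk.le
        obtain ⟨k, rfl⟩ := Nat.exists_eq_succ_of_ne_zero (by simpa using hk.ne')
        refine Submodule.span_mono ?_ (pos k y hy)
        rintro y ⟨v, h1, h2, h3, h4⟩
        exact ⟨v, h1, Or.inl h2, fun j hy hj _ => h4 j hy hj⟩
      · obtain ⟨k', hk'⟩ := izl (neg_nonneg.2 hk)
        obtain rfl : k = -k' := by omega
        refine Submodule.span_mono ?_ (neg k' y (by rw [hy]; congr 2; ring))
        rintro y ⟨v, h1, h2⟩
        exact ⟨v, h1, Or.inr h2, fun j _ _ hj => absurd (h2 j) (not_le.2 hj)⟩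
    · rw [T.even k y hy]; exact Submodule.zero_mem _
  let B0 := Module.Basis.ofSpan hspan.ge
  have hB0 : ∀ x, Good (B0 x) := fun x => Module.Basis.ofSpan_subset hspan.ge ⟨x, rfl⟩
  haveI := Module.Finite.finite_basis B0
  let B := B0.reindex (Finite.equivFin _)
  have hB : ∀ b, Good (B b) := fun b => by rw [Module.Basis.reindex_apply]; exact hB0 _
  choose wt h1 h2 h3 using hB
  refine ⟨⟨r, _, w, ee, fun i => (2 / a i i) • ff i, C, fun i => a i i / 2, B, wt, T, hw, li, wsp, we, ?_, ?_, ee0,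
    fun i => div_ne_zero (aii i) two_ne_zero, se.symm, ?_, hh, fun i => ?_, ?_, fun i b => h1 b i, h2,
    fun b j => h3 b j (B.ne_zero b)⟩⟩
  · intro i j; rw [lie_smul, wf]; split_ifs <;> simp
  · intro i j
    by_cases hij : i = j
    · subst hij; exact ef i i
    · rw [if_neg hij, lie_smul, ef0 i j hij, smul_zero]
  · rw [← sf]
    refine Finset.sum_congr rfl fun i _ => ?_
    rw [smul_smul, div_mul_div_cancel₀ two_ne_zero, div_self (aii i), one_smul]
  · have := hC i i
    rw [div_mul_cancel₀ _ (aii i)] at this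
    exact_mod_cast this.symm
  · intro hdet
    have hdF : ((Matrix.of C).map (Int.castRingHom F)).det = 0 := by
      rw [← RingHom.mapMatrix_apply, ← RingHom.map_det, hdet, map_zero]
    obtain ⟨x, x0, hx⟩ := Matrix.exists_vecMul_eq_zero_iff.2 hdF
    apply x0
    have key : ∑ i, x i • ((2 / a i i) • ff i) = 0 := by
      refine T.e_inj (-2) _ (by norm_num) ?_ ?_
      · rw [lie_sum, Finset.smul_sum]
        refine Finset.sum_congr rfl fun i _ => ?_
        rw [lie_smul, lie_smul, hf2]; push_cast; module
      · rw [lie_sum]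
        have : ∀ i, ⁅e, x i • ((2 / a i i) • ff i)⁆ = ∑ k, (x i * (C i k : F)) • w k := fun i => by
          rw [lie_smul, lie_smul, efj, ← lie_smul, ef, if_pos rfl, Finset.smul_sum]
          exact Finset.sum_congr rfl fun k _ => smul_smul _ _ _
        simp_rw [this]
        rw [Finset.sum_comm]
        refine Finset.sum_eq_zero fun k _ => ?_
        rw [← Finset.sum_smul]
        have := congrFun hx k
        simp only [Matrix.vecMul, dotProduct, Matrix.map_apply, Matrix.of_apply, Pi.zero_apply] at this
        erw [this, zero_smul]
    ext j
    have := congrArg (fun y => ⁅w j, y⁆) key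
    simp only [lie_sum, lie_smul, wf, smul_ite, smul_zero, Finset.sum_ite_eq,
      Finset.mem_univ, if_true, lie_zero, smul_neg, neg_eq_zero, smul_smul] at this
    exact (mul_eq_zero.1 ((smul_eq_zero.1 this).resolve_right (ff0 j))).resolve_right
      (div_ne_zero two_ne_zero (aii j))

end pd2

section nexp
open Finset
variable {F : Type*} [Field F]

/-- exponential of a nilpotent endomorphism -/
noncomputable def nx {V : Type*} [AddCommGroup V] [Module F V] (a : End F V) : End F V :=
  ∑ i ∈ range (nilpotencyClass a), ((i.factorial : F)⁻¹) • a ^ i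

theorem nx_eq_sum {V : Type*} [AddCommGroup V] [Module F V] {a : End F V} {k : ℕ} (h : a ^ k = 0) :
    nx a = ∑ i ∈ range k, ((i.factorial : F)⁻¹) • a ^ i := by
  have hn : nilpotencyClass a ≤ k := csInf_le (OrderBot.bddBelow _) h
  rw [nx, ← sum_range_add_sum_Ico _ hn, left_eq_add]
  refine sum_eq_zero fun i hi => ?_
  rw [pow_eq_zero_of_le (mem_Ico.1 hi).1 (pow_nilpotencyClass ⟨k, h⟩), smul_zero]

theorem nx_zero {V : Type*} [AddCommGroup V] [Module F V] : nx (0 : End F V) = 1 := by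
  rw [nx_eq_sum (k := 1) (by simp)]; simp

variable [CharZero F]

theorem nx_eq_exp {V : Type*} [AddCommGroup V] [Module F V] [Module ℚ V] (a : End F V) :
    nx a = IsNilpotent.exp a := by
  rw [nx, IsNilpotent.exp]
  refine sum_congr rfl fun i _ => ?_
  ext v
  simp only [lsm]
  have := map_ratCast_smul (AddMonoidHom.id V) F ℚ ((i.factorial : ℚ)⁻¹) ((a ^ i) v)
  push_cast at this
  exact this

theorem nx_neg_mul {V : Type*} [AddCommGroup V] [Module F V] {a : End F V} (ha : IsNilpotent a) :
    nx (-a) * nx a = 1 := by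
  letI : Module ℚ V := Module.compHom V (algebraMap ℚ F)
  rw [nx_eq_exp, nx_eq_exp, IsNilpotent.exp_neg_mul_exp_self ha]

theorem nx_neg_apply {V : Type*} [AddCommGroup V] [Module F V] {a : End F V} (ha : IsNilpotent a) (x : V) :
    nx (-a) (nx a x) = x := by
  rw [← ema, nx_neg_mul ha]; rfl

theorem nx_apply_neg {V : Type*} [AddCommGroup V] [Module F V] {a : End F V} (ha : IsNilpotent a) (x : V) :
    nx a (nx (-a) x) = x := by
  simpa using nx_neg_apply ha.neg x

theorem nx_comm {V W : Type*} [AddCommGroup V] [Module F V] [AddCommGroup W] [Module F W]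
    {a : End F V} {b : End F W} (m : V →ₗ[F] W) (ha : IsNilpotent a) (hb : IsNilpotent b)
    (h : ∀ v, m (a v) = b (m v)) (v : V) : m (nx a v) = nx b (m v) := by
  obtain ⟨k, hk⟩ := ha
  obtain ⟨l, hl⟩ := hb
  have e1 : a ^ (k + l) = 0 := by rw [pow_add, hk, zero_mul]
  have e2 : b ^ (k + l) = 0 := by rw [pow_add, hl, mul_zero]
  have hp : ∀ (i : ℕ) v, m ((a ^ i) v) = (b ^ i) (m v) := by
    intro i
    induction i with
    | zero => simp
    | succ i ih => intro v; rw [pow_succ', pow_succ', ema, ema, h, ih]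
  rw [nx_eq_sum e1, nx_eq_sum e2]
  simp [lsu, hp]

theorem nx_bil {U V W : Type*} [AddCommGroup U] [Module F U] [AddCommGroup V] [Module F V] [AddCommGroup W] [Module F W]
    {a : End F U} {b : End F V} {c : End F W} (β : U →ₗ[F] V →ₗ[F] W)
    (ha : IsNilpotent a) (hb : IsNilpotent b) (hc : IsNilpotent c)
    (h : ∀ u v, c (β u v) = β (a u) v + β u (b v)) (u : U) (v : V) :
    nx c (β u v) = β (nx a u) (nx b v) := by
  letI : Module ℚ U := Module.compHom U (algebraMap ℚ F)
  letI : Module ℚ V := Module.compHom V (algebraMap ℚ F)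
  letI : Module ℚ W := Module.compHom W (algebraMap ℚ F)
  let A : End F (U ⊗[F] V) := a.rTensor V
  let B : End F (U ⊗[F] V) := b.lTensor U
  have hA : IsNilpotent A := ha.map (Module.End.rTensorAlgHom (R := F) (M := U) (N := V))
  have hB : IsNilpotent B := hb.map (Module.End.lTensorAlgHom (R := F) (M := V) (N := U))
  have hAB : Commute A B := by ext; simp [A, B]
  have h1 := nx_comm (a := A + B) (b := c) (TensorProduct.lift β) (hAB.isNilpotent_add hA hB) hc (fun x => by
    induction x with
    | zero => simp
    | add x y hx hy => simp only [map_add, hx, hy]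
    | tmul x y => simp [A, B, h]) (u ⊗ₜ v)
  rw [TensorProduct.lift.tmul] at h1
  rw [← h1]
  letI : Module ℚ (U ⊗[F] V) := Module.compHom (U ⊗[F] V) (algebraMap ℚ F)
  have h2 : nx (A + B) = nx A * nx B := by
    rw [nx_eq_exp, nx_eq_exp, nx_eq_exp]
    exact IsNilpotent.exp_add_of_commute hAB hA hB
  have h3 : ∀ x y, nx A (x ⊗ₜ[F] y) = (nx a x) ⊗ₜ y := fun x y =>
    (nx_comm (a := a) (b := A) ((TensorProduct.mk F U V).flip y) ha hA (fun v => by simp [A]) x).symm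
  have h4 : ∀ x y, nx B (x ⊗ₜ[F] y) = x ⊗ₜ (nx b y) := fun x y =>
    (nx_comm (a := b) (b := B) ((TensorProduct.mk F U V) x) hb hB (fun v => by simp [B]) y).symm
  rw [h2, ema, h4, h3, TensorProduct.lift.tmul]

theorem nx_sub1 {V : Type*} [AddCommGroup V] [Module F V] {a : End F V} (ha : IsNilpotent a)
    (P : Submodule F V) (x : V) (h : ∀ k, (a ^ (k + 1)) x ∈ P) : nx a x - x ∈ P := by
  obtain ⟨k, hk⟩ := ha
  rw [nx_eq_sum (k := k + 1) (by rw [pow_succ, hk, zero_mul]), sum_range_succ']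
  simp only [lad, lsu, lsm]
  simp only [Nat.factorial_zero, Nat.cast_one, inv_one, pow_zero, Module.End.one_apply, one_smul, add_sub_cancel_right]
  exact ssu _ fun i _ => P.smul_mem _ (h i)

theorem nx_sub2 {V : Type*} [AddCommGroup V] [Module F V] {a : End F V} (ha : IsNilpotent a)
    (P : Submodule F V) (x : V) (h : ∀ k, (a ^ (k + 2)) x ∈ P) : nx a x - x - a x ∈ P := by
  obtain ⟨k, hk⟩ := ha
  rw [nx_eq_sum (k := k + 2) (by rw [pow_add, hk, zero_mul]), sum_range_succ', sum_range_succ']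
  simp only [lad, lsu, lsm]
  simp only [Nat.factorial_zero, Nat.cast_one, inv_one, pow_zero, Module.End.one_apply, one_smul, add_sub_cancel_right,
    zero_add, Nat.factorial_one, pow_one]
  exact ssu _ fun i _ => P.smul_mem _ (h i)

theorem nx_mem {V : Type*} [AddCommGroup V] [Module F V] {a : End F V} 
    (P : Submodule F V) (h : ∀ v ∈ P, a v ∈ P) (x : V) (hx : x ∈ P) : nx a x ∈ P := by
  rw [nx]
  simp only [lsu, lsm]
  refine ssu _ fun i hi => P.smul_mem _ ?_
  clear hi
  induction i with
  | zero => simpa using hx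
  | succ i ih => rw [pow_succ', ema]; exact h _ ih

/-- polynomial dependence -/
theorem nx_span {V : Type*} [AddCommGroup V] [Module F V] {a : End F V} (ha : IsNilpotent a)
    (P : Submodule F V) (x : V) (h : ∀ t : F, nx (t • a) x ∈ P) : a x ∈ P := by
  classical
  obtain ⟨k, hk⟩ := ha
  have h0 : ∀ φ : V →ₗ[F] F, (∀ v ∈ P, φ v = 0) → φ (a x) = 0 := by
    intro φ hφ
    let p : Polynomial F := ∑ i ∈ range (k + 2), Polynomial.monomial i ((i.factorial : F)⁻¹ * φ ((a ^ i) x))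
    have hp : p = 0 := Polynomial.funext fun t => by
      have := hφ _ (h t)
      rw [nx_eq_sum (k := k + 2) (by rw [smul_pow, pow_add a, hk, zero_mul, smul_zero])] at this
      simp only [p, Polynomial.eval_finset_sum, Polynomial.eval_monomial, Polynomial.eval_zero]
      rw [← this]
      simp only [lsu, lsm, map_sum, map_smul, smul_pow, smul_eq_mul]
      exact sum_congr rfl fun i _ => by ring
    have h1 := congrArg (fun q => Polynomial.coeff q 1) hp
    simp [p, Polynomial.finset_sum_coeff, Polynomial.coeff_monomial] at h1
    exact h1
  by_contra hc
  obtain ⟨φ, h1, h2⟩ := Submodule.exists_le_ker_of_notMem hc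
  exact h1 (h0 φ fun v hv => h2 hv)

end nexp

section conj
variable {F : Type*} [Field F] 

/-- conjugacy under products of exponentials -/
def Cj (F : Type*) [Field F] (L : Type*) [LieRing L] [LieAlgebra F L] : L → L → Prop :=
  Relation.ReflTransGen fun X Y => ∃ N, IsNilpotent (ad F L N : End F L) ∧
    Y = nx (ad F L N : End F L) X

variable {L : Type*} [LieRing L] [LieAlgebra F L]

theorem Cj.step {N : L} (hN : IsNilpotent (ad F L N : End F L)) (X : L) :
    Cj F L X (nx (ad F L N : End F L) X) := .single ⟨N, hN, rfl⟩

theorem Cj.trans {X Y Z : L} (h : Cj F L X Y) (h' : Cj F L Y Z) : Cj F L X Z :=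
  Relation.ReflTransGen.trans h h'

theorem Cj.refl (X : L) : Cj F L X X := Relation.ReflTransGen.refl

theorem Cj.symm [CharZero F] {X Y : L} (h : Cj F L X Y) : Cj F L Y X := by
  induction h with
  | refl => exact Cj.refl _
  | tail _ h ih =>
  refine Cj.trans ?_ ih
  obtain ⟨N, hN, rfl⟩ := h
  have : (ad F L (-N) : End F L) = -ad F L N := map_neg _ _
  exact Relation.ReflTransGen.single ⟨-N, by rw [this]; exact hN.neg, by rw [this, nx_neg_apply hN]⟩

theorem expEnd_eq [FiniteDimensional F L] {a : End F L} (ha : IsNilpotent a) : expEnd a = nx a := by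
  rw [expEnd, nx_eq_sum (k := finrank F L + 1)]
  have h1 := LinearMap.aeval_self_charpoly a
  rw [IsNilpotent.charpoly_eq_X_pow_finrank ha, map_pow, Polynomial.aeval_X] at h1
  rw [pow_succ, h1, zero_mul]

theorem reach_iff [CharZero F] [FiniteDimensional F L] (X Y : L) : reach F L X Y ↔ Cj F L X Y := by
  constructor
  · rintro ⟨l, hl, rfl⟩
    induction l with
    | nil => exact Cj.refl _
    | cons N l ih =>
      refine (ih fun M hM => hl M (List.mem_cons_of_mem _ hM)).trans ?_
      rw [List.foldr_cons, expEnd_eq (hl N List.mem_cons_self)]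
      exact Cj.step (hl N List.mem_cons_self) _
  · intro h
    induction h with
    | refl => exact ⟨[], by simp, rfl⟩
    | tail _ h ih =>
      obtain ⟨l, hl, rfl⟩ := ih
      obtain ⟨N, hN, rfl⟩ := h
      refine ⟨N :: l, by simpa using ⟨hN, hl⟩, ?_⟩
      rw [List.foldr_cons, expEnd_eq hN]

theorem nx_lie [CharZero F] {N : L} (hN : IsNilpotent (ad F L N : End F L)) (x y : L) :
    nx (ad F L N : End F L) ⁅x, y⁆ =
      ⁅nx (ad F L N : End F L) x, nx (ad F L N : End F L) y⁆ :=
  nx_bil (LieModule.toEnd F L L : L →ₗ[F] End F L) hN hN hN (fun u v => by simp) x y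

end conj

section bc
variable {F : Type*} [Field F] {g : Type*} [LieRing g] [LieAlgebra F g]
  {R : Type*} [CommRing R] [Algebra F R] {R' : Type*} [CommRing R'] [Algebra F R']

theorem ad_one_tmul (N : g) : (ad F (R ⊗[F] g) ((1 : R) ⊗ₜ N) : End F (R ⊗[F] g)) =
    (ad F g N : End F g).lTensor R := by
  ext r x; simp

theorem nilp_one_tmul {N : g} (hN : IsNilpotent (ad F g N : End F g)) :
    IsNilpotent (ad F (R ⊗[F] g) ((1 : R) ⊗ₜ N) : End F (R ⊗[F] g)) := by
  rw [ad_one_tmul]; exact hN.map (Module.End.lTensorAlgHom (R := F) (M := g) (N := R))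

theorem Cj.bc [CharZero F] {x y : g} (h : Cj F g x y) : Cj F (R ⊗[F] g) ((1 : R) ⊗ₜ x) ((1 : R) ⊗ₜ y) := by
  induction h with
  | refl => exact Cj.refl _
  | tail _ h ih =>
    obtain ⟨N, hN, rfl⟩ := h
    refine ih.trans (.single ⟨(1 : R) ⊗ₜ N, nilp_one_tmul hN, ?_⟩)
    exact nx_comm (TensorProduct.mk F R g 1) hN (nilp_one_tmul hN) (fun v => by simp) _

/-- lifting a conjugation to the tensor product, for an arbitrary element -/
theorem Cj.lift [CharZero F] {x y : g} (h : Cj F g x y) (X : R ⊗[F] g) (φ : (R ⊗[F] g) →ₗ[F] g) (ε : R → F)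
    (hφ : ∀ r (z : g), φ (r ⊗ₜ z) = ε r • z) (hX : φ X = x) :
    ∃ Y, φ Y = y ∧ Cj F (R ⊗[F] g) X Y := by
  induction h with
  | refl => exact ⟨X, hX, Cj.refl _⟩
  | tail _ h ih =>
    obtain ⟨Y, hY, hc⟩ := ih
    obtain ⟨N, hN, rfl⟩ := h
    refine ⟨_, ?_, hc.trans (Cj.step (nilp_one_tmul hN) Y)⟩
    rw [← hY]
    refine nx_comm φ (nilp_one_tmul hN) hN (fun v => ?_) _
    induction v with
    | zero => simp
    | add x y hx hy => simp only [map_add, hx, hy]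
    | tmul r z => simp [hφ]

end bc

section coords
open Finset
variable {F : Type*} [Field F] {g : Type*} [LieRing g] [LieAlgebra F g] {n : ℕ} (B : Module.Basis (Fin n) F g)
  {R : Type*} [CommRing R] [Algebra F R]

/-- coordinates on `R ⊗ g` -/
noncomputable def co (b : Fin n) : (R ⊗[F] g) →ₗ[F] R :=
  (TensorProduct.rid F R).toLinearMap ∘ₗ (B.coord b).lTensor R

@[simp] theorem co_tmul (b : Fin n) (r : R) (x : g) : co B b (r ⊗ₜ[F] x) = B.repr x b • r := by
  simp [co]

theorem co_sum (X : R ⊗[F] g) : X = ∑ b, co B b X ⊗ₜ[F] B b := by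
  induction X with
  | zero => simp
  | add x y hx hy =>
    simp only [map_add, TensorProduct.add_tmul, sum_add_distrib]; rw [← hx, ← hy]
  | tmul r x =>
    conv_lhs => rw [← B.sum_repr x, TensorProduct.tmul_sum]
    exact sum_congr rfl fun b _ => by rw [co_tmul, TensorProduct.smul_tmul]

theorem co_ext {X Y : R ⊗[F] g} (h : ∀ b, co B b X = co B b Y) : X = Y := by
  rw [co_sum B X, co_sum B Y]; simp [h]

@[simp] theorem co_smul (b : Fin n) (r : R) (X : R ⊗[F] g) : co B b (r • X) = r * co B b X := by
  induction X with
  | zero => simp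
  | add x y hx hy => simp only [smul_add, map_add, hx, hy, mul_add]
  | tmul s x => simp [TensorProduct.smul_tmul']

theorem co_lie (c : Fin n) (X Y : R ⊗[F] g) :
    co B c ⁅X, Y⁆ = ∑ a, ∑ b, B.repr ⁅B a, B b⁆ c • (co B a X * co B b Y) := by
  conv_lhs => rw [co_sum B X, co_sum B Y]
  simp only [sum_lie, lie_sum, map_sum, btm, co_tmul]
  exact sum_comm

/-- the derivation of the coordinate ring given by the adjoint vector field -/
noncomputable def Dv (y : g) : Derivation F (MvPolynomial (Fin n) F) (MvPolynomial (Fin n) F) :=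
  MvPolynomial.mkDerivation F fun c => ∑ b, B.repr ⁅y, B b⁆ c • MvPolynomial.X b

/-- invariant polynomials -/
def Iv (q : MvPolynomial (Fin n) F) : Prop := ∀ y : g, Dv B y q = 0

/-- evaluation -/
noncomputable def ev (X : R ⊗[F] g) : MvPolynomial (Fin n) F →ₐ[F] R := MvPolynomial.aeval fun b => co B b X

set_option maxHeartbeats 1000000 in
theorem Iv.step [CharZero F] {q : MvPolynomial (Fin n) F} (hq : Iv B q) {N : R ⊗[F] g}
    (hN : IsNilpotent (ad F (R ⊗[F] g) N : End F (R ⊗[F] g))) (X : R ⊗[F] g) :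
    ev B (nx (ad F (R ⊗[F] g) N : End F (R ⊗[F] g)) X) q = ev B X q := by
  classical
  obtain ⟨k, hk⟩ := hN
  set T : End F (R ⊗[F] g) := ad F (R ⊗[F] g) N with hT
  let x : Fin n → Polynomial R := fun c =>
    ∑ i ∈ range (k + 1), Polynomial.monomial i (((i.factorial : F)⁻¹) • co B c ((T ^ i) X))
  let φ : MvPolynomial (Fin n) F →ₐ[F] Polynomial R := MvPolynomial.aeval x
  have hx : ∀ c, Polynomial.derivative (x c) = ∑ a, Polynomial.C (co B a N) * φ (Dv B (B a) (MvPolynomial.X c)) := by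
    intro c
    have h1 : Polynomial.derivative (x c) = ∑ i ∈ range (k + 1), Polynomial.monomial i (((i.factorial : F)⁻¹) • co B c ((T ^ (i + 1)) X)) := by
      simp only [x]
      rw [map_sum, sum_range_succ', sum_range_succ _ k, pow_succ, hk]
      simp only [Polynomial.derivative_monomial, Nat.cast_zero, mul_zero, map_zero, add_zero, zero_mul, LinearMap.zero_apply, smul_zero]
      refine sum_congr rfl fun i _ => ?_
      congr 1
      rw [← nsmul_eq_mul', ← Nat.cast_smul_eq_nsmul F, smul_smul, Nat.factorial_succ]
      congr 1
      have : ((i : F) + 1) ≠ 0 := by exact_mod_cast Nat.succ_ne_zero i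
      have := Nat.factorial_ne_zero i
      push_cast
      field_simp
    have h2 : ∀ i, co B c ((T ^ (i + 1)) X) = ∑ a, ∑ b, B.repr ⁅B a, B b⁆ c • (co B a N * co B b ((T ^ i) X)) := by
      intro i
      rw [pow_succ', ema, hT, adp, co_lie]
    rw [h1]
    simp only [h2, Dv, MvPolynomial.mkDerivation_X, map_sum, map_smul, φ, MvPolynomial.aeval_X, x, smul_sum, mul_sum]
    rw [sum_comm]
    refine sum_congr rfl fun a _ => ?_
    rw [sum_comm]
    refine sum_congr rfl fun b _ => ?_
    refine sum_congr rfl fun i _ => ?_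
    rw [Polynomial.smul_monomial, Polynomial.C_mul_monomial, mul_smul_comm, mul_smul_comm, smul_comm]
  have hd : ∀ p : MvPolynomial (Fin n) F, Polynomial.derivative (φ p) = ∑ a, Polynomial.C (co B a N) * φ (Dv B (B a) p) := by
    intro p
    induction p using MvPolynomial.induction_on with
    | C r => 
      have : φ (MvPolynomial.C r) = Polynomial.C (algebraMap F R r) := φ.commutes r
      rw [this]; simp
    | add p q hp hq => simp only [map_add, hp, hq, mul_add, sum_add_distrib]
    | mul_X p c hp =>
      rw [map_mul, Polynomial.derivative_mul, hp]
      have : φ (MvPolynomial.X c) = x c := by simp [φ]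
      rw [this, hx]
      simp only [Derivation.leibniz, smul_eq_mul, map_add, map_mul, this, mul_add, sum_add_distrib, sum_mul, mul_sum]
      rw [add_comm]
      congr 1 <;> exact sum_congr rfl fun a _ => by ring
  have h0 : Polynomial.derivative (φ q) = 0 := by rw [hd]; exact sum_eq_zero fun a _ => by rw [hq]; simp
  have hc : ∀ i, (φ q).coeff (i + 1) = 0 := by
    intro i
    have := congrArg (fun p => Polynomial.coeff p i) h0
    simp only [Polynomial.coeff_derivative, Polynomial.coeff_zero] at this
    have h3 : ((i : F) + 1) ≠ 0 := by exact_mod_cast Nat.succ_ne_zero i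
    have h4 : ((i : F) + 1) • (φ q).coeff (i + 1) = 0 := by
      rw [← this, Algebra.smul_def, mul_comm]; simp
    exact (smul_eq_zero.1 h4).resolve_left h3
  have hC : φ q = Polynomial.C ((φ q).coeff 0) := by
    ext i
    cases i with
    | zero => simp
    | succ i => rw [hc]; simp [Polynomial.coeff_C]
  have e1 : ∀ t : R, Polynomial.eval t (φ q) = MvPolynomial.aeval (fun c => Polynomial.eval t (x c)) q := by
    intro t
    have : (MvPolynomial.aeval (fun c => Polynomial.eval t (x c)) : MvPolynomial (Fin n) F →ₐ[F] R) =
      ((Polynomial.aeval t : Polynomial R →ₐ[R] R).restrictScalars F).comp φ := by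
      ext c; simp [φ]
    rw [this]; simp
  have e2 : ∀ t : R, Polynomial.eval t (φ q) = (φ q).coeff 0 := fun t => by rw [hC]; simp
  have h1 : (fun c => Polynomial.eval 1 (x c)) = fun c => co B c (nx T X) := by
    ext c
    rw [nx_eq_sum (k := k + 1) (by rw [pow_succ, hk, zero_mul])]
    simp [x, Polynomial.eval_finset_sum]
  have h2 : (fun c => Polynomial.eval 0 (x c)) = fun c => co B c X := by
    ext c
    simp only [x, Polynomial.eval_finset_sum, Polynomial.eval_monomial]
    rw [sum_range_succ']; simp
  rw [ev, ev, ← h1, ← h2, ← e1, ← e1, e2, e2]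

theorem Iv.cj [CharZero F] {q : MvPolynomial (Fin n) F} (hq : Iv B q) {X Y : R ⊗[F] g} (h : Cj F (R ⊗[F] g) X Y) :
    ev B Y q = ev B X q := by
  induction h with
  | refl => rfl
  | tail _ h ih => obtain ⟨N, hN, rfl⟩ := h; rw [hq.step B hN, ih]

theorem ev_map {R' : Type*} [CommRing R'] [Algebra F R'] (φ : R →ₐ[F] R') (X : R ⊗[F] g) (q : MvPolynomial (Fin n) F) :
    ev B (φ.toLinearMap.rTensor g X) q = φ (ev B X q) := by
  have : ∀ b, co B b (φ.toLinearMap.rTensor g X) = φ (co B b X) := by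
    intro b
    induction X with
    | zero => simp
    | add x y hx hy => simp only [map_add, hx, hy]
    | tmul r x => simp
  rw [ev, ev]
  simp only [this]
  rw [← MvPolynomial.comp_aeval]; rfl

end coords

section tenV
open Finset
variable {F : Type*} [Field F] {g : Type*} [LieRing g] [LieAlgebra F g] {n : ℕ} (B : Module.Basis (Fin n) F g)
  {R : Type*} [CommRing R] [Algebra F R]

/-- `R ⊗ V` inside `R ⊗ g` -/
noncomputable def tenV (V : Submodule F g) : Submodule F (R ⊗[F] g) :=
  LinearMap.range (TensorProduct.map (LinearMap.id : R →ₗ[F] R) V.subtype)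

theorem tmul_tenV {V : Submodule F g} (r : R) {v : g} (hv : v ∈ V) : r ⊗ₜ[F] v ∈ tenV (R := R) V :=
  ⟨r ⊗ₜ ⟨v, hv⟩, by simp⟩

/-- elements with coordinates in an ideal -/
noncomputable def JG (J : Ideal R) : Submodule F (R ⊗[F] g) where
  carrier := {X | ∀ b, co B b X ∈ J}
  add_mem' hx hy b := by rw [map_add]; exact J.add_mem (hx b) (hy b)
  zero_mem' b := by simp
  smul_mem' c x hx b := by rw [map_smul, Algebra.smul_def]; exact J.mul_mem_left _ (hx b)

theorem JG_lie {I J : Ideal R} {X Y : R ⊗[F] g} (hX : X ∈ JG B I) (hY : Y ∈ JG B J) : ⁅X, Y⁆ ∈ JG B (I * J) := by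
  intro c
  rw [co_lie]
  refine Ideal.sum_mem _ fun a _ => Ideal.sum_mem _ fun b _ => ?_
  rw [Algebra.smul_def]
  exact Ideal.mul_mem_left _ _ (Ideal.mul_mem_mul (hX a) (hY b))

theorem JG_mono {I J : Ideal R} (h : I ≤ J) : JG B I ≤ JG (F := F) B J := fun _ hX b => h (hX b)

theorem JG_lie' {I : Ideal R} {X : R ⊗[F] g} (Y : R ⊗[F] g) (hX : X ∈ JG B I) : ⁅X, Y⁆ ∈ JG B I :=
  have h1 : Y ∈ JG B (⊤ : Ideal R) := fun _ => Submodule.mem_top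
  JG_mono B (show I * ⊤ ≤ I from Ideal.mul_le_left) (JG_lie B hX h1)

theorem JG_nilp {I : Ideal R} (hI : IsNilpotent I) {N : R ⊗[F] g} (hN : N ∈ JG B I) :
    IsNilpotent (ad F (R ⊗[F] g) N : End F (R ⊗[F] g)) := by
  obtain ⟨K, hK⟩ := hI
  refine ⟨K, LinearMap.ext fun X => ?_⟩
  have : ∀ m, ((ad F (R ⊗[F] g) N : End F (R ⊗[F] g)) ^ m) X ∈ JG B (I ^ m) := by
    intro m
    induction m with
    | zero => intro b; simp
    | succ m ih => rw [pow_succ' (ad F (R ⊗[F] g) N), ema, adp, pow_succ' I]; exact JG_lie B hN ih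
  have h := this K
  rw [hK] at h
  exact co_ext B fun b => by rw [LinearMap.zero_apply, map_zero]; exact h b

theorem JG_tmul {I : Ideal R} {r : R} (hr : r ∈ I) (x : g) : r ⊗ₜ[F] x ∈ JG B I := fun b => by
  rw [co_tmul, Algebra.smul_def]; exact I.mul_mem_left _ hr

theorem formal [CharZero F] (V : Submodule F g) (s0 : g) (hV : ∀ x : g, ∃ v ∈ V, ∃ z : g, x = v + ⁅s0, z⁆)
    {J : Ideal R} (hJ : IsNilpotent J) (X : R ⊗[F] g) (hX : X - 1 ⊗ₜ s0 ∈ JG B J) :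
    ∃ Y, Cj F (R ⊗[F] g) X Y ∧ Y - 1 ⊗ₜ s0 ∈ tenV V := by
  choose vv hvv zz hzz using fun b => hV (B b)
  have key : ∀ k : ℕ, ∃ Y v u, Cj F (R ⊗[F] g) X Y ∧ Y = 1 ⊗ₜ s0 + v + u ∧ v ∈ tenV V ∧ v ∈ JG B J ∧ u ∈ JG B (J ^ (k + 1)) := by
    intro k
    induction k with
    | zero => exact ⟨X, 0, X - 1 ⊗ₜ s0, Cj.refl _, by abel, zero_mem _, zero_mem _, by simpa using hX⟩
    | succ k ih =>
      obtain ⟨Y, v, u, hc, hY, hv, hvJ, hu⟩ := ih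
      have hk1 : J ^ (k + 1) ≤ J := Ideal.pow_le_self (by simp)
      let N : R ⊗[F] g := ∑ b, co B b u ⊗ₜ zz b
      have hN : N ∈ JG B (J ^ (k + 1)) := ssu _ fun b _ => JG_tmul B (hu b) _
      have hnil := JG_nilp B hJ (JG_mono B hk1 hN)
      let v1 : R ⊗[F] g := ∑ b, co B b u ⊗ₜ vv b
      have hu1 : u = v1 + ⁅(1 : R) ⊗ₜ[F] s0, N⁆ := by
        conv_lhs => rw [co_sum B u]
        simp only [v1, N, lie_sum, btm, one_mul]
        rw [← sum_add_distrib]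
        refine sum_congr rfl fun b _ => ?_
        conv_lhs => rw [hzz b, TensorProduct.tmul_add]
      refine ⟨_, v + v1, nx (ad F (R ⊗[F] g) N) Y - (1 ⊗ₜ s0 + (v + v1)), hc.trans (Cj.step hnil Y), by abel, 
        add_mem hv (ssu _ fun b _ => tmul_tenV _ (hvv b)), 
        add_mem hvJ (ssu _ fun b _ => JG_tmul B (hk1 (hu b)) _), ?_⟩
      have h1 : nx (ad F (R ⊗[F] g) N) Y - Y - (ad F (R ⊗[F] g) N) Y ∈ JG B (J ^ (k + 1 + 1)) := by
        refine nx_sub2 hnil _ Y fun m => ?_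
        induction m with
        | zero =>
          rw [zero_add, pow_two, ema, adp, adp, pow_succ]
          exact JG_lie B hN (JG_lie' B _ (JG_mono B hk1 hN))
        | succ m ih =>
          rw [show m + 1 + 2 = (m + 2) + 1 by ring, pow_succ' (ad F (R ⊗[F] g) N), ema, adp, ← lie_skew]
          exact neg_mem (JG_lie' B _ ih)
      have h2 : ⁅N, v + u⁆ ∈ JG B (J ^ (k + 1 + 1)) := by
        rw [pow_succ]; exact JG_lie B hN (add_mem hvJ (JG_mono B hk1 hu))
      have h3 : nx (ad F (R ⊗[F] g) N) Y - (1 ⊗ₜ s0 + (v + v1)) =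
          (nx (ad F (R ⊗[F] g) N) Y - Y - (ad F (R ⊗[F] g) N) Y) + ⁅N, v + u⁆ := by
        have : (ad F (R ⊗[F] g) N) Y = ⁅N, v + u⁆ - ⁅(1 : R) ⊗ₜ[F] s0, N⁆ := by
          rw [adp, ← lie_skew (1 ⊗ₜ[F] s0) N, sub_neg_eq_add, ← lie_add, hY]; congr 1; abel
        rw [this]
        have h4 : Y = 1 ⊗ₜ s0 + v + (v1 + ⁅(1 : R) ⊗ₜ[F] s0, N⁆) := by rw [← hu1]; exact hY
        have h5 : ∀ P Q : R ⊗[F] g, P - (1 ⊗ₜ s0 + (v + v1)) = P - Y - (Q - ⁅(1 : R) ⊗ₜ[F] s0, N⁆) + Q := fun P Q => by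
          rw [h4]; abel
        exact h5 _ _
      rw [h3]; exact add_mem h1 h2
  obtain ⟨K, hK⟩ := hJ
  obtain ⟨Y, v, u, hc, hY, hv, _, hu⟩ := key K
  have hu0 : u = 0 := co_ext B fun b => by
    have := hu b
    rw [pow_succ, hK, zero_mul] at this
    rw [map_zero]; exact this
  exact ⟨Y, hc, by rw [hY, hu0]; simpa using hv⟩

end tenV

section ht
open Finset
variable {F : Type*} [Field F] [CharZero F] [IsAlgClosed F] {g : Type*} [LieRing g] [LieAlgebra F g] {e h f : g} (P : PD F e h f)

theorem repr_diag {n : ℕ} (B : Module.Basis (Fin n) F g) (T : g →ₗ[F] g) (c : Fin n → F) (hT : ∀ b, T (B b) = c b • B b)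
    (y : g) (d : Fin n) : B.repr (T y) d = c d * B.repr y d := by
  have : (B.coord d) ∘ₗ T = c d • B.coord d := B.ext fun b => by
    rw [lco, hT, map_smul, lsm]
    by_cases hb : b = d
    · rw [hb]
    · simp [Finsupp.single_apply, hb]
  simpa using LinearMap.congr_fun this y

/-- height -/
def PD.ht (b : Fin P.n) : ℤ := ∑ i, P.wt b i

theorem PD.repr_wt {y : g} {i : Fin P.r} {μ : F} (hy : ⁅P.w i, y⁆ = μ • y) {c : Fin P.n} (hc : P.B.repr y c ≠ 0) :
    (P.wt c i : F) = μ := by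
  have h1 : P.B.repr ⁅P.w i, y⁆ c = P.wt c i * P.B.repr y c :=
    repr_diag P.B (ad F g (P.w i)) (fun b => (P.wt b i : F)) (P.wB i) y c
  rw [hy, map_smul, fsm, smul_eq_mul] at h1
  exact (mul_right_cancel₀ hc h1).symm

theorem PD.hB (b : Fin P.n) : ⁅h, P.B b⁆ = ((2 * P.ht b : ℤ) : F) • P.B b := by
  have h1 : ⁅h, P.B b⁆ = ⁅(2 : F) • ∑ i, P.w i, P.B b⁆ := congrArg (fun t => ⁅t, P.B b⁆) P.h_eq
  rw [h1, smul_lie, sum_lie]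
  simp only [P.wB, ← sum_smul, smul_smul, PD.ht]
  push_cast; rfl

theorem PD.repr_h {y : g} {m : ℤ} (hy : ⁅h, y⁆ = ((2 * m : ℤ) : F) • y) {c : Fin P.n} (hc : P.B.repr y c ≠ 0) :
    P.ht c = m := by
  have h1 : P.B.repr ⁅h, y⁆ c = ((2 * P.ht c : ℤ) : F) * P.B.repr y c :=
    repr_diag P.B (ad F g h) (fun b => ((2 * P.ht b : ℤ) : F)) P.hB y c
  rw [hy, map_smul, fsm, smul_eq_mul] at h1
  have := Int.cast_injective (mul_right_cancel₀ hc h1)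
  omega

theorem wt_lie {w x y : g} {a b : F} (hx : ⁅w, x⁆ = a • x) (hy : ⁅w, y⁆ = b • y) : ⁅w, ⁅x, y⁆⁆ = (a + b) • ⁅x, y⁆ := by
  rw [leibniz_lie, hx, hy, smul_lie, lie_smul, add_smul]

theorem PD.wt_add {a b c : Fin P.n} (hc : P.B.repr ⁅P.B a, P.B b⁆ c ≠ 0) (i) : P.wt c i = P.wt a i + P.wt b i := by
  have := P.repr_wt (wt_lie (P.wB i a) (P.wB i b)) hc
  exact_mod_cast this

theorem PD.ht_add {a b c : Fin P.n} (hc : P.B.repr ⁅P.B a, P.B b⁆ c ≠ 0) : P.ht c = P.ht a + P.ht b := by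
  simp only [PD.ht, ← sum_add_distrib, P.wt_add hc]

/-- projection to height m -/
noncomputable def PD.pr (m : ℤ) : g →ₗ[F] g := P.B.constr F fun b => if P.ht b = m then P.B b else 0

theorem PD.pr_B (m : ℤ) (b) : P.pr m (P.B b) = if P.ht b = m then P.B b else 0 := P.B.constr_basis F _ b

theorem PD.pr_hom {y : g} {k : ℤ} (hy : ⁅h, y⁆ = ((2 * k : ℤ) : F) • y) (m : ℤ) : P.pr m y = if k = m then y else 0 := by
  conv_lhs => rw [← P.B.sum_repr y, map_sum]
  have : ∀ b, P.pr m (P.B.repr y b • P.B b) = if k = m then P.B.repr y b • P.B b else 0 := fun b => by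
    rw [map_smul, P.pr_B]
    by_cases hc : P.B.repr y b = 0
    · simp [hc]
    · rw [P.repr_h hy hc]; split_ifs <;> simp
  simp only [this]
  split_ifs
  · exact P.B.sum_repr y
  · simp

theorem PD.h_pr (m : ℤ) (x : g) : ⁅h, P.pr m x⁆ = ((2 * m : ℤ) : F) • P.pr m x := by
  conv_lhs => rw [← P.B.sum_repr x]
  conv_rhs => rw [← P.B.sum_repr x]
  simp only [map_sum, map_smul, P.pr_B, lie_sum, lie_smul, smul_sum]
  refine sum_congr rfl fun b _ => ?_
  split_ifs with hb
  · rw [P.hB, hb, smul_comm]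
  · simp

theorem PD.lie_pr {y : g} {k : ℤ} (hy : ⁅h, y⁆ = ((2 * k : ℤ) : F) • y) (m : ℤ) (x : g) :
    ⁅y, P.pr m x⁆ = P.pr (m + k) ⁅y, x⁆ := by
  conv_lhs => rw [← P.B.sum_repr x]
  conv_rhs => rw [← P.B.sum_repr x]
  simp only [map_sum, map_smul, P.pr_B, lie_sum, lie_smul]
  refine sum_congr rfl fun b _ => ?_
  have h1 : ⁅h, ⁅y, P.B b⁆⁆ = ((2 * (k + P.ht b) : ℤ) : F) • ⁅y, P.B b⁆ := by
    rw [wt_lie hy (P.hB b)]; push_cast; ring_nf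
  rw [P.pr_hom h1]
  by_cases hb : P.ht b = m
  · rw [if_pos hb, if_pos (by omega)]
  · rw [if_neg hb, if_neg (by omega), lie_zero]

theorem PD.repr_pr (m : ℤ) (x : g) (b) : P.B.repr (P.pr m x) b = if P.ht b = m then P.B.repr x b else 0 := by
  conv_lhs => rw [← P.B.sum_repr x]
  simp only [map_sum, map_smul, P.pr_B]
  rw [Finsupp.finsetSum_apply, sum_eq_single b]
  · split_ifs <;> simp
  · intro c _ hc; split_ifs <;> simp [Finsupp.single_apply, hc]
  · simp

theorem PD.hf2 (P : PD F e h f) : ⁅h, f⁆ = ((2 * (-1) : ℤ) : F) • f := by rw [P.pt.hf]; norm_num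
theorem PD.he2 (P : PD F e h f) : ⁅h, e⁆ = ((2 * 1 : ℤ) : F) • e := by rw [P.pt.he]; norm_num

theorem PD.cent_f {x : g} (hx : ⁅f, x⁆ = 0) {b} (hb : 0 < P.ht b) : P.B.repr x b = 0 := by
  have h1 := P.lie_pr P.hf2 (P.ht b) x
  rw [hx, map_zero] at h1
  have h2 := P.pt.f_inj (2 * P.ht b) _ (by omega) (P.h_pr _ x) h1
  have := P.repr_pr (P.ht b) x b
  rw [h2] at this; simpa using this.symm

theorem PD.fe_inj (P : PD F e h f) [FiniteDimensional F g] {x : g} {m : ℤ} (hm : m ≤ -1) (hx : ⁅h, x⁆ = ((2 * m : ℤ) : F) • x) (h0 : ⁅f, ⁅e, x⁆⁆ = 0) : x = 0 := by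
  have hhe : ⁅h, e⁆ = 2 • e := by rw [P.pt.he, two_smul, two_smul]
  have hhf : ⁅h, f⁆ = -(2 • f) := by rw [P.pt.hf, neg_smul, two_smul, two_smul]
  obtain ⟨a, b, c⟩ := ad_sl2 (F := F) hhe hhf P.pt.ef
  exact sl2_fe_inj a b c (2 * m) (by omega) x (mei.2 hx) h0

/-- splitting of basis elements -/
theorem PD.split (b : Fin P.n) : ∃ v z : g, ⁅f, v⁆ = 0 ∧ P.B b = v + ⁅e, z⁆ ∧
    ⁅h, v⁆ = ((2 * P.ht b : ℤ) : F) • v ∧ ⁅h, z⁆ = ((2 * (P.ht b - 1) : ℤ) : F) • z := by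
  rcases le_or_gt (P.ht b) 0 with hb | hb
  · obtain ⟨y, hy, h0⟩ := P.pt.slice (2 * P.ht b) _ (by omega) (P.hB b)
    have hy' : ⁅h, y⁆ = ((2 * (P.ht b - 1) : ℤ) : F) • y := by rw [hy]; congr 2; ring
    refine ⟨_, y, h0, by abel, ?_, hy'⟩
    rw [lie_sub, wt_lie P.he2 hy', P.hB, smul_sub]; push_cast; ring_nf
  · obtain ⟨y, hy, h0⟩ := P.pt.e_surj (2 * P.ht b) _ (by omega) (P.hB b)
    exact ⟨0, y, lie_zero _, by rw [h0, zero_add], by simp, by rw [hy]; congr 2; ring⟩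

end ht

section fil
open Finset
variable {F : Type*} [Field F] [CharZero F] [IsAlgClosed F] {g : Type*} [LieRing g] [LieAlgebra F g] {e h f : g}
  (P : PD F e h f) {R : Type*} [CommRing R] [Algebra F R]

/-- height filtration -/
noncomputable def PD.Fil (m : ℤ) : Submodule F (R ⊗[F] g) where
  carrier := {X | ∀ b, m < P.ht b → co P.B b X = 0}
  add_mem' hx hy b hb := by rw [map_add, hx b hb, hy b hb, add_zero]
  zero_mem' b _ := map_zero _
  smul_mem' c x hx b hb := by rw [map_smul, hx b hb, smul_zero]

theorem PD.Fil_mono {m l : ℤ} (hl : m ≤ l) : P.Fil m ≤ (P.Fil l : Submodule F (R ⊗[F] g)) :=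
  fun _ hX b hb => hX b (by omega)

theorem PD.Fil_le {m l : ℤ} (hl : m ≤ l) {X : R ⊗[F] g} (hX : X ∈ P.Fil m) : X ∈ P.Fil l := P.Fil_mono hl hX

theorem PD.Fil_lie {m l k : ℤ} (hk : m + l ≤ k) {X Y : R ⊗[F] g} (hX : X ∈ P.Fil m) (hY : Y ∈ P.Fil l) : ⁅X, Y⁆ ∈ P.Fil k := by
  intro c hc
  rw [co_lie]
  refine sum_eq_zero fun a _ => sum_eq_zero fun b _ => ?_
  by_cases h0 : P.B.repr ⁅P.B a, P.B b⁆ c = 0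
  · rw [h0, zero_smul]
  have := P.ht_add h0
  rcases le_or_gt (P.ht a) m with ha | ha
  · rw [hY b (by omega), mul_zero, smul_zero]
  · rw [hX a ha, zero_mul, smul_zero]

theorem PD.Fil_tmul {m k : ℤ} (hk : m ≤ k) {x : g} (hx : ⁅h, x⁆ = ((2 * m : ℤ) : F) • x) (r : R) : r ⊗ₜ[F] x ∈ P.Fil k := by
  intro b hb
  rw [co_tmul]
  by_cases h0 : P.B.repr x b = 0
  · rw [h0, zero_smul]
  · have := P.repr_h hx h0; omega

theorem PD.bd : ∃ M : ℤ, 1 ≤ M ∧ ∀ b, |P.ht b| ≤ M := by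
  refine ⟨∑ b, |P.ht b| + 1, ?_, fun b => ?_⟩
  · have := sum_nonneg (s := univ) fun b _ => abs_nonneg (P.ht b); omega
  · have := single_le_sum (f := fun b => |P.ht b|) (fun b _ => abs_nonneg (P.ht b)) (mem_univ b); omega

theorem PD.Fil_bot {m : ℤ} (hm : ∀ b, m < P.ht b) {X : R ⊗[F] g} (hX : X ∈ P.Fil m) : X = 0 :=
  co_ext P.B fun b => by rw [hX b (hm b), map_zero]

theorem PD.Fil_nilp {N : R ⊗[F] g} (hN : N ∈ P.Fil (-1)) :
    IsNilpotent (ad F (R ⊗[F] g) N : End F (R ⊗[F] g)) := by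
  obtain ⟨M, hM, hb⟩ := P.bd
  refine ⟨(2 * M + 1).toNat, LinearMap.ext fun X => ?_⟩
  have : ∀ k : ℕ, ((ad F (R ⊗[F] g) N : End F (R ⊗[F] g)) ^ k) X ∈ P.Fil (M - k) := by
    intro k
    induction k with
    | zero => intro b h0; have := abs_le.1 (hb b); simp at h0; omega
    | succ k ih =>
      rw [pow_succ' (ad F (R ⊗[F] g) N), ema, adp]
      exact P.Fil_lie (by push_cast; omega) hN ih
  exact P.Fil_bot (fun b => by have := abs_le.1 (hb b); omega) (this _)

/-- conjugation by the lower unipotent group -/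
def PD.CjM (R : Type*) [CommRing R] [Algebra F R] : R ⊗[F] g → R ⊗[F] g → Prop :=
  Relation.ReflTransGen fun X Y => ∃ N ∈ P.Fil (-1), Y = nx (ad F (R ⊗[F] g) N : End F (R ⊗[F] g)) X

theorem PD.CjM.cj {X Y : R ⊗[F] g} (hc : P.CjM R X Y) : Cj F (R ⊗[F] g) X Y := by
  induction hc with
  | refl => exact Cj.refl _
  | tail _ hs ih => obtain ⟨N, hN, rfl⟩ := hs; exact ih.trans (Cj.step (P.Fil_nilp hN) _)

theorem PD.CjM.symm {X Y : R ⊗[F] g} (hc : P.CjM R X Y) : P.CjM R Y X := by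
  induction hc with
  | refl => exact .refl
  | tail _ hs ih =>
  refine Relation.ReflTransGen.trans ?_ ih
  obtain ⟨N, hN, rfl⟩ := hs
  have : (ad F (R ⊗[F] g) (-N) : End F (R ⊗[F] g)) = -ad F (R ⊗[F] g) N := map_neg _ _
  exact Relation.ReflTransGen.single ⟨-N, neg_mem hN, by rw [this, nx_neg_apply (P.Fil_nilp hN)]⟩

theorem co_rT {n : ℕ} (B : Module.Basis (Fin n) F g) {R' : Type*} [CommRing R'] [Algebra F R'] (φ : R →ₗ[F] R') (X : R ⊗[F] g) (b) :
    co B b (φ.rTensor g X) = φ (co B b X) := by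
  induction X with
  | zero => simp
  | add x y hx hy => simp only [map_add, hx, hy]
  | tmul r x => simp

theorem rT_lie {R' : Type*} [CommRing R'] [Algebra F R'] (φ : R →ₐ[F] R') (X Y : R ⊗[F] g) :
    φ.toLinearMap.rTensor g ⁅X, Y⁆ = ⁅φ.toLinearMap.rTensor g X, φ.toLinearMap.rTensor g Y⁆ := by
  induction X with
  | zero => simp
  | add x y hx hy => simp only [map_add, hx, hy, add_lie]
  | tmul r x =>
    induction Y with
    | zero => simp
    | add x y hx hy => simp only [map_add, hx, hy, lie_add]
    | tmul s y => simp

theorem PD.CjM.map {R' : Type*} [CommRing R'] [Algebra F R'] (φ : R →ₐ[F] R') {X Y : R ⊗[F] g} (hc : P.CjM R X Y) :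
    P.CjM R' (φ.toLinearMap.rTensor g X) (φ.toLinearMap.rTensor g Y) := by
  induction hc with
  | refl => exact .refl
  | tail _ hs ih =>
  refine ih.trans ?_
  obtain ⟨N, hN, rfl⟩ := hs
  have hN' : φ.toLinearMap.rTensor g N ∈ P.Fil (-1) := fun b hb => by rw [co_rT, hN b hb, map_zero]
  exact Relation.ReflTransGen.single ⟨_, hN', nx_comm _ (P.Fil_nilp hN) (P.Fil_nilp hN') (fun v => rT_lie φ N v) _⟩

theorem PD.CjM.low {X Y : R ⊗[F] g} (hc : P.CjM R X Y) : ∃ u : End F (R ⊗[F] g),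
    (∀ x y, u ⁅x, y⁆ = ⁅u x, u y⁆) ∧ (∀ m, ∀ x ∈ P.Fil m, u x - x ∈ P.Fil (m - 1)) ∧ u X = Y := by
  induction hc with
  | refl => exact ⟨1, fun _ _ => rfl, fun m x _ => by simp, rfl⟩
  | tail _ hs ih =>
  obtain ⟨u, h1, h2, h3⟩ := ih
  obtain ⟨N, hN, rfl⟩ := hs
  refine ⟨nx (ad F (R ⊗[F] g) N) * u, fun x y => ?_, fun m x hx => ?_, by rw [ema, h3]⟩
  · simp only [ema, h1, nx_lie (P.Fil_nilp hN)]
  · have h4 := h2 m x hx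
    have h5 : u x ∈ P.Fil m := by
      have := add_mem (P.Fil_le (by omega : m - 1 ≤ m) h4) hx; simpa using this
    have h6 : nx (ad F (R ⊗[F] g) N) (u x) - u x ∈ P.Fil (m - 1) := by
      refine nx_sub1 (P.Fil_nilp hN) _ _ fun k => ?_
      induction k with
      | zero => simpa using P.Fil_lie (by omega) hN h5
      | succ k ih =>
        rw [pow_succ' (ad F (R ⊗[F] g) N), ema, adp]
        exact P.Fil_lie (by omega) hN (P.Fil_le (by omega : m - 1 ≤ m) ih)
    have := add_mem h6 h4
    simpa using this

/-- the slice -/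
def Sl (F : Type*) [Field F] {g : Type*} [LieRing g] [LieAlgebra F g] (e f : g) (R : Type*) [CommRing R] [Algebra F R] : Set (R ⊗[F] g) :=
  {Y | Y - 1 ⊗ₜ e ∈ tenV (cent F g f)}

theorem lie_tenV {v : R ⊗[F] g} (hv : v ∈ tenV (cent F g f)) : ⁅(1 : R) ⊗ₜ[F] f, v⁆ = 0 := by
  obtain ⟨t, rfl⟩ := hv
  induction t with
  | zero => simp
  | add x y hx hy => rw [map_add, lie_add, hx, hy, add_zero]
  | tmul r x => have := mem_cent.1 x.2; simp [this]

theorem PD.tenV_Fil {v : R ⊗[F] g} (hv : v ∈ tenV (cent F g f)) : v ∈ P.Fil 0 := by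
  obtain ⟨t, rfl⟩ := hv
  induction t with
  | zero => simp
  | add x y hx hy => rw [map_add]; exact add_mem hx hy
  | tmul r x => intro b hb; have := P.cent_f (mem_cent.1 x.2) hb; simp [this]

theorem gstep {s Y v u v1 N : R ⊗[F] g} (hY : Y = s + v + u) (hu : u = v1 + ⁅s, N⁆) :
    nx (ad F (R ⊗[F] g) N) Y - (s + (v + v1)) =
      (nx (ad F (R ⊗[F] g) N) Y - Y - (ad F (R ⊗[F] g) N) Y) + ⁅N, v + u⁆ := by
  have : (ad F (R ⊗[F] g) N) Y = ⁅N, v + u⁆ - ⁅s, N⁆ := by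
    rw [adp, ← lie_skew s N, sub_neg_eq_add, ← lie_add, hY]; congr 1; abel
  rw [this]
  have h4 : Y = s + v + (v1 + ⁅s, N⁆) := by rw [← hu]; exact hY
  have h5 : ∀ P Q : R ⊗[F] g, P - (s + (v + v1)) = P - Y - (Q - ⁅s, N⁆) + Q := fun P Q => by rw [h4]; abel
  exact h5 _ _

/-- splitting of an element of `Fil m` -/
theorem PD.splitR {m : ℤ} {u : R ⊗[F] g} (hu : u ∈ P.Fil m) : ∃ v N : R ⊗[F] g, v ∈ tenV (cent F g f) ∧ v ∈ P.Fil m ∧ N ∈ P.Fil (m - 1) ∧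
    u = v + ⁅(1 : R) ⊗ₜ[F] e, N⁆ := by
  choose vv zz h1 h2 h3 h4 using P.split
  refine ⟨∑ b, co P.B b u ⊗ₜ vv b, ∑ b, co P.B b u ⊗ₜ zz b, ssu _ fun b _ => tmul_tenV _ (mem_cent.2 (h1 b)),
    ssu _ fun b _ => ?_, ssu _ fun b _ => ?_, ?_⟩
  · rcases le_or_gt (P.ht b) m with hb | hb
    · exact P.Fil_tmul hb (h3 b) _
    · rw [hu b hb, TensorProduct.zero_tmul]; exact zero_mem _
  · rcases le_or_gt (P.ht b) m with hb | hb
    · exact P.Fil_tmul (by omega) (h4 b) _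
    · rw [hu b hb, TensorProduct.zero_tmul]; exact zero_mem _
  · conv_lhs => rw [co_sum P.B u]
    simp only [lie_sum, btm, one_mul]
    rw [← sum_add_distrib]
    refine sum_congr rfl fun b _ => ?_
    rw [← TensorProduct.tmul_add, ← h2 b]

theorem PD.gauge {X : R ⊗[F] g} (hX : X - 1 ⊗ₜ e ∈ P.Fil 0) : ∃ Y, P.CjM R X Y ∧ Y ∈ Sl F e f R := by
  obtain ⟨M, hM, hbd⟩ := P.bd
  have he : (1 : R) ⊗ₜ[F] e ∈ P.Fil 1 := P.Fil_tmul le_rfl P.he2 _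
  have key : ∀ k : ℕ, ∃ Y v u, P.CjM R X Y ∧ Y = 1 ⊗ₜ e + v + u ∧ v ∈ tenV (cent F g f) ∧ u ∈ P.Fil (-k) := by
    intro k
    induction k with
    | zero => exact ⟨X, 0, X - 1 ⊗ₜ e, .refl, by abel, zero_mem _, by simpa using hX⟩
    | succ k ih =>
      obtain ⟨Y, v, u, hc, hY, hv, hu⟩ := ih
      obtain ⟨v1, N, a1, a2, a3, a4⟩ := P.splitR hu
      have hN : N ∈ P.Fil (-1) := P.Fil_le (by omega) a3
      have hnil := P.Fil_nilp hN
      have hvu : v + u ∈ P.Fil 0 := add_mem (P.tenV_Fil hv) (P.Fil_le (by omega) hu)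
      have hYF : Y ∈ P.Fil 1 := by rw [hY, add_assoc]; exact add_mem he (P.Fil_le (by omega) hvu)
      refine ⟨_, v + v1, nx (ad F (R ⊗[F] g) N) Y - (1 ⊗ₜ e + (v + v1)), hc.trans (.single ⟨N, hN, rfl⟩), by abel,
        add_mem hv a1, ?_⟩
      rw [gstep hY a4]
      refine add_mem (nx_sub2 hnil _ Y fun m => ?_) (P.Fil_lie (by push_cast; omega) a3 hvu)
      induction m with
      | zero =>
        rw [zero_add, pow_two, ema, adp, adp]
        exact P.Fil_lie (k := _) (l := -k) (m := -k - 1) (by push_cast; omega) a3 (P.Fil_lie (by omega) a3 hYF)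
      | succ m ih =>
        rw [show m + 1 + 2 = (m + 2) + 1 by ring, pow_succ' (ad F (R ⊗[F] g) N), ema, adp]
        exact P.Fil_lie (by omega) hN ih
  obtain ⟨Y, v, u, hc, hY, hv, hu⟩ := key (M + 1).toNat
  have hu0 : u = 0 := P.Fil_bot (fun b => by have := abs_le.1 (hbd b); omega) hu
  exact ⟨Y, hc, by rw [Sl, Set.mem_setOf_eq, hY, hu0]; simpa using hv⟩

theorem PD.sum_top (P : PD F e h f) {s : R ⊗[F] g} (hs : s ∈ Sl F e f R) (X : R ⊗[F] g) :
    ∃ v ∈ tenV (cent F g f), ∃ N, X = v + ⁅s, N⁆ := by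
  obtain ⟨M, hM, hbd⟩ := P.bd
  have key : ∀ k : ℕ, ∀ X ∈ P.Fil (-M - 1 + k), ∃ v ∈ tenV (cent F g f), ∃ N : R ⊗[F] g, X = v + ⁅s, N⁆ := by
    intro k
    induction k with
    | zero => 
      intro X hX
      exact ⟨0, zero_mem _, 0, by rw [P.Fil_bot (fun b => by have := abs_le.1 (hbd b); push_cast; omega) hX]; simp⟩
    | succ k ih =>
      intro X hX
      obtain ⟨v1, N, a1, a2, a3, a4⟩ := P.splitR hX
      obtain ⟨v, hv, N', h1⟩ := ih (X - v1 - ⁅s, N⁆) (by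
        have : X - v1 - ⁅s, N⁆ = -⁅s - 1 ⊗ₜ e, N⁆ := by rw [sub_lie]; nth_rewrite 1 [a4]; abel
        rw [this]; exact neg_mem (P.Fil_lie (by push_cast; omega) (P.tenV_Fil hs) a3))
      refine ⟨v + v1, add_mem hv a1, N' + N, ?_⟩
      rw [lie_add, sub_sub, sub_eq_iff_eq_add] at *
      rw [h1]; abel
  exact key (2 * M + 1).toNat X fun b hb => by have := abs_le.1 (hbd b); omega

end fil

section uniq
open Finset
variable {F : Type*} [Field F] [CharZero F] [IsAlgClosed F] {g : Type*} [LieRing g] [LieAlgebra F g] {e h f : g}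
  (P : PD F e h f) {R : Type*} [CommRing R] [Algebra F R]

/-- applying a functional -/
noncomputable def ap (lam : R →ₗ[F] F) : (R ⊗[F] g) →ₗ[F] g := (TensorProduct.lid F g).toLinearMap ∘ₗ lam.rTensor g

theorem repr_ap {n : ℕ} (B : Module.Basis (Fin n) F g) (lam : R →ₗ[F] F) (X : R ⊗[F] g) (b) : B.repr (ap lam X) b = lam (co B b X) := by
  induction X with
  | zero => simp
  | add x y hx hy => simp only [map_add, Finsupp.add_apply, hx, hy]
  | tmul r x => simp [ap, mul_comm]

theorem ap_lie (lam : R →ₗ[F] F) (x : g) (X : R ⊗[F] g) : ap lam ⁅(1 : R) ⊗ₜ[F] x, X⁆ = ⁅x, ap lam X⁆ := by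
  induction X with
  | zero => simp
  | add x y hx hy => simp only [map_add, lie_add, hx, hy]
  | tmul r x => simp [ap]

theorem PD.fe_Fil [FiniteDimensional F g] {k : ℤ} (hk : 1 ≤ k) {Y : R ⊗[F] g} (hY : Y ∈ P.Fil (-k))
    (h0 : ⁅(1 : R) ⊗ₜ[F] f, ⁅(1 : R) ⊗ₜ[F] e, Y⁆⁆ ∈ P.Fil (-k - 1)) : Y ∈ P.Fil (-k - 1) := by
  intro b hb
  rcases lt_or_ge (-k) (P.ht b) with hb' | hb'
  · exact hY b hb'
  have hbk : P.ht b = -k := by omega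
  rw [← Module.forall_dual_apply_eq_zero_iff F]
  intro lam
  have h1 : P.pr (-k) (ap lam Y) = 0 := by
    refine P.fe_inj (m := -k) (by omega) (P.h_pr _ _) ?_
    rw [P.lie_pr P.he2, P.lie_pr P.hf2, ← ap_lie, ← ap_lie]
    refine P.B.ext_elem fun c => ?_
    rw [P.repr_pr, repr_ap, map_zero, Finsupp.zero_apply]
    split_ifs with hc
    · rw [h0 c (by omega), map_zero]
    · rfl
  have := P.repr_pr (-k) (ap lam Y) b
  rw [h1, if_pos hbk, repr_ap] at this
  simpa using this.symm

theorem PD.h_Fil {m : ℤ} {X : R ⊗[F] g} (hX : X ∈ P.Fil m) : ⁅(1 : R) ⊗ₜ[F] h, X⁆ - ((2 * m : ℤ) : F) • X ∈ P.Fil (m - 1) := by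
  have h1 : ∀ b, co P.B b ⁅(1 : R) ⊗ₜ[F] h, X⁆ = ((2 * P.ht b : ℤ) : F) • co P.B b X := by
    intro b
    clear hX
    induction X with
    | zero => simp
    | add x y hx hy => simp only [map_add, lie_add, hx, hy, smul_add]
    | tmul r x =>
      rw [btm, co_tmul, co_tmul, one_mul, smul_smul]
      congr 1
      exact repr_diag P.B (ad F g h) (fun b => ((2 * P.ht b : ℤ) : F)) P.hB x b
  intro b hb
  rw [map_sub, h1, map_smul]
  rcases lt_or_ge m (P.ht b) with hb' | hb'
  · rw [hX b hb']; simp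
  · rw [show P.ht b = m by omega, sub_self]

theorem PD.low_uniq [FiniteDimensional F g] {s s' : R ⊗[F] g} (hs : s ∈ Sl F e f R) (hs' : s' ∈ Sl F e f R) (hc : P.CjM R s s') : s = s' := by
  obtain ⟨u, u1, u2, u3⟩ := PD.CjM.low P hc
  obtain ⟨M, hM, hbd⟩ := P.bd
  have key : ∀ k : ℕ, ∀ m, ∀ x ∈ P.Fil m, u x - x ∈ P.Fil (m - (k + 1)) := by
    intro k
    induction k with
    | zero => simpa using u2
    | succ k ih =>
      set H : R ⊗[F] g := 1 ⊗ₜ h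
      set E : R ⊗[F] g := 1 ⊗ₜ e
      have hH : H ∈ P.Fil 0 := P.Fil_tmul le_rfl (by simp) _
      have hE : E ∈ P.Fil 1 := P.Fil_tmul le_rfl P.he2 _
      set Y := u H - H
      have hY : Y ∈ P.Fil (-(k + 1)) := by simpa using ih 0 H hH
      have st : ∀ (m : ℤ) (x : R ⊗[F] g), x ∈ P.Fil m → ⁅H, x⁆ = ((2 * m : ℤ) : F) • x →
          ((2 * (k + 1) : ℤ) : F) • (u x - x) - ⁅Y, x⁆ ∈ P.Fil (m - (k + 2)) := by
        intro m x hx hw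
        have e1 := u1 H x
        rw [hw, map_smul] at e1
        have a1 := P.h_Fil (ih m x hx)
        have a2 := P.Fil_lie (k := m - (k + 2)) (by omega) hY (ih m x hx)
        have : ((2 * (k + 1) : ℤ) : F) • (u x - x) - ⁅Y, x⁆ = (⁅H, u x - x⁆ - ((2 * (m - (k + 1)) : ℤ) : F) • (u x - x)) + ⁅Y, u x - x⁆ := by
          have e2 : ⁅Y, u x - x⁆ = ⁅u H, u x⁆ - ⁅H, u x⁆ - ⁅Y, x⁆ := by simp only [Y, lie_sub, sub_lie]
          rw [e2, ← e1, lie_sub, hw]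
          have e3 : ((2 * (m - (k + 1)) : ℤ) : F) • (u x - x) = ((2 * m : ℤ) : F) • (u x - x) - ((2 * (k + 1) : ℤ) : F) • (u x - x) := by
            rw [← sub_smul]; push_cast; ring_nf
          rw [e3, smul_sub ((2 * m : ℤ) : F)]
          abel
        rw [this]
        exact add_mem (P.Fil_le (by omega) a1) a2
      have hv := P.tenV_Fil hs
      have b1 := ih 0 _ hv
      have b2 := st 1 E hE (by simp only [H, E, btm, P.he2, TensorProduct.tmul_smul, one_mul])
      have b3 : ((2 * (k + 1) : ℤ) : F) • ((s' - E) - (s - E)) - ⁅Y, E⁆ ∈ P.Fil (-(k + 1)) := by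
        have : ((2 * (k + 1) : ℤ) : F) • ((s' - E) - (s - E)) - ⁅Y, E⁆ = (((2 * (k + 1) : ℤ) : F) • (u E - E) - ⁅Y, E⁆) 
            + ((2 * (k + 1) : ℤ) : F) • (u (s - E) - (s - E)) := by
          rw [map_sub, u3]; simp only [smul_sub]; abel
        rw [this]
        exact add_mem (P.Fil_le (by omega) b2) (ssm _ _ (by simpa using b1))
      have b4 : ⁅(1 : R) ⊗ₜ[F] f, ⁅E, Y⁆⁆ ∈ P.Fil (-(k + 1) - 1) := by
        have := P.Fil_lie (k := -(k + 1) - 1) (by omega) (P.Fil_tmul le_rfl P.hf2 (1 : R)) b3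
        rw [lie_sub, lie_smul, lie_sub, lie_tenV hs, lie_tenV hs', sub_self, smul_zero, zero_sub, ← lie_neg, lie_skew] at this
        exact this
      have b5 := P.fe_Fil (by omega) hY b4
      have b6 : ∀ (m : ℤ) (x : R ⊗[F] g), x ∈ P.Fil m → ⁅H, x⁆ = ((2 * m : ℤ) : F) • x → u x - x ∈ P.Fil (m - (k + 2)) := by
        intro m x hx hw
        have c1 := add_mem (st m x hx hw) (P.Fil_lie (k := m - (k + 2)) (by omega) b5 hx)
        rw [sub_add_cancel] at c1
        have h0 : ((2 * (k + 1) : ℤ) : F) ≠ 0 := by norm_cast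
        have := ssm _ ((2 * (k + 1) : ℤ) : F)⁻¹ c1
        rwa [inv_smul_smul₀ h0] at this
      intro m x hx
      have : u x - x = ∑ b, (u (co P.B b x ⊗ₜ P.B b) - co P.B b x ⊗ₜ P.B b) := by
        rw [sum_sub_distrib, ← map_sum, ← co_sum P.B x]
      rw [this]
      refine ssu _ fun b _ => ?_
      rcases le_or_gt (P.ht b) m with hb | hb
      · refine P.Fil_le ?_ (b6 (P.ht b) _ (P.Fil_tmul le_rfl (P.hB b) _) ?_)
        · push_cast; omega
        · simp only [H, btm, P.hB, TensorProduct.tmul_smul, one_mul]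
      · rw [hx b hb]; simp
  have h1 : s ∈ P.Fil M := fun b hb => by have := abs_le.1 (hbd b); omega
  have h2 := key (2 * M + 1).toNat M s h1
  have h3 := P.Fil_bot (fun b => by have := abs_le.1 (hbd b); omega) h2
  rw [u3] at h3
  exact (sub_eq_zero.1 h3).symm

end uniq

section kap
open Finset
variable {F : Type*} [Field F] [CharZero F] [IsAlgClosed F] {g : Type*} [LieRing g] [LieAlgebra F g] {e h f : g}
  (P : PD F e h f) {R : Type*} [CommRing R] [Algebra F R]

/-- the elements `e + z` -/
noncomputable def PD.eta (z : Fin P.r → R) : R ⊗[F] g := 1 ⊗ₜ e + ∑ i, z i ⊗ₜ P.w i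

/-- the slice elements -/
noncomputable def sig {r : ℕ} (e : g) (v : Fin r → g) (y : Fin r → R) : R ⊗[F] g := 1 ⊗ₜ e + ∑ i, y i ⊗ₜ v i

theorem PD.eta_map {R' : Type*} [CommRing R'] [Algebra F R'] (φ : R →ₐ[F] R') (z : Fin P.r → R) :
    φ.toLinearMap.rTensor g (P.eta z) = P.eta fun i => φ (z i) := by simp [PD.eta]

theorem sig_map {r : ℕ} (v : Fin r → g) {R' : Type*} [CommRing R'] [Algebra F R'] (φ : R →ₐ[F] R') (y : Fin r → R) :
    φ.toLinearMap.rTensor g (sig e v y) = sig e v fun i => φ (y i) := by simp [sig]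

theorem sig_mem {r : ℕ} {v : Fin r → g} (hv : ∀ i, ⁅f, v i⁆ = 0) (y : Fin r → R) : sig e v y ∈ Sl F e f R := by
  rw [Sl, Set.mem_setOf_eq, sig, add_sub_cancel_left]
  exact ssu _ fun i _ => tmul_tenV _ (mem_cent.2 (hv i))

theorem sig_ex {r : ℕ} {v : Fin r → g} (hv : ∀ x, ⁅f, x⁆ = 0 → ∃ c : Fin r → F, x = ∑ i, c i • v i) {s : R ⊗[F] g} (hs : s ∈ Sl F e f R) :
    ∃ y, s = sig e v y := by
  obtain ⟨t, ht⟩ := hs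
  suffices ∃ y : Fin r → R, s - 1 ⊗ₜ e = ∑ i, y i ⊗ₜ v i by
    obtain ⟨y, hy⟩ := this; exact ⟨y, by rw [sig, ← hy]; abel⟩
  rw [← ht]
  clear ht
  induction t with
  | zero => exact ⟨0, by simp⟩
  | add a b ha hb =>
    obtain ⟨y, hy⟩ := ha; obtain ⟨z, hz⟩ := hb
    exact ⟨y + z, by rw [map_add, hy, hz]; simp [TensorProduct.add_tmul, sum_add_distrib]⟩
  | tmul a x =>
    obtain ⟨c, hc⟩ := hv x (mem_cent.1 x.2)
    refine ⟨fun i => c i • a, ?_⟩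
    simp [hc, TensorProduct.tmul_sum, TensorProduct.smul_tmul]

theorem sig_inj {r : ℕ} {v : Fin r → g} (hv : LinearIndependent F v) {y y' : Fin r → R} (hy : sig (F := F) e v y = sig e v y') : y = y' := by
  have h1 : ∑ i, y i ⊗ₜ[F] v i = ∑ i, y' i ⊗ₜ[F] v i := add_left_cancel hy
  funext j
  rw [← sub_eq_zero, ← Module.forall_dual_apply_eq_zero_iff F]
  intro lam
  have h2 := congrArg (ap lam) h1
  rw [← sub_eq_zero] at h2
  simp only [ap, map_sum, lco, LinearMap.rTensor_tmul, LinearEquiv.coe_coe, TensorProduct.lid_tmul, ← sum_sub_distrib, ← sub_smul, ← map_sub] at h2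
  exact Fintype.linearIndependent_iff.1 hv _ h2 j

theorem PD.eta_Fil (z : Fin P.r → R) : P.eta z - 1 ⊗ₜ e ∈ P.Fil 0 := by
  rw [PD.eta, add_sub_cancel_left]
  exact ssu _ fun i _ => P.Fil_tmul (m := 0) le_rfl (by simp [P.hw]) _

theorem nx3 {V : Type*} [AddCommGroup V] [Module F V] {a : End F V} (ha : IsNilpotent a) (x : V) (h3 : a (a (a x)) = 0) :
    nx a x = x + a x + (2 : F)⁻¹ • a (a x) := by
  obtain ⟨k, hk⟩ := ha
  rw [nx_eq_sum (k := k + 3) (by rw [pow_add, hk, zero_mul]), lsu, sum_range_succ', sum_range_succ', sum_range_succ', sum_eq_zero]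
  · simp [pow_two]; abel
  · intro i _
    rw [lsm, show i + 1 + 1 + 1 = i + 3 by ring, pow_add, ema, show (a ^ 3) x = 0 by simpa [pow_succ] using h3]
    simp

theorem PD.refl_cj (z : Fin P.r → R) (j : Fin P.r) : P.CjM R (P.eta z) (P.eta fun k => z k - (P.C j k : F) • z j) := by
  have hN : z j ⊗ₜ[F] P.ff j ∈ P.Fil (-1) := by
    refine P.Fil_tmul (m := -1) le_rfl ?_ _
    have : ⁅h, P.ff j⁆ = ⁅(2 : F) • ∑ i, P.w i, P.ff j⁆ := congrArg (fun t => ⁅t, P.ff j⁆) P.h_eq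
    rw [this, smul_lie, sum_lie]; simp [P.wf]
  refine .single ⟨z j ⊗ₜ P.ff j, hN, ?_⟩
  set H : g := ∑ k, (P.C j k : F) • P.w k with hH
  have fe : ⁅P.ff j, e⁆ = - H := by
    have : ⁅P.ff j, e⁆ = ⁅P.ff j, ∑ i, P.ee i⁆ := congrArg (fun t => ⁅P.ff j, t⁆) P.e_eq
    rw [this, ← lie_skew, sum_lie]; simp [P.ef, H]
  have fw : ∀ i, ⁅P.ff j, P.w i⁆ = if i = j then P.ff j else 0 := fun i => by
    rw [← lie_skew, P.wf]; split_ifs <;> simp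
  have fH : ⁅P.ff j, H⁆ = (2 : F) • P.ff j := by simp [hH, lie_sum, fw, P.Cii]
  have a1 : ⁅z j ⊗ₜ[F] P.ff j, P.eta z⁆ = - (z j ⊗ₜ H) + (z j * z j) ⊗ₜ P.ff j := by
    simp [PD.eta, lie_sum, fe, fw, TensorProduct.tmul_neg, apply_ite (TensorProduct.tmul F _)]
  have a2 : ⁅z j ⊗ₜ[F] P.ff j, ⁅z j ⊗ₜ[F] P.ff j, P.eta z⁆⁆ = - ((2 : F) • ((z j * z j) ⊗ₜ P.ff j)) := by
    rw [a1, lie_add, lie_neg]; simp [fH]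
  have a3 : ⁅z j ⊗ₜ[F] P.ff j, ⁅z j ⊗ₜ[F] P.ff j, ⁅z j ⊗ₜ[F] P.ff j, P.eta z⁆⁆⁆ = 0 := by
    rw [a2]; simp
  rw [nx3 (P.Fil_nilp hN) _ a3, adp, adp, a2, a1, smul_neg, inv_smul_smul₀ two_ne_zero, PD.eta, PD.eta]
  have : ∑ i, (z i - (P.C j i : F) • z j) ⊗ₜ[F] P.w i = ∑ i, z i ⊗ₜ[F] P.w i - z j ⊗ₜ H := by
    simp [TensorProduct.sub_tmul, sum_sub_distrib, hH, TensorProduct.tmul_sum, TensorProduct.smul_tmul]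
  rw [this]; abel

/-- the slice coordinates of `e + z` -/
theorem PD.kappa [FiniteDimensional F g] (hr : finrank F (cent F g f) = P.r) :
    ∃ (v : Fin P.r → g) (y : Fin P.r → MvPolynomial (Fin P.r) F), LinearIndependent F v ∧ (∀ i, ⁅f, v i⁆ = 0) ∧
      (∀ x, ⁅f, x⁆ = 0 → ∃ c : Fin P.r → F, x = ∑ i, c i • v i) ∧
      (∀ i j, MvPolynomial.aeval (fun k => MvPolynomial.X k - (P.C j k : F) • MvPolynomial.X j) (y i) = y i) ∧
      P.CjM (MvPolynomial (Fin P.r) F) (P.eta MvPolynomial.X) (sig e v y) := by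
  let b := Module.finBasisOfFinrankEq F (cent F g f) hr
  have li : LinearIndependent F fun i => (b i : g) := b.linearIndependent.map' (cent F g f).subtype (by simp)
  have h2 : ∀ x, ⁅f, x⁆ = 0 → ∃ c : Fin P.r → F, x = ∑ i, c i • (b i : g) := fun x hx => 
    ⟨fun i => b.repr ⟨x, hx⟩ i, by
      have := congrArg (cent F g f).subtype (b.sum_repr ⟨x, hx⟩)
      rw [map_sum] at this; exact this.symm⟩
  have h1 : ∀ i, ⁅f, (b i : g)⁆ = 0 := fun i => mem_cent.1 (b i).2
  obtain ⟨Y, hc, hY⟩ := P.gauge (P.eta_Fil (MvPolynomial.X (R := F)))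
  obtain ⟨y, rfl⟩ := sig_ex h2 hY
  refine ⟨_, y, li, h1, h2, fun i j => ?_, hc⟩
  have c1 := PD.CjM.map P (MvPolynomial.aeval (fun k => (MvPolynomial.X k - (P.C j k : F) • MvPolynomial.X j : MvPolynomial (Fin P.r) F))) hc
  rw [PD.eta_map, sig_map] at c1
  simp only [MvPolynomial.aeval_X] at c1
  have c2 := Relation.ReflTransGen.trans (Relation.ReflTransGen.trans (PD.CjM.symm P hc) (P.refl_cj _ j)) c1
  exact (congrFun (sig_inj li (P.low_uniq (sig_mem h1 _) (sig_mem h1 _) c2)) i).symm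

end kap

section hw
open Finset
variable {F : Type*} [Field F] [CharZero F] [IsAlgClosed F] {g : Type*} [LieRing g] [LieAlgebra F g] {e h f : g}
  (P : PD F e h f)

theorem PD.gen (L : Submodule F g) (hw : ∀ i, P.w i ∈ L) (hee : ∀ i, P.ee i ∈ L) (hff : ∀ i, P.ff i ∈ L)
    (hl : ∀ x ∈ L, ∀ y ∈ L, ⁅x, y⁆ ∈ L) : L = ⊤ := by
  have he : e ∈ L := by
    have := ssu L (t := univ) fun i _ => hee i
    rw [← P.e_eq] at this; exact this
  have hf : f ∈ L := by
    have := ssu L (t := univ) fun i _ => ssm L (P.d i) (hff i)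
    rw [← P.f_eq] at this; exact this
  have h0 : ∀ x : g, ⁅h, x⁆ = 0 → x ∈ L := fun x hx => by
    have := P.w_span x hx
    refine (sle.2 ?_) this
    rintro _ ⟨i, rfl⟩; exact hw i
  have hp : ∀ k : ℕ, ∀ x : g, ⁅h, x⁆ = ((2 * k : ℤ) : F) • x → x ∈ L := by
    intro k
    induction k with
    | zero => intro x hx; exact h0 x (by simpa using hx)
    | succ k ih =>
      intro x hx
      obtain ⟨y, hy, rfl⟩ := P.pt.e_surj (2 * (k + 1 : ℕ)) x (by push_cast; omega) hx
      exact hl _ he _ (ih y (by rw [hy]; congr 2; push_cast; ring))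
  have hn : ∀ k : ℕ, ∀ x : g, ⁅h, x⁆ = ((-(2 * k) : ℤ) : F) • x → x ∈ L := by
    intro k
    induction k with
    | zero => intro x hx; exact h0 x (by simpa using hx)
    | succ k ih =>
      intro x hx
      obtain ⟨y, hy, rfl⟩ := P.pt.f_surj (-(2 * (k + 1 : ℕ))) x (by push_cast; omega) hx
      exact hl _ hf _ (ih y (by rw [hy]; congr 2; push_cast; ring))
  refine P.pt.diag L fun m w hw => ?_
  rcases Int.even_or_odd' m with ⟨k, rfl | rfl⟩
  · rcases le_total 0 k with hk | hk
    · lift k to ℕ using hk; exact hp k w hw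
    · obtain ⟨l, rfl⟩ := Int.exists_eq_neg_ofNat hk
      exact hn l w (by rw [hw]; congr 2; ring)
  · rw [P.pt.even k w hw]; exact zero_mem _

/-- highest weight representations by matrices -/
structure HW {F : Type*} [Field F] {g : Type*} [LieRing g] [LieAlgebra F g] {e h f : g} (P : PD F e h f) (lam : Fin P.r → ℤ) where
  d : ℕ
  ρ : g →ₗ[F] Matrix (Fin d) (Fin d) F
  lie : ∀ x y : g, ρ ⁅x, y⁆ = ρ x * ρ y - ρ y * ρ x
  wv : Fin d → Fin P.r → ℤ
  k0 : Fin d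
  diag : ∀ i, ρ (P.w i) = Matrix.diagonal fun k => (wv k i : F)
  top : wv k0 = lam
  le : ∀ k i, wv k i ≤ lam i
  ne : ∀ k, k ≠ k0 → ∃ i, wv k i < lam i
  hi : ∀ i, (ρ (P.ee i)).mulVec (Pi.single k0 1) = 0
  gen : ∀ U : Submodule F (Fin d → F), (∀ x, ∀ u ∈ U, (ρ x).mulVec u ∈ U) → Pi.single k0 1 ∈ U → U = ⊤
  nd : ∀ U : Submodule F (Fin d → F), (∀ x, ∀ u ∈ U, (ρ x).mulVec u ∈ U) → (∀ u ∈ U, u k0 = 0) → U = ⊥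

/-- words in the lowering operators -/
noncomputable def wd {V : Type*} [AddCommGroup V] [Module F V] (δ : g →ₗ[F] End F V) (v : V) : List (Fin P.r) → V
  | [] => v
  | i :: l => δ (P.ff i) (wd δ v l)

variable {V : Type*} [AddCommGroup V] [Module F V] (δ : g →ₗ[F] End F V)
  (hδ : ∀ (x y : g) v, δ ⁅x, y⁆ v = δ x (δ y v) - δ y (δ x v)) (lam : Fin P.r → ℤ) (v : V) 
  (hee : ∀ i, δ (P.ee i) v = 0) (hw : ∀ i, δ (P.w i) v = (lam i : F) • v)

include hδ hw in
theorem wd_wt (l : List (Fin P.r)) (i) : δ (P.w i) (wd P δ v l) = ((lam i - l.count i : ℤ) : F) • wd P δ v l := by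
  induction l with
  | nil => simpa [wd] using hw i
  | cons j l ih =>
    have := hδ (P.w i) (P.ff j) (wd P δ v l)
    rw [eq_sub_iff_add_eq] at this
    rw [wd, ← this, ih, P.wf, map_smul, List.count_cons]
    by_cases hij : i = j
    · subst hij; simp; module
    · simp [hij, Ne.symm hij]

include hδ hw hee in
theorem wd_stable (x : g) {u : V} (hu : u ∈ Submodule.span F (Set.range (wd P δ v))) : δ x u ∈ Submodule.span F (Set.range (wd P δ v)) := by
  set U := Submodule.span F (Set.range (wd P δ v)) with hU
  have mem : ∀ l, wd P δ v l ∈ U := fun l => sss ⟨l, rfl⟩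
  have red : ∀ x : g, (∀ l, δ x (wd P δ v l) ∈ U) → ∀ u ∈ U, δ x u ∈ U := fun x hx u hu => by
    refine (sle (p := U.comap (δ x))).2 ?_ hu
    rintro _ ⟨l, rfl⟩; exact hx l
  let L : Submodule F g := 
    { carrier := {x | ∀ u ∈ U, δ x u ∈ U}
      add_mem' := fun ha hb u hu => by rw [map_add]; exact add_mem (ha u hu) (hb u hu)
      zero_mem' := fun u hu => by simp
      smul_mem' := fun c x hx u hu => by rw [map_smul]; exact ssm _ _ (hx u hu) }
  have hwL : ∀ i, P.w i ∈ L := fun i => red _ fun l => by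
    rw [wd_wt P δ hδ lam v hw]; exact ssm _ _ (mem l)
  have hffL : ∀ i, P.ff i ∈ L := fun i => red _ fun l => mem (i :: l)
  have hL : L = ⊤ := by
    refine P.gen L hwL (fun i => red _ fun l => ?_) hffL ?_
    · induction l with
      | nil => rw [wd, hee]; exact zero_mem _
      | cons j l ih =>
        have := hδ (P.ee i) (P.ff j) (wd P δ v l)
        rw [eq_sub_iff_add_eq] at this
        rw [wd, ← this, P.ef]
        refine add_mem ?_ (hffL j _ ih)
        split_ifs
        · exact (ssu L fun k _ => ssm L _ (hwL k)) _ (mem l)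
        · simp
    · intro x hx y hy u hu
      rw [hδ]; exact sub_mem (hx _ (hy u hu)) (hy _ (hx u hu))
  exact (hL ▸ Submodule.mem_top : x ∈ L) u hu

include hδ hw in
theorem wd_top (hv : v ≠ 0) : v ∉ Submodule.span F (wd P δ v '' {l | l ≠ []}) := by
  intro hmem
  let T : End F V := ∑ i, δ (P.w i)
  have hT : ∀ l, T (wd P δ v l) = ((∑ i, lam i - l.length : ℤ) : F) • wd P δ v l := fun l => by
    simp only [T, lsu, wd_wt P δ hδ lam v hw, ← sum_smul]
    congr 1
    have : (∑ i, l.count i : ℕ) = l.length := by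
      rw [← Multiset.coe_card, ← Multiset.sum_count_eq_card (s := univ) (fun _ _ => mem_univ _)]; simp
    rw [← this]; push_cast; rw [sum_sub_distrib]
  have hle : Submodule.span F (wd P δ v '' {l | l ≠ []}) ≤ ⨆ μ, ⨆ (_ : μ ≠ ((∑ i, lam i : ℤ) : F)), T.eigenspace μ := by
    rw [sle]
    rintro _ ⟨l, hl, rfl⟩
    refine mis ((∑ i, lam i - l.length : ℤ) : F) (mis ?_ (mei.2 (hT l)))
    intro h0
    have := Int.cast_injective h0
    have h3 : l.length ≠ 0 := by simpa using hl
    omega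
  have ind := (Module.End.eigenspaces_iSupIndep T) ((∑ i, lam i : ℤ) : F)
  rw [disjoint_iff_inf_le] at ind
  exact hv ((Submodule.mem_bot F).1 (ind ⟨mei.2 (by simpa [wd] using hT []), hle hmem⟩))

end hw

section hw
open Finset
variable {F : Type*} [Field F] [CharZero F] [IsAlgClosed F] {g : Type*} [LieRing g] [LieAlgebra F g] {e h f : g}
  (P : PD F e h f)
variable {V : Type*} [AddCommGroup V] [Module F V] [FiniteDimensional F V] (δ : g →ₗ[F] End F V)
  (hδ : ∀ (x y : g) v, δ ⁅x, y⁆ v = δ x (δ y v) - δ y (δ x v)) (lam : Fin P.r → ℤ) (v : V) 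
  (hee : ∀ i, δ (P.ee i) v = 0) (hw : ∀ i, δ (P.w i) v = (lam i : F) • v)

include hδ hw hee in
theorem HW.of (hv : v ≠ 0) : Nonempty (HW P lam) := by
  classical
  set wd' := wd P δ v with hwd'
  set U := Submodule.span F (Set.range wd') with hU
  have hUs : ∀ (x : g) u, u ∈ U → δ x u ∈ U := fun x u hu => wd_stable P δ hδ lam v hee hw x hu
  set W := Submodule.span F (wd' '' {l | l ≠ []}) with hW
  have hvW : v ∉ W := wd_top P δ hδ lam v hw hv
  have mem : ∀ l, wd' l ∈ U := fun l => sss ⟨l, rfl⟩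
  let N : Submodule F V := sSup {K | (∀ x, ∀ u ∈ K, δ x u ∈ K) ∧ K ≤ W}
  have hNW : N ≤ W := sSup_le fun K hK => hK.2
  have hNs : ∀ x, ∀ u ∈ N, δ x u ∈ N := fun x u hu => by
    have : N ≤ N.comap (δ x) := sSup_le fun K hK u hu => (le_sSup hK : K ≤ N) (hK.1 x u hu)
    exact this hu
  have hNmax : ∀ K : Submodule F V, (∀ x, ∀ u ∈ K, δ x u ∈ K) → K ≤ W → K ≤ N := fun K h1 h2 => le_sSup ⟨h1, h2⟩
  have hli : LinearIndepOn F (N.mkQ ∘ wd') {([] : List (Fin P.r))} := by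
    refine LinearIndepOn.singleton ?_
    simp only [Function.comp, Submodule.mkQ_apply, ne_eq, Submodule.Quotient.mk_eq_zero]
    exact fun h => hvW (hNW h)
  have hsub : ({([] : List (Fin P.r))} : Set _) ⊆ Set.univ := Set.subset_univ _
  let S := hli.extend hsub
  have hS : LinearIndepOn F (N.mkQ ∘ wd') S := hli.linearIndepOn_extend hsub
  have hSspan : Submodule.span F ((N.mkQ ∘ wd') '' S) = Submodule.span F ((N.mkQ ∘ wd') '' Set.univ) := hli.span_image_extend_eq_span_image hsub
  have hS0 : [] ∈ S := hli.subset_extend hsub rfl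
  haveI : Finite S := hS.finite
  haveI := Fintype.ofFinite S
  let d := Fintype.card S
  let b : Fin d → S := (Fintype.equivFin S).symm
  have bi : Function.Injective b := (Fintype.equivFin S).symm.injective
  have bs : Function.Surjective b := (Fintype.equivFin S).symm.surjective
  have hli' : LinearIndependent F (fun k => N.mkQ (wd' (b k))) := LinearIndependent.comp hS b bi
  let E : (Fin d → F) →ₗ[F] V := Fintype.linearCombination F (fun k => wd' (b k))
  have hE1 : ∀ k, E (Pi.single k 1) = wd' (b k) := fun k => by simp [E]
  have hEU : ∀ z, E z ∈ U := fun z => by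
    simp only [E, Fintype.linearCombination_apply]
    exact ssu _ fun k _ => ssm _ _ (mem _)
  obtain ⟨cb, hcb⟩ := (N.mkQ ∘ₗ E).exists_leftInverse_of_injective (by
    rw [LinearMap.ker_eq_bot, ← LinearMap.ker_eq_bot, LinearMap.ker_eq_bot']
    intro z hz
    have h1 := Fintype.linearIndependent_iff.1 hli' z (by simpa [E, Fintype.linearCombination_apply] using hz)
    funext k; exact h1 k)
  let c : V →ₗ[F] (Fin d → F) := cb ∘ₗ N.mkQ
  have hcE : ∀ z, c (E z) = z := fun z => LinearMap.congr_fun hcb z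
  have hcN : ∀ u ∈ N, c u = 0 := fun u hu => by
    simp only [c, lco, Submodule.mkQ_apply, (Submodule.Quotient.mk_eq_zero N).2 hu, map_zero]
  have hUN : ∀ u ∈ U, u - E (c u) ∈ N := fun u hu => by
    have h1 : N.mkQ u ∈ Submodule.span F ((N.mkQ ∘ wd') '' S) := by
      rw [hSspan, Set.image_univ, Set.range_comp, Submodule.span_image]
      exact Submodule.mem_map_of_mem hu
    have h2 : N.mkQ u ∈ LinearMap.range (N.mkQ ∘ₗ E) := by
      refine sle.2 ?_ h1
      rintro _ ⟨l, hl, rfl⟩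
      obtain ⟨k, hk⟩ := bs ⟨l, hl⟩
      exact ⟨Pi.single k 1, by rw [lco, hE1, hk]; rfl⟩
    obtain ⟨z, hz⟩ := h2
    have h3 : c u = z := by
      have := LinearMap.congr_fun hcb z
      simp only [lco, LinearMap.id_apply] at this hz
      simp only [c, lco]
      rw [← hz]; exact this
    rw [h3, ← Submodule.Quotient.mk_eq_zero, ← Submodule.mkQ_apply, map_sub, sub_eq_zero]
    exact hz.symm
  let ρ : g →ₗ[F] Matrix (Fin d) (Fin d) F :=
    { toFun := fun x => LinearMap.toMatrix' (c ∘ₗ δ x ∘ₗ E)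
      map_add' := fun x y => by rw [map_add, LinearMap.add_comp, LinearMap.comp_add, map_add]
      map_smul' := fun t x => by rw [map_smul, LinearMap.smul_comp, LinearMap.comp_smul, map_smul]; rfl }
  have hρ : ∀ x z, (ρ x).mulVec z = c (δ x (E z)) := fun x z => by
    change (LinearMap.toMatrix' (c ∘ₗ δ x ∘ₗ E)).mulVec z = _
    rw [LinearMap.toMatrix'_mulVec]; rfl
  have key : ∀ x, ∀ u ∈ U, c (δ x u) = (ρ x).mulVec (c u) := fun x u hu => by
    rw [hρ, ← sub_eq_zero, ← map_sub, ← map_sub]; exact hcN _ (hNs x _ (hUN u hu))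
  obtain ⟨k0, hk0⟩ := bs ⟨[], hS0⟩
  have hcb1 : ∀ k, c (wd' (b k)) = Pi.single k 1 := fun k => by rw [← hE1, hcE]
  have hE0 : E (Pi.single k0 1) = v := by rw [hE1, hk0]; rfl
  have hc0 : c v = Pi.single k0 1 := by rw [← hE0, hcE]
  have hdiag : ∀ i, ρ (P.w i) = Matrix.diagonal fun k => ((lam i - (b k).1.count i : ℤ) : F) := fun i => by
    refine Matrix.ext_of_mulVec_single fun k => ?_
    rw [hρ, hE1, wd_wt P δ hδ lam v hw, map_smul]
    erw [hcb1]
    rw [Matrix.diagonal_mulVec_single, ← Pi.single_smul']; simp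
  have hword : ∀ l, l ≠ [] → c (wd' l) k0 = 0 := fun l hl => by
    obtain ⟨i, hi⟩ := List.exists_mem_of_ne_nil l hl
    have h1 := key (P.w i) _ (mem l)
    rw [wd_wt P δ hδ lam v hw, map_smul, hdiag] at h1
    have h2 := congrFun h1 k0
    rw [Matrix.mulVec_diagonal, hk0, Pi.smul_apply, smul_eq_mul] at h2
    have h3 : ((l.count i : ℕ) : F) * c (wd' l) k0 = 0 := by
      simp only [List.count_nil] at h2
      push_cast at h2
      linear_combination -h2
    exact (mul_eq_zero.1 h3).resolve_left (by exact_mod_cast (List.count_pos_iff.2 hi).ne')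
  have hWk : ∀ u ∈ W, c u k0 = 0 := fun u hu => by
    refine (sle (p := LinearMap.ker (LinearMap.proj k0 ∘ₗ c))).2 ?_ hu
    rintro _ ⟨l, hl, rfl⟩; exact hword l hl
  have hUW : ∀ u ∈ U, ∃ a : F, u - a • v ∈ W := fun u hu => by
    have : U ≤ Submodule.span F {v} ⊔ W := by
      rw [hU, sle]
      rintro _ ⟨l, rfl⟩
      by_cases hl : l = []
      · subst hl; exact Submodule.mem_sup_left (Submodule.mem_span_singleton_self v)
      · exact Submodule.mem_sup_right (sss ⟨l, hl, rfl⟩)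
    obtain ⟨y, hy, z, hz, rfl⟩ := Submodule.mem_sup.1 (this hu)
    obtain ⟨a, rfl⟩ := Submodule.mem_span_singleton.1 hy
    exact ⟨a, by simpa using hz⟩
  have hst : ∀ U' : Submodule F (Fin d → F), (∀ x, ∀ u ∈ U', (ρ x).mulVec u ∈ U') → ∀ x, ∀ u ∈ U ⊓ U'.comap c, δ x u ∈ U ⊓ U'.comap c :=
    fun U' hU' x u hu => ⟨hUs x u hu.1, by
      rw [SetLike.mem_coe, Submodule.mem_comap, key x u hu.1]; exact hU' x _ hu.2⟩
  refine ⟨⟨d, ρ, fun x y => ?_, fun k i => lam i - (b k).1.count i, k0, hdiag, ?_, ?_, ?_, ?_, ?_, ?_⟩⟩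
  · refine Matrix.ext_of_mulVec_single fun k => ?_
    rw [Matrix.sub_mulVec, ← Matrix.mulVec_mulVec, ← Matrix.mulVec_mulVec, hρ, hρ y, hρ x (Pi.single k 1),
      hδ, map_sub, key x _ (hUs y _ (hEU _)), key y _ (hUs x _ (hEU _))]
  · funext i; simp [hk0]
  · intro k i; simp
  · intro k hk
    have : (b k).1 ≠ [] := fun h0 => hk (bi (by rw [hk0]; exact Subtype.ext h0))
    obtain ⟨i, hi⟩ := List.exists_mem_of_ne_nil _ this
    exact ⟨i, by have := List.count_pos_iff.2 hi; omega⟩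
  · intro i; rw [hρ, hE0, hee, map_zero]
  · intro U' hU' h0
    have hall : ∀ l, c (wd' l) ∈ U' := by
      intro l
      induction l with
      | nil => change c v ∈ U'; rw [hc0]; exact h0
      | cons i l ih => 
        change c (δ (P.ff i) (wd' l)) ∈ U'
        rw [key _ _ (mem l)]; exact hU' _ _ ih
    rw [eq_top_iff]
    rintro z -
    rw [← hcE z]
    simp only [E, Fintype.linearCombination_apply, map_sum, map_smul]
    exact ssu _ fun k _ => ssm _ _ (hall _)
  · intro U' hU' h0
    have h1 : U ⊓ U'.comap c ≤ N := hNmax _ (hst U' hU') fun u hu => by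
      obtain ⟨a, ha⟩ := hUW u hu.1
      have h2 := hWk _ ha
      have h3 := h0 _ hu.2
      rw [map_sub, map_smul, hc0] at h2
      simp [h3] at h2
      subst h2; simpa using ha
    rw [eq_bot_iff]
    intro z hz
    have := hcN _ (h1 ⟨hEU z, by rw [SetLike.mem_coe, Submodule.mem_comap, hcE]; exact hz⟩)
    rwa [hcE] at this
end hw

section dual
open Finset
variable {F : Type*} [Field F] {Q : Type*} [CommRing Q] [Algebra F Q]

/-- a derivation as a homomorphism to dual numbers -/
noncomputable def dnh (D : Derivation F Q Q) : Q →+* DualNumber Q where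
  toFun r := TrivSqZeroExt.inl r + TrivSqZeroExt.inr (D r)
  map_one' := by ext <;> simp
  map_zero' := by ext <;> simp
  map_add' x y := by ext <;> simp
  map_mul' x y := by ext <;> simp [mul_comm]

theorem dnh_fst (D : Derivation F Q Q) (r) : (dnh D r).fst = r := by simp [dnh]
theorem dnh_snd (D : Derivation F Q Q) (r) : (dnh D r).snd = D r := by simp [dnh]

theorem D_det {m : Type*} [Fintype m] [DecidableEq m] (D : Derivation F Q Q) (M N : Matrix m m Q) (h : M.map D = N * M) :
    D M.det = N.trace * M.det := by
  let ι : Q →+* DualNumber Q := TrivSqZeroExt.inlHom Q Q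
  have h1 : M.map (dnh D) = (1 + (DualNumber.eps : DualNumber Q) • N.map ι) * M.map ι := by
    have h2 : M.map (dnh D) = M.map ι + (DualNumber.eps : DualNumber Q) • (M.map D).map ι := by
      ext i j <;> simp [dnh, ι]
    rw [h2, h, Matrix.map_mul, add_mul, one_mul, Matrix.smul_mul]
  have h3 := congrArg TrivSqZeroExt.snd (RingHom.map_det (dnh D) M)
  rw [dnh_snd, RingHom.mapMatrix_apply, h1, Matrix.det_mul, Matrix.det_one_add_smul, pow_two, DualNumber.eps_mul_eps,
    mul_zero, add_zero] at h3
  have h5 : (M.map ι).det = ι M.det := (RingHom.map_det ι M).symm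
  rw [h3, h5]
  have h4 : (N.map ι).trace = ι N.trace := by simp [Matrix.trace]
  rw [h4]
  simp [ι, mul_comm]

theorem D_charpoly {m : Type*} [Fintype m] [DecidableEq m] (D : Derivation F Q Q) (M N : Matrix m m Q) (h : M.map D = N * M - M * N) (k) :
    D (M.charpoly.coeff k) = 0 := by
  let ι : Q →+* DualNumber Q := TrivSqZeroExt.inlHom Q Q
  have ee : (DualNumber.eps : DualNumber Q) * DualNumber.eps = 0 := DualNumber.eps_mul_eps
  let u : (Matrix m m (DualNumber Q))ˣ := ⟨1 + (DualNumber.eps : DualNumber Q) • N.map ι, 1 - (DualNumber.eps : DualNumber Q) • N.map ι, by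
    rw [mul_sub, add_mul, one_mul, mul_one, add_mul, one_mul, Matrix.smul_mul, Matrix.mul_smul, smul_smul, ee]; simp, by
    rw [mul_add, sub_mul, one_mul, mul_one, sub_mul, one_mul, Matrix.smul_mul, Matrix.mul_smul, smul_smul, ee]; simp⟩
  have h1 : M.map (dnh D) = u.1 * M.map ι * u⁻¹.1 := by
    have h2 : M.map (dnh D) = M.map ι + (DualNumber.eps : DualNumber Q) • (M.map D).map ι := by
      ext i j <;> simp [dnh, ι]
    change _ = (1 + (DualNumber.eps : DualNumber Q) • N.map ι) * M.map ι * (1 - (DualNumber.eps : DualNumber Q) • N.map ι)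
    rw [h2, h, Matrix.map_sub _ (fun a b => map_sub ι a b), Matrix.map_mul, Matrix.map_mul, mul_sub, add_mul, one_mul, mul_one, add_mul]
    simp only [Matrix.smul_mul, Matrix.mul_smul, smul_smul, ee, zero_smul, smul_sub]
    abel
  have h3 : (M.map (dnh D)).charpoly = (M.map ι).charpoly := by
    have h5 := Matrix.charpoly_units_conj u (M.map ι)
    rw [← Matrix.coe_units_inv] at h5
    rw [h1, h5]
  have h4 := congrArg (fun p => (Polynomial.coeff p k).snd) h3
  simp only [Matrix.charpoly_map, Polynomial.coeff_map, dnh_snd] at h4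
  rw [h4]; simp [ι]

end dual

section inv
open Finset MvPolynomial
variable {F : Type*} [Field F] {g : Type*} [LieRing g] [LieAlgebra F g] {n : ℕ} (B : Module.Basis (Fin n) F g)

/-- generic matrix in representation ρ -/
noncomputable def gm {d : ℕ} (ρ : g →ₗ[F] Matrix (Fin d) (Fin d) F) : Matrix (Fin d) (Fin d) (MvPolynomial (Fin n) F) :=
  fun k l => ∑ b, ρ (B b) k l • X b

theorem Iv_charpoly {d : ℕ} (ρ : g →ₗ[F] Matrix (Fin d) (Fin d) F) (hρ : ∀ x y : g, ρ ⁅x, y⁆ = ρ x * ρ y - ρ y * ρ x) (k) :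
    Iv B ((gm B ρ).charpoly.coeff k) := by
  intro y
  refine D_charpoly (Dv B y) (gm B ρ) ((ρ y).map C) ?_ k
  ext1 i j
  have h1 : ∀ b, ∑ c, B.repr ⁅y, B b⁆ c • ρ (B c) = ρ ⁅y, B b⁆ := fun b => by
    conv_rhs => rw [← B.sum_repr ⁅y, B b⁆, map_sum]
    simp only [map_smul]
  have h2 : (Dv B y) (gm B ρ i j) = ∑ b, (ρ ⁅y, B b⁆) i j • (X b : MvPolynomial (Fin n) F) := by
    simp only [gm, map_sum, Derivation.map_smul, Dv, mkDerivation_X, smul_sum]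
    rw [sum_comm]
    refine sum_congr rfl fun b _ => ?_
    rw [← h1, xsu, sum_smul]
    exact sum_congr rfl fun c _ => by rw [smul_smul, mul_comm]; rfl
  rw [Matrix.map_apply, h2]
  simp only [hρ, Matrix.sub_apply, Matrix.mul_apply, sub_smul, sum_sub_distrib, Matrix.map_apply, gm, mul_sum, sum_mul, sum_smul]
  congr 1 <;>
  · rw [sum_comm]
    refine sum_congr rfl fun b _ => sum_congr rfl fun c _ => ?_
    simp only [smul_eq_C_mul, C_mul]; ring

end inv

section plu
open Finset MvPolynomial
variable {F : Type*} [Field F] [CharZero F] [IsAlgClosed F] {g : Type*} [LieRing g] [LieAlgebra F g] {e h f : g}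
  (P : PD F e h f)

set_option maxHeartbeats 1000000 in
theorem PD.plu (T : Finset (Fin P.n)) (hT : ∀ i, ∀ b ∈ T, ∀ c, P.B.repr ⁅P.ee i, P.B b⁆ c ≠ 0 → c ∈ T) :
    Nonempty (HW P fun i => ∑ b ∈ T, P.wt b i) := by
  classical
  let Q := MvPolynomial (Fin P.n × T) F
  let L : T → g →ₗ[F] Q := fun k => P.B.constr F fun a => X (a, k)
  have hL : ∀ k a, L k (P.B a) = X (a, k) := fun k a => P.B.constr_basis F _ a
  let D : g →ₗ[F] Derivation F Q Q := 
    { toFun := fun y => mkDerivation F fun p => L p.2 ⁅y, P.B p.1⁆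
      map_add' := fun x y => by ext p; simp [mkDerivation_X]
      map_smul' := fun c y => by ext p; simp [mkDerivation_X] }
  have hD : ∀ y k x, D y (L k x) = L k ⁅y, x⁆ := fun y k x => by
    have : (D y).toLinearMap ∘ₗ L k = L k ∘ₗ (ad F g y : End F g) := P.B.ext fun a => by
      rw [lco, hL]
      change mkDerivation F _ (X (a, k)) = _
      rw [mkDerivation_X]; rfl
    exact LinearMap.congr_fun this x
  have hlie : ∀ x y : g, D ⁅x, y⁆ = ⁅D x, D y⁆ := fun x y => by
    ext1 p
    rw [Derivation.commutator_apply, ← hL, hD, hD, hD, hD, hD, lie_lie, map_sub]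
  let S : Submodule F Q := Submodule.span F (Set.range X)
  have hLS : ∀ k x, L k x ∈ S := fun k x => by
    rw [← P.B.sum_repr x, map_sum]
    exact ssu _ fun a _ => by rw [map_smul, hL]; exact ssm _ _ (sss ⟨_, rfl⟩)
  have hDS : ∀ y, ∀ q ∈ S, D y q ∈ S := fun y q hq => by
    refine (sle (p := S.comap (D y).toLinearMap)).2 ?_ hq
    rintro _ ⟨p, rfl⟩
    change D y (X p) ∈ S
    rw [← hL, hD]; exact hLS _ _
  have hDSn : ∀ (m : ℕ) y, ∀ q ∈ S ^ m, D y q ∈ S ^ m := by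
    intro m y
    induction m with
    | zero => 
      intro q hq
      rw [pow_zero, Submodule.mem_one] at hq
      obtain ⟨c, rfl⟩ := hq
      rw [Derivation.map_algebraMap]; exact zero_mem _
    | succ m ih =>
      intro q hq
      rw [pow_succ] at hq ⊢
      refine Submodule.mul_induction_on hq (fun a ha b hb => ?_) (fun a b ha hb => by rw [map_add]; exact add_mem ha hb)
      rw [Derivation.leibniz, smul_eq_mul, smul_eq_mul]
      refine add_mem (Submodule.mul_mem_mul ha (hDS y b hb)) ?_
      rw [mul_comm b]; exact Submodule.mul_mem_mul (ih a ha) hb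
  have hSfg : S.FG := Submodule.fg_span (Set.finite_range _)
  let m := Fintype.card T
  haveI : FiniteDimensional F ↥(S ^ m) := Module.Finite.iff_fg.2 (hSfg.pow m) 
  let M : Matrix T T Q := fun a k => X (a.1, k)
  have hM0 : M.det ≠ 0 := fun h0 => by
    have h1 := AlgHom.map_det (aeval (fun p : Fin P.n × T => if p.1 = p.2 then (1 : F) else 0) : Q →ₐ[F] F) M
    rw [h0, map_zero] at h1
    have h2 : (AlgHom.mapMatrix (aeval (fun p : Fin P.n × T => if p.1 = p.2 then (1 : F) else 0) : Q →ₐ[F] F)) M = 1 := by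
      ext a k
      rw [AlgHom.mapMatrix_apply, Matrix.map_apply]
      simp only [M, aeval_X, Matrix.one_apply, Subtype.ext_iff]
    rw [h2, Matrix.det_one] at h1
    exact one_ne_zero h1.symm
  have hprod : ∀ (s : Finset T) (q : T → Q), (∀ k, q k ∈ S) → ∏ k ∈ s, q k ∈ S ^ s.card := fun s q hq => by
    induction s using Finset.induction_on with
    | empty => simp
    | insert a s ha ih => 
      rw [prod_insert ha, card_insert_of_notMem ha, pow_succ']
      exact Submodule.mul_mem_mul (hq a) ih
  have hMS : M.det ∈ S ^ m := by
    rw [Matrix.det_apply]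
    refine ssu _ fun σ _ => ?_
    have : ∏ i, M (σ i) i ∈ S ^ m := hprod univ _ fun k => sss ⟨_, rfl⟩
    rcases Int.units_eq_one_or (Equiv.Perm.sign σ) with h | h <;> rw [h]
    · simpa using this
    · simpa using neg_mem this
  let δ : g →ₗ[F] End F ↥(S ^ m) :=
    { toFun := fun y => (D y).toLinearMap.restrict (hDSn m y)
      map_add' := fun x y => by ext q; simp
      map_smul' := fun c y => by ext q; simp }
  have hδ : ∀ y q, (δ y q : Q) = D y q := fun y q => rfl
  have hdet : ∀ y, (∀ b ∈ T, ∀ c, P.B.repr ⁅y, P.B b⁆ c ≠ 0 → c ∈ T) → D y M.det = MvPolynomial.C (∑ b ∈ T, P.B.repr ⁅y, P.B b⁆ b) * M.det := fun y hy => by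
    have := D_det (D y) M (Matrix.of fun a c : T => MvPolynomial.C (P.B.repr ⁅y, P.B a⁆ c)) (by
      ext1 a k
      rw [Matrix.map_apply, Matrix.mul_apply]
      change D y (X (a.1, k)) = ∑ c : T, MvPolynomial.C (P.B.repr ⁅y, P.B a⁆ c) * X (c.1, k)
      rw [← hL, hD]
      conv_lhs => rw [← P.B.sum_repr ⁅y, P.B a⁆, map_sum]
      simp only [map_smul, hL]
      rw [← Finset.sum_subset (subset_univ T), ← sum_coe_sort]
      · exact sum_congr rfl fun c _ => smul_eq_C_mul _ _
      intro c _ hc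
      by_cases h0 : P.B.repr ⁅y, P.B a⁆ c = 0
      · rw [h0]; simp
      · exact absurd (hy a a.2 c h0) hc)
    rw [this]; congr 1
    rw [map_sum, ← sum_coe_sort]; rfl
  refine HW.of P δ (fun x y q => Subtype.ext ?_) _ ⟨M.det, hMS⟩ (fun i => Subtype.ext ?_) (fun i => Subtype.ext ?_) (fun h0 => hM0 (congrArg Subtype.val h0))
  · simp only [AddSubgroupClass.coe_sub, hδ, hlie, Derivation.commutator_apply]
  · rw [hδ]
    change D _ M.det = 0
    rw [hdet _ (hT i), sum_eq_zero, map_zero, zero_mul]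
    intro b _
    by_contra h0
    have h1 := P.repr_wt (wt_lie (by simpa using P.we i i : ⁅P.w i, P.ee i⁆ = (1 : F) • P.ee i) (P.wB i b)) h0
    simp at h1
  · rw [hδ]
    change D _ M.det = _ • M.det
    rw [hdet _ (fun b hb c hc => ?_), smul_eq_C_mul]
    · congr 2; push_cast
      exact sum_congr rfl fun b _ => by rw [P.wB]; simp
    · rw [P.wB] at hc
      by_cases hbc : b = c
      · rwa [← hbc]
      · simp [hbc] at hc
end plu

section fund
open Finset
variable {F : Type*} [Field F] [CharZero F] [IsAlgClosed F] {g : Type*} [LieRing g] [LieAlgebra F g] {e h f : g}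
  (P : PD F e h f)

theorem PD.wee (i j) : ⁅P.w i, P.ee j⁆ = (if i = j then (1 : F) else 0) • P.ee j := by rw [P.we]; split_ifs <;> simp
theorem PD.wff (i j) : ⁅P.w i, P.ff j⁆ = (if i = j then (-1 : F) else 0) • P.ff j := by rw [P.wf]; split_ifs <;> simp

theorem PD.wt_ee {j b c} (hc : P.B.repr ⁅P.ee j, P.B b⁆ c ≠ 0) (i) : P.wt c i = (if i = j then 1 else 0) + P.wt b i := by
  have := P.repr_wt (wt_lie (P.wee i j) (P.wB i b)) hc
  split_ifs at this ⊢ <;> exact_mod_cast this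
theorem PD.wt_ff {j b c} (hc : P.B.repr ⁅P.ff j, P.B b⁆ c ≠ 0) (i) : P.wt c i = (if i = j then -1 else 0) + P.wt b i := by
  have := P.repr_wt (wt_lie (P.wff i j) (P.wB i b)) hc
  split_ifs at this ⊢ <;> exact_mod_cast this

theorem PD.tr0 (j) (T : Finset (Fin P.n)) (h1 : ∀ b ∈ T, ∀ c, P.B.repr ⁅P.ee j, P.B b⁆ c ≠ 0 → c ∈ T)
    (h2 : ∀ b ∈ T, ∀ c, P.B.repr ⁅P.ff j, P.B b⁆ c ≠ 0 → c ∈ T) : ∑ k, P.C j k * ∑ b ∈ T, P.wt b k = 0 := by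
  have h3 : ∀ b, P.B.repr ⁅⁅P.ee j, P.ff j⁆, P.B b⁆ b = ((∑ k, P.C j k * P.wt b k : ℤ) : F) := fun b => by
    rw [P.ef, if_pos rfl, sum_lie, map_sum]
    simp [P.wB]
  have h4 : ∀ x y : g, (∀ b ∈ T, ∀ c, P.B.repr ⁅y, P.B b⁆ c ≠ 0 → c ∈ T) → ∀ b ∈ T, P.B.repr ⁅x, ⁅y, P.B b⁆⁆ b = ∑ c ∈ T, P.B.repr ⁅y, P.B b⁆ c * P.B.repr ⁅x, P.B c⁆ b := fun x y hy b hb => by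
    conv_lhs => rw [← P.B.sum_repr ⁅y, P.B b⁆, lie_sum, map_sum]
    rw [Finsupp.finsetSum_apply, ← sum_subset (subset_univ T)]
    · simp
    · intro c _ hc
      by_cases h0 : P.B.repr ⁅y, P.B b⁆ c = 0
      · rw [h0]; simp
      · exact absurd (hy b hb c h0) hc
  have h5 : ∑ b ∈ T, P.B.repr ⁅⁅P.ee j, P.ff j⁆, P.B b⁆ b = 0 := by
    simp only [lie_lie, map_sub, Finsupp.sub_apply, sum_sub_distrib]
    rw [sum_congr rfl (h4 _ _ h2), sum_congr rfl (h4 _ _ h1), sum_comm (s := T) (t := T), sub_eq_zero]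
    exact sum_congr rfl fun b _ => sum_congr rfl fun c _ => mul_comm _ _
  simp only [h3] at h5
  have h6 : ∑ b ∈ T, ∑ k, P.C j k * P.wt b k = 0 := by exact_mod_cast h5
  rw [sum_comm] at h6
  simpa [mul_sum] using h6

theorem HW.dom {lam} (V : HW P lam) (j) : ∃ m : ℕ, ∑ k, P.C j k * lam k = m := by
  have tl : ∀ x y : g, Matrix.toLin' (V.ρ ⁅x, y⁆) = Matrix.toLin' (V.ρ x) * Matrix.toLin' (V.ρ y) - Matrix.toLin' (V.ρ y) * Matrix.toLin' (V.ρ x) := fun x y => by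
    rw [V.lie, map_sub, Matrix.toLin'_mul, Matrix.toLin'_mul]; rfl
  have hh : ⁅P.ee j, P.ff j⁆ = ∑ k, (P.C j k : F) • P.w k := by rw [P.ef, if_pos rfl]
  have h1 : ⁅⁅P.ee j, P.ff j⁆, P.ee j⁆ = (2 : F) • P.ee j := by
    rw [hh, sum_lie]; simp [P.we, P.Cii]
  have h2 : ⁅⁅P.ee j, P.ff j⁆, P.ff j⁆ = (-2 : F) • P.ff j := by
    rw [hh, sum_lie]; simp [P.wf, P.Cii]
  have hv : Matrix.toLin' (V.ρ ⁅P.ee j, P.ff j⁆) (Pi.single V.k0 1) = ((∑ k, P.C j k * lam k : ℤ) : F) • Pi.single V.k0 1 := by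
    rw [hh]
    simp only [map_sum, map_smul, lsu, lsm, Matrix.toLin'_apply, V.diag, Matrix.diagonal_mulVec_single, V.top]
    push_cast
    rw [sum_smul]
    refine sum_congr rfl fun k _ => ?_
    rw [mul_smul, mul_one, ← Pi.single_smul', ← Pi.single_smul', ← Pi.single_smul']; simp
  obtain ⟨⟨m, hm⟩, -⟩ := sl2_prim (e := Matrix.toLin' (V.ρ (P.ee j))) (f := Matrix.toLin' (V.ρ (P.ff j))) (h := Matrix.toLin' (V.ρ ⁅P.ee j, P.ff j⁆))
    (by rw [← tl, h1, map_smul, map_smul]) (by rw [← tl, h2, map_smul, map_smul]) (by rw [← tl])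
    (w := Pi.single V.k0 1) (i := ((∑ k, P.C j k * lam k : ℤ) : F)) (by rw [Matrix.toLin'_apply, V.hi]) (by simp)
    ((Module.End.genEigenspace _ _).mono le_top (Module.End.mem_genEigenspace_one.2 hv))
  exact ⟨m, by exact_mod_cast hm⟩

theorem PD.ee_b (j) : ∃ b, (∀ k, P.wt b k = if k = j then 1 else 0) ∧ ∀ b', (∀ k, k ≠ j → P.wt b' k = 0) → 0 < P.wt b' j → b' = b := by
  obtain ⟨b, hb⟩ : ∃ b, P.B.repr (P.ee j) b ≠ 0 := by
    by_contra! h0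
    exact P.ee0 j (P.B.repr.map_eq_zero_iff.1 (Finsupp.ext h0))
  have h1 : ∀ k, P.wt b k = if k = j then 1 else 0 := fun k => by
    have := P.repr_wt (P.wee k j) hb
    split_ifs at this ⊢ <;> exact_mod_cast this
  refine ⟨b, h1, fun b' h2 h3 => ?_⟩
  obtain ⟨-, h4⟩ := P.simple b' j h2 h3
  obtain ⟨c, hc⟩ := Submodule.mem_span_singleton.1 h4
  by_contra hne
  have h5 := congrArg (fun y => P.B.repr y b) hc
  simp [hne] at h5
  rcases h5 with h5 | h5
  · subst h5; rw [zero_smul] at hc; exact P.B.ne_zero b' hc.symm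
  · exact hb h5

theorem PD.fund (i) : ∃ lam, Nonempty (HW P lam) ∧ (∀ j, j ≠ i → ∑ k, P.C j k * lam k = 0) ∧ 0 < ∑ k, P.C i k * lam k := by
  let T : Finset (Fin P.n) := univ.filter fun b => 1 ≤ P.wt b i
  have hT : ∀ j, ∀ b ∈ T, ∀ c, P.B.repr ⁅P.ee j, P.B b⁆ c ≠ 0 → c ∈ T := fun j b hb c hc => by
    simp only [T, mem_filter, mem_univ, true_and] at hb ⊢
    have := P.wt_ee hc i
    split_ifs at this <;> omega
  obtain ⟨V⟩ := P.plu T hT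
  have hj : ∀ j, j ≠ i → ∑ k, P.C j k * ∑ b ∈ T, P.wt b k = 0 := fun j hj => P.tr0 j T (hT j) fun b hb c hc => by
    simp only [T, mem_filter, mem_univ, true_and] at hb ⊢
    have := P.wt_ff hc i
    rw [if_neg hj.symm] at this; omega
  refine ⟨_, ⟨V⟩, hj, ?_⟩
  obtain ⟨m, hm⟩ := HW.dom P V i
  rw [hm]
  rcases Nat.eq_zero_or_pos m with rfl | h0
  · exfalso
    have h1 : (Matrix.of P.C).mulVec (fun k => ∑ b ∈ T, P.wt b k) = 0 := by
      funext j
      by_cases h : j = i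
      · subst h; exact hm
      · exact hj j h
    have h2 := congrFun (Matrix.eq_zero_of_mulVec_eq_zero P.Cdet h1) i
    obtain ⟨b, hb, -⟩ := P.ee_b i
    have h3 : 0 < ∑ b ∈ T, P.wt b i := sum_pos (fun b hb => by simp only [T, mem_filter, mem_univ, true_and] at hb; omega)
      ⟨b, by simp [T, hb]⟩
    simp only [Pi.zero_apply] at h2
    omega
  · exact_mod_cast h0

theorem PD.fundP : ∃ lam, Nonempty (HW P lam) ∧ (∀ j, ∑ k, P.C j k * lam k = 2) ∧ (∀ i, lam i = ∑ b ∈ univ.filter (fun b => 1 ≤ P.ht b), P.wt b i) := by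
  classical
  have pos : ∀ b, 1 ≤ P.ht b → ∀ k, 0 ≤ P.wt b k := fun b hb => by
    rcases P.sgn b with h | h
    · exact h
    · have : P.ht b ≤ 0 := sum_nonpos fun i _ => h i
      omega
  let T : Finset (Fin P.n) := univ.filter fun b => 1 ≤ P.ht b
  have hT : ∀ j, ∀ b ∈ T, ∀ c, P.B.repr ⁅P.ee j, P.B b⁆ c ≠ 0 → c ∈ T := fun j b hb c hc => by
    simp only [T, mem_filter, mem_univ, true_and] at hb ⊢
    have h1 := P.wt_ee hc
    have : P.ht c = 1 + P.ht b := by simp [PD.ht, h1, sum_add_distrib]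
    omega
  obtain ⟨V⟩ := P.plu T hT
  refine ⟨_, ⟨V⟩, fun j => ?_, fun i => rfl⟩
  obtain ⟨b0, hb0, hu⟩ := P.ee_b j
  let T' : Finset (Fin P.n) := univ.filter fun b => ∃ k, k ≠ j ∧ 1 ≤ P.wt b k
  have h0 : ∑ k, P.C j k * ∑ b ∈ T', P.wt b k = 0 := P.tr0 j T' (fun b hb c hc => by
      simp only [T', mem_filter, mem_univ, true_and] at hb ⊢
      obtain ⟨k, hk, h1⟩ := hb
      have := P.wt_ee hc k
      rw [if_neg hk] at this; exact ⟨k, hk, by omega⟩) (fun b hb c hc => by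
      simp only [T', mem_filter, mem_univ, true_and] at hb ⊢
      obtain ⟨k, hk, h1⟩ := hb
      have := P.wt_ff hc k
      rw [if_neg hk] at this; exact ⟨k, hk, by omega⟩)
  have hbT : b0 ∉ T' := by
    simp only [T', mem_filter, mem_univ, true_and]
    rintro ⟨k, hk, h1⟩
    rw [hb0, if_neg hk] at h1; omega
  have hTT : T = insert b0 T' := by
    ext b
    simp only [T, T', mem_filter, mem_univ, true_and, mem_insert]
    constructor
    · intro hb
      by_cases hk : ∃ k, k ≠ j ∧ 1 ≤ P.wt b k
      · exact Or.inr hk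
      · push Not at hk
        have h1 : ∀ k, k ≠ j → P.wt b k = 0 := fun k hkj => by have := pos b hb k; have := hk k hkj; omega
        refine Or.inl (hu b h1 ?_)
        have : P.ht b = P.wt b j := sum_eq_single j (fun k _ hk => h1 k hk) (by simp)
        omega
    · rintro (rfl | ⟨k, hk, h1⟩)
      · simp [PD.ht, hb0]
      · have hp : ∀ k, 0 ≤ P.wt b k := by
          rcases P.sgn b with h | h
          · exact h
          · have := h k; omega
        exact h1.trans (single_le_sum (f := P.wt b) (fun i _ => hp i) (mem_univ k))
  change ∑ k, P.C j k * ∑ b ∈ T, P.wt b k = 2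
  simp only [hTT, sum_insert hbT, mul_add, sum_add_distrib, h0, hb0]
  simp [P.Cii]
end fund

theorem exists_ord (K : Type*) [Field K] [CharZero K] : ∃ _ : LinearOrder K, IsOrderedAddMonoid K := by
  classical
  let b := Module.Free.chooseBasis ℚ K
  letI : LinearOrder (Module.Free.ChooseBasisIndex ℚ K) := IsWellOrder.linearOrder WellOrderingRel
  let ψ : K → Lex (Module.Free.ChooseBasisIndex ℚ K →₀ ℚ) := fun x => toLex (b.repr x)
  have hψ : Function.Injective ψ := fun x y h => b.repr.injective (toLex.injective h)
  letI : LinearOrder K := LinearOrder.lift' ψ hψ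
  refine ⟨inferInstance, ⟨fun a b hab c => ?_, fun a b hab c => ?_⟩⟩
  · change ψ (a + c) ≤ ψ (b + c)
    have h1 : ∀ a c, ψ (a + c) = ψ a + ψ c := fun a c => by simp [ψ]
    rw [h1, h1]; exact add_le_add_left (show ψ a ≤ ψ b from hab) _
  · change ψ (c + a) ≤ ψ (c + b)
    have h1 : ∀ a c, ψ (a + c) = ψ a + ψ c := fun a c => by simp [ψ]
    rw [h1, h1]; exact add_le_add_right (show ψ a ≤ ψ b from hab) _

theorem int_mono {K : Type*} [Field K] [LinearOrder K] [IsOrderedAddMonoid K] {x : K} (hx : 0 ≤ x) {m n : ℤ} (h : m ≤ n) : (m : K) * x ≤ n * x := by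
  rw [← zsmul_eq_mul, ← zsmul_eq_mul]; exact zsmul_le_zsmul_left hx h

section sep
open Finset
variable {F : Type*} [Field F] [CharZero F] [IsAlgClosed F] {g : Type*} [LieRing g] [LieAlgebra F g] {e h f : g}
  (P : PD F e h f) {K : Type*} [Field K] [Algebra F K]

theorem co_gm {d : ℕ} (ρ : g →ₗ[F] Matrix (Fin d) (Fin d) F) (X : K ⊗[F] g) (k l) :
    ev P.B X (gm P.B ρ k l) = ∑ b, ρ (P.B b) k l • co P.B b X := by
  simp [gm, ev]

theorem HW.gm_eta {lam} (V : HW P lam) (z : Fin P.r → K) :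
    (gm P.B V.ρ).map (ev P.B (P.eta z)) = (V.ρ e).map (algebraMap F K) + Matrix.diagonal fun k => ∑ i, (V.wv k i : K) * z i := by
  have h1 : ∀ x : g, ∀ k l, ∑ b, V.ρ (P.B b) k l * P.B.repr x b = V.ρ x k l := fun x k l => by
    conv_rhs => rw [← P.B.sum_repr x, map_sum]
    rw [xsu]
    exact sum_congr rfl fun b _ => by rw [map_smul, xsm, smul_eq_mul, mul_comm]
  ext1 k l
  rw [Matrix.map_apply, co_gm, PD.eta]
  simp only [map_add, map_sum, co_tmul, smul_add, sum_add_distrib, smul_sum, smul_smul]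
  rw [sum_comm]
  simp only [← sum_smul, h1, V.diag]
  rw [Matrix.add_apply, Matrix.map_apply, aes]
  congr 1
  by_cases hkl : k = l
  · subst hkl; simp [Algebra.smul_def]
  · simp [hkl]

theorem HW.e_ht {lam} (V : HW P lam) {k l} (hkl : V.ρ e k l ≠ 0) : ∑ i, V.wv k i = ∑ i, V.wv l i + 1 := by
  have h1 : V.ρ ⁅h, e⁆ k l = (2 : F) * V.ρ e k l := by rw [P.pt.he, map_smul]; rfl
  have h2 : V.ρ h = Matrix.diagonal fun k => ((2 * ∑ i, V.wv k i : ℤ) : F) := by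
    have : V.ρ h = V.ρ ((2 : F) • ∑ i, P.w i) := congrArg V.ρ P.h_eq
    rw [this, map_smul, map_sum]
    simp only [V.diag]
    ext a b
    by_cases hab : a = b
    · subst hab; simp [xsu]
    · simp [xsu, hab]
  rw [V.lie, h2, Matrix.sub_apply, Matrix.diagonal_mul, Matrix.mul_diagonal] at h1
  have h3 : ((2 * ∑ i, V.wv k i : ℤ) : F) - ((2 * ∑ i, V.wv l i : ℤ) : F) - 2 = 0 := by
    refine (mul_eq_zero.1 (?_ : _ * V.ρ e k l = 0)).resolve_right hkl
    linear_combination h1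
  have h4 : (2 * ∑ i, V.wv k i) - (2 * ∑ i, V.wv l i) - 2 = 0 := by exact_mod_cast h3
  omega

/-- matrix of η(z) -/
noncomputable def HW.M {lam} (V : HW P lam) (z : Fin P.r → K) : Matrix (Fin V.d) (Fin V.d) K :=
  (V.ρ e).map (algebraMap F K) + Matrix.diagonal fun k => ∑ i, (V.wv k i : K) * z i

theorem HW.root1 {lam} (V : HW P lam) (z : Fin P.r → K) : (V.M P z).charpoly.IsRoot (∑ i, (lam i : K) * z i) := by
  rw [Polynomial.IsRoot, Matrix.eval_charpoly, ← Matrix.exists_mulVec_eq_zero_iff]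
  refine ⟨Pi.single V.k0 1, by simp, ?_⟩
  have h1 : (V.ρ e).mulVec (Pi.single V.k0 1) = 0 := by
    have : V.ρ e = V.ρ (∑ i, P.ee i) := congrArg V.ρ P.e_eq
    rw [this, map_sum, Matrix.sum_mulVec]; exact sum_eq_zero fun i _ => V.hi i
  have h2 : ((V.ρ e).map (algebraMap F K)).mulVec (Pi.single V.k0 1) = 0 := by
    funext k
    have := congrArg (algebraMap F K) (congrFun h1 k)
    simpa using this
  rw [Matrix.sub_mulVec, HW.M, Matrix.add_mulVec, h2, Matrix.diagonal_mulVec_single, V.top, sub_eq_zero, zero_add]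
  rw [Matrix.scalar_apply, Matrix.diagonal_mulVec_single]

theorem HW.root2 {lam} (V : HW P lam) (z : Fin P.r → K) {μ : K} (hμ : (V.M P z).charpoly.IsRoot μ) : ∃ k, μ = ∑ i, (V.wv k i : K) * z i := by
  classical
  rw [Polynomial.IsRoot, Matrix.eval_charpoly, ← Matrix.exists_mulVec_eq_zero_iff] at hμ
  obtain ⟨u, hu, h0⟩ := hμ
  obtain ⟨k, hk, hmin⟩ := exists_min_image (univ.filter fun k => u k ≠ 0) (fun k => ∑ i, V.wv k i) (by
    obtain ⟨k, hk⟩ := Function.ne_iff.1 hu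
    exact ⟨k, by simpa using hk⟩)
  simp only [mem_filter, mem_univ, true_and] at hk hmin
  refine ⟨k, ?_⟩
  have h1 := congrFun h0 k
  have h2 : ((V.ρ e).map (algebraMap F K)).mulVec u k = 0 := by
    rw [Matrix.mulVec, dotProduct]
    refine sum_eq_zero fun l _ => ?_
    by_cases hl : V.ρ e k l = 0
    · simp [hl]
    · by_cases hul : u l = 0
      · simp [hul]
      · have := hmin l hul
        have := V.e_ht P hl
        omega
  rw [Matrix.sub_mulVec, HW.M, Matrix.add_mulVec, Pi.sub_apply, Pi.add_apply, h2, Matrix.mulVec_diagonal, Pi.zero_apply] at h1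
  have h3 : ((Matrix.scalar (Fin V.d)) μ).mulVec u k = μ * u k := by simp
  rw [h3, zero_add, ← sub_mul] at h1
  exact sub_eq_zero.1 ((mul_eq_zero.1 h1).resolve_right hk)

theorem HW.charpoly_eq {lam} (V : HW P lam) {z z' : Fin P.r → K} (hI : ∀ q, Iv P.B q → ev P.B (P.eta z) q = ev P.B (P.eta z') q) :
    (V.M P z).charpoly = (V.M P z').charpoly := by
  rw [HW.M, HW.M, ← V.gm_eta P, ← V.gm_eta P]
  have h1 : ∀ z : Fin P.r → K, ((gm P.B V.ρ).map (ev P.B (P.eta z))).charpoly = (gm P.B V.ρ).charpoly.map (ev P.B (P.eta z)).toRingHom := fun z =>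
    (Matrix.charpoly_map (gm P.B V.ρ) (ev P.B (P.eta z)).toRingHom)
  rw [h1, h1]
  ext k
  rw [Polynomial.coeff_map, Polynomial.coeff_map]
  exact hI _ (Iv_charpoly P.B V.ρ V.lie k)

theorem PD.sep [CharZero K] {z z' : Fin P.r → K} (hI : ∀ q, Iv P.B q → ev P.B (P.eta z) q = ev P.B (P.eta z') q)
    (y : MvPolynomial (Fin P.r) F) (hy : ∀ j, MvPolynomial.aeval (fun k => MvPolynomial.X k - (P.C j k : F) • MvPolynomial.X j) y = y) :
    MvPolynomial.aeval z y = MvPolynomial.aeval z' y := by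
  obtain ⟨_, _⟩ := exists_ord K
  obtain ⟨lp, ⟨V⟩, hlp, -⟩ := P.fundP
  have key : ∀ z : Fin P.r → K, ∃ z1 : Fin P.r → K, (∀ q, Iv P.B q → ev P.B (P.eta z1) q = ev P.B (P.eta z) q) ∧
      MvPolynomial.aeval z1 y = MvPolynomial.aeval z y ∧ ∀ i, 0 ≤ z1 i := by
    intro z
    let O : Set (Fin P.r → K) := {z1 | (∀ q, Iv P.B q → ev P.B (P.eta z1) q = ev P.B (P.eta z) q) ∧ MvPolynomial.aeval z1 y = MvPolynomial.aeval z y}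
    let L : (Fin P.r → K) → K := fun z => ∑ i, (lp i : K) * z i
    have hne : (L '' O).Nonempty := ⟨L z, z, ⟨fun _ _ => rfl, rfl⟩, rfl⟩
    have hfin : (L '' O).Finite := by
      refine (V.M P z).charpoly.roots.toFinset.finite_toSet.subset ?_
      rintro _ ⟨z1, hz1, rfl⟩
      simp only [mem_coe, Multiset.mem_toFinset]
      rw [Polynomial.mem_roots (Matrix.charpoly_monic _).ne_zero, ← V.charpoly_eq P hz1.1]
      exact V.root1 P z1
    obtain ⟨_, ⟨z1, hz1, rfl⟩, hmax⟩ := Set.exists_max_image _ id hfin hne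
    refine ⟨z1, hz1.1, hz1.2, fun j => ?_⟩
    by_contra! hj
    let z2 : Fin P.r → K := fun k => z1 k - (P.C j k : F) • z1 j
    have hz2 : z2 ∈ O := by
      refine ⟨fun q hq => ?_, ?_⟩
      · rw [← hz1.1 q hq]; exact hq.cj P.B (PD.CjM.cj P (P.refl_cj z1 j))
      · rw [← hz1.2]
        conv_rhs => rw [← hy j]
        rw [← AlgHom.comp_apply, MvPolynomial.comp_aeval]
        congr 2; funext k; simp [z2]
    have h1 := hmax _ ⟨z2, hz2, rfl⟩
    have h2 : L z2 = L z1 - 2 * z1 j := by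
      have h3 : ((∑ k, P.C j k * lp k : ℤ) : K) = 2 := by rw [hlp]; norm_num
      rw [← h3]
      simp only [L, z2, mul_sub, sum_sub_distrib]
      push_cast
      rw [sum_mul]
      congr 1
      refine sum_congr rfl fun k _ => ?_
      rw [Algebra.smul_def]; simp; ring
    simp only [id, h2] at h1
    have h3 : (2 : K) * z1 j < 0 := by rw [two_mul]; exact add_neg hj hj
    rw [sub_le_iff_le_add] at h1
    have := add_lt_add_right h3 (L z1)
    rw [add_zero] at this
    exact absurd h1 (not_le.2 this)
  obtain ⟨z1, h1, h1y, h1p⟩ := key z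
  obtain ⟨z2, h2, h2y, h2p⟩ := key z'
  have hI12 : ∀ q, Iv P.B q → ev P.B (P.eta z1) q = ev P.B (P.eta z2) q := fun q hq => by rw [h1 q hq, h2 q hq, hI q hq]
  have hle : ∀ {z1 z2 : Fin P.r → K}, (∀ i, 0 ≤ z2 i) → (∀ q, Iv P.B q → ev P.B (P.eta z1) q = ev P.B (P.eta z2) q) →
      ∀ {lam} (V : HW P lam), ∑ i, (lam i : K) * z1 i ≤ ∑ i, (lam i : K) * z2 i := by
    intro z1 z2 h2p hI lam V
    have h3 := V.root1 P z1
    rw [V.charpoly_eq P hI] at h3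
    obtain ⟨k, hk⟩ := V.root2 P z2 h3
    rw [hk]
    exact sum_le_sum fun i _ => int_mono (h2p i) (V.le k i)
  choose lam hV hl0 hlp' using P.fund
  have heq : z1 = z2 := by
    let Λ : Matrix (Fin P.r) (Fin P.r) ℤ := fun i k => lam i k
    have hdet : Λ.det ≠ 0 := fun h0 => by
      have h3 : (Matrix.of P.C) * Λ.transpose = Matrix.diagonal fun i => ∑ k, P.C i k * lam i k := by
        ext a b
        rw [Matrix.mul_apply]
        by_cases hab : a = b
        · subst hab; rw [Matrix.diagonal_apply_eq]; rfl
        · rw [Matrix.diagonal_apply_ne _ hab]; exact hl0 b a hab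
      have h4 := congrArg Matrix.det h3
      rw [Matrix.det_mul, Matrix.det_transpose, h0, mul_zero, Matrix.det_diagonal] at h4
      exact (prod_pos fun i _ => hlp' i).ne h4
    have h5 : (Λ.map (Int.castRingHom K)).mulVec (z1 - z2) = 0 := by
      funext i
      obtain ⟨V⟩ := hV i
      have := le_antisymm (hle h2p hI12 V) (hle h1p (fun q hq => (hI12 q hq).symm) V)
      rw [Matrix.mulVec_sub, Pi.sub_apply, Pi.zero_apply, sub_eq_zero]
      exact this
    have h6 : (Λ.map (Int.castRingHom K)).det ≠ 0 := by
      have := RingHom.map_det (Int.castRingHom K) Λ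
      rw [RingHom.mapMatrix_apply] at this
      rw [← this]; simpa using hdet
    exact sub_eq_zero.1 (Matrix.eq_zero_of_mulVec_eq_zero h6 h5)
  rw [← h1y, ← h2y, heq]
end sep

section res
universe u
open Finset
variable {F : Type*} [Field F] [CharZero F] [IsAlgClosed F] {g : Type*} [LieRing g] [LieAlgebra F g] {e h f : g}
  (P : PD F e h f) {R : Type*} [CommRing R] [Algebra F R]

theorem tenV_ex {r : ℕ} {v : Fin r → g} {V : Submodule F g} (hv : ∀ x ∈ V, ∃ c : Fin r → F, x = ∑ i, c i • v i) {s : R ⊗[F] g} (hs : s ∈ tenV V) :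
    ∃ y : Fin r → R, s = ∑ i, y i ⊗ₜ v i := by
  obtain ⟨t, rfl⟩ := hs
  induction t with
  | zero => exact ⟨0, by simp⟩
  | add a b ha hb =>
    obtain ⟨y, hy⟩ := ha; obtain ⟨z, hz⟩ := hb
    exact ⟨y + z, by rw [map_add, hy, hz, ← sum_add_distrib]; simp [TensorProduct.add_tmul]⟩
  | tmul a x =>
    obtain ⟨c, hc⟩ := hv x x.2
    refine ⟨fun i => c i • a, ?_⟩
    rw [TensorProduct.map_tmul, Submodule.subtype_apply, hc, TensorProduct.tmul_sum]
    simp [TensorProduct.smul_tmul]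

theorem PD.hV (P : PD F e h f) (x : g) : ∃ v ∈ Submodule.span F (Set.range P.w), ∃ z : g, x = v + ⁅e + h, z⁆ := by
  set L : Submodule F g := Submodule.span F (Set.range P.w) ⊔ LinearMap.range (ad F g (e + h) : End F g) with hL
  obtain ⟨M, hM, hbd⟩ := P.bd
  have key : ∀ k : ℕ, ∀ x : g, ⁅h, x⁆ = ((2 * (M + 1 - k) : ℤ) : F) • x → x ∈ L := by
    intro k
    induction k with
    | zero =>
      intro x hx
      have : x = 0 := P.B.repr.map_eq_zero_iff.1 (Finsupp.ext fun b => by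
        by_contra h0
        have h1 := P.repr_h hx h0
        have := abs_le.1 (hbd b); push_cast at h1; omega)
      rw [this]; exact zero_mem _
    | succ k ih =>
      intro x hx
      by_cases hm : M + 1 - ((k + 1 : ℕ) : ℤ) = 0
      · rw [hm, mul_zero, Int.cast_zero, zero_smul] at hx
        exact Submodule.mem_sup_left (P.w_span x hx)
      · set c : F := ((2 * (M + 1 - (k + 1 : ℕ)) : ℤ) : F) with hc
        have hc0 : c ≠ 0 := by rw [hc]; exact_mod_cast mul_ne_zero two_ne_zero hm
        have h1 : x = ⁅e + h, c⁻¹ • x⁆ - ⁅e, c⁻¹ • x⁆ := by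
          rw [add_lie, add_sub_cancel_left, lie_smul, hx, smul_smul, inv_mul_cancel₀ hc0, one_smul]
        rw [h1]
        refine sub_mem (Submodule.mem_sup_right ⟨_, rfl⟩) (ih _ ?_)
        have := wt_lie P.he2 (by rw [lie_smul, hx, smul_comm] : ⁅h, c⁻¹ • x⁆ = c • (c⁻¹ • x))
        rw [this, hc]; congr 1; push_cast; ring
  have hT : L = ⊤ := P.pt.diag L fun m w hw => by
    rcases Int.even_or_odd' m with ⟨k, rfl | rfl⟩
    · rcases le_or_gt k (M + 1) with hk | hk
      · refine key (M + 1 - k).toNat w ?_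
        rw [hw]; congr 2
        rw [Int.toNat_of_nonneg (by omega)]; ring
      · have : w = 0 := P.B.repr.map_eq_zero_iff.1 (Finsupp.ext fun b => by
          by_contra h0
          have h1 := P.repr_h hw h0
          have := abs_le.1 (hbd b); omega)
        rw [this]; exact zero_mem _
    · rw [P.pt.even k w hw]; exact zero_mem _
  obtain ⟨v, hv, _, ⟨z, rfl⟩, h1⟩ := Submodule.mem_sup.1 (hT ▸ Submodule.mem_top : x ∈ L)
  exact ⟨v, hv, z, h1.symm⟩

/-- restriction to η -/
noncomputable def PD.res : MvPolynomial (Fin P.n) F →ₐ[F] MvPolynomial (Fin P.r) F := ev P.B (P.eta MvPolynomial.X)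

theorem PD.ev_eta (z : Fin P.r → R) (q) : ev P.B (P.eta z) q = MvPolynomial.aeval z (P.res q) := by
  rw [PD.res, ← ev_map, P.eta_map]; simp

theorem PD.res_nil {q} (hq : Iv P.B q) (h0 : P.res q = 0) {t : R} {N : ℕ} (ht : t ^ N = 0) (a : Fin P.n → R) :
    MvPolynomial.aeval (fun b => algebraMap F R (P.B.repr (e + h) b) + t * a b) q = 0 := by
  have hJ : IsNilpotent (Ideal.span {t}) := ⟨N, by rw [Ideal.span_singleton_pow, ht]; simp⟩
  let X : R ⊗[F] g := ∑ b, (algebraMap F R (P.B.repr (e + h) b) + t * a b) ⊗ₜ P.B b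
  have hX0 : ∀ b, co P.B b X = algebraMap F R (P.B.repr (e + h) b) + t * a b := fun b => by
    simp only [X, map_sum, co_tmul]
    rw [sum_eq_single b]
    · simp
    · intro c _ hc; simp [hc]
    · simp
  have hX : X - 1 ⊗ₜ (e + h) ∈ JG P.B (Ideal.span {t}) := fun b => by
    rw [map_sub, hX0, co_tmul, ← aes, add_sub_cancel_left]
    exact Ideal.mul_mem_right _ _ (Ideal.mem_span_singleton_self _)
  obtain ⟨Y, hc, hY⟩ := formal P.B (Submodule.span F (Set.range P.w)) (e + h) P.hV hJ X hX
  obtain ⟨z, hz⟩ := tenV_ex (v := P.w) (fun x hx => by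
    obtain ⟨c, hc⟩ := (mse F).1 hx
    exact ⟨c, hc.symm⟩) hY
  have h2 : Y = P.eta fun i => z i + 2 := by
    have h3 : (1 : R) ⊗ₜ[F] h = ∑ i, (2 : R) ⊗ₜ P.w i := by
      have : (1 : R) ⊗ₜ[F] h = (1 : R) ⊗ₜ[F] ((2 : F) • ∑ i, P.w i) := congrArg (fun t => (1 : R) ⊗ₜ[F] t) P.h_eq
      have h2 : (2 : F) • (1 : R) = 2 := by rw [← aes]; exact map_ofNat _ 2
      rw [this, ← TensorProduct.smul_tmul, TensorProduct.tmul_sum, h2]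
    rw [sub_eq_iff_eq_add] at hz
    rw [hz, PD.eta, TensorProduct.tmul_add, h3]
    simp only [TensorProduct.add_tmul, sum_add_distrib]; abel
  have h4 := hq.cj P.B hc
  rw [h2, P.ev_eta, h0, map_zero, ev] at h4
  simp only [hX0] at h4; exact h4.symm

theorem quot_ex {T : Type u} [CommRing T] [Algebra F T] (t : T) : ∃ (R : Type u) (_ : CommRing R) (_ : Algebra F R) (π : T →ₐ[F] R), ∀ p, π p = 0 ↔ t ∣ p :=
  ⟨T ⧸ Ideal.span {t}, inferInstance, inferInstance, Ideal.Quotient.mkₐ F _, fun _ => Ideal.Quotient.eq_zero_iff_mem.trans Ideal.mem_span_singleton⟩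

theorem PD.res_inj {q} (hq : Iv P.B q) (h0 : P.res q = 0) : q = 0 := by
  let A := MvPolynomial (Fin P.n) F
  let cc : Fin P.n → F := fun b => P.B.repr (e + h) b
  let x : Fin P.n → Polynomial A := fun b => algebraMap F _ (cc b) + Polynomial.X * Polynomial.C (MvPolynomial.X b)
  let p : Polynomial A := MvPolynomial.aeval x q
  have hp0 : p = 0 := by
    let N := p.natDegree + 1
    obtain ⟨R, _, _, π, hπ⟩ := quot_ex (F := F) (Polynomial.X ^ N : Polynomial A)
    have h4 := P.res_nil hq h0 (t := π Polynomial.X) (N := N) (by rw [← map_pow, hπ]) (fun b => π (Polynomial.C (MvPolynomial.X b)))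
    have h5 : π p = 0 := by
      rw [← h4]
      refine (MvPolynomial.comp_aeval_apply x π q).trans ?_
      congr 2
      funext b; refine (map_add π _ _).trans ?_
      rw [map_mul]; congr 1; exact π.commutes _
    have h6 := (hπ _).1 h5
    by_contra hp
    have := Polynomial.natDegree_le_of_dvd h6 hp
    rw [Polynomial.natDegree_X_pow] at this
    omega
  let ψ : Polynomial A →ₐ[F] A := (MvPolynomial.aeval (fun b => MvPolynomial.X b - algebraMap F A (cc b)) : A →ₐ[F] A).comp ((Polynomial.aeval (1 : A) : Polynomial A →ₐ[A] A).restrictScalars F)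
  have h1 : ψ p = q := by
    have : ψ.comp (MvPolynomial.aeval x) = AlgHom.id F A := MvPolynomial.algHom_ext fun b => by
      simp [ψ, x]; rfl
    exact DFunLike.congr_fun this q
  rw [← h1, hp0, map_zero]

end res

section alg
universe u
theorem alg5 {I P R : Type*} [CommRing I] [CommRing P] [IsDomain P] [IsIntegrallyClosed P] [CommRing R] [IsDomain R] (φ : I →+* R)
    (hφ : Function.Injective φ) (ι : I →+* P) (hι : Function.Injective ι) {y : R} (hy : φ.IsIntegralElem y) {α β : I} (hβ : β ≠ 0)
    (h : φ β * y = φ α) : ∃ p, ι α = ι β * p := by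
  obtain ⟨p, hp, h0⟩ := hy
  have h1 := Polynomial.scaleRoots_eval₂_mul (p := p) φ y β
  rw [h0, mul_zero, h, Polynomial.eval₂_at_apply, ← map_zero φ] at h1
  have h2 := hφ h1
  let j : I →+* FractionRing P := (algebraMap P (FractionRing P)).comp ι
  have hj : Function.Injective j := (IsFractionRing.injective P (FractionRing P)).comp hι
  have hb : j β ≠ 0 := fun h => hβ (hj (h.trans (map_zero j).symm))
  have h3 := Polynomial.scaleRoots_eval₂_mul (p := p) j (j α / j β) β
  rw [mul_div_cancel₀ _ hb, Polynomial.eval₂_at_apply, h2, map_zero] at h3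
  have h4 := (mul_eq_zero.1 h3.symm).resolve_left (pow_ne_zero _ hb)
  have h5 : IsIntegral P (j α / j β) := ⟨p.map ι, hp.map ι, by rw [Polynomial.eval₂_map]; exact h4⟩
  obtain ⟨q, hq⟩ := IsIntegrallyClosed.isIntegral_iff.1 h5
  refine ⟨q, IsFractionRing.injective P (FractionRing P) ?_⟩
  rw [map_mul, hq]
  exact (mul_div_cancel₀ (j α) hb).symm

theorem alg2 {E K : Type*} [Field E] [Field K] [CharZero E] [Algebra E K] [Algebra.IsIntegral E K] (y : K) (hy : ∀ z, algebraMap E K z ≠ y) :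
    ∃ φ : K →ₐ[E] AlgebraicClosure K, φ y ≠ algebraMap K _ y := by
  have hirr : Irreducible (minpoly E y) := minpoly.irreducible (Algebra.IsIntegral.isIntegral _)
  have hsepb := hirr.separable
  have hdeg : (minpoly E y).natDegree ≠ 1 := fun h => by
    obtain ⟨z, hz⟩ := minpoly.natDegree_eq_one_iff.1 h
    exact hy z hz
  have hcard : Multiset.card ((minpoly E y).aroots (AlgebraicClosure K)) = (minpoly E y).natDegree := by
    rw [Polynomial.aroots, ← Polynomial.natDegree_map (algebraMap E (AlgebraicClosure K))]
    exact (Polynomial.splits_iff_card_roots.1 (IsAlgClosed.splits _))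
  have hnd : ((minpoly E y).aroots (AlgebraicClosure K)).Nodup := Polynomial.nodup_roots hsepb.map
  obtain ⟨y', hy', hne⟩ : ∃ y' ∈ (minpoly E y).aroots (AlgebraicClosure K), y' ≠ algebraMap K (AlgebraicClosure K) y := by
    classical
    by_contra! hall
    have h1 := Multiset.eq_replicate_card.2 hall
    have h2 := Multiset.nodup_iff_count_le_one.1 hnd (algebraMap K _ y)
    rw [h1, Multiset.count_replicate_self, hcard] at h2
    have := minpoly.natDegree_pos (Algebra.IsIntegral.isIntegral (R := E) y)
    omega
  rw [Polynomial.mem_aroots] at hy'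
  obtain ⟨φ, hφ⟩ := IntermediateField.exists_algHom_of_splits_of_aeval (F := E) (E := K) (K := AlgebraicClosure K)
    (fun s => ⟨Algebra.IsIntegral.isIntegral s, IsAlgClosed.splits _⟩) hy'.2
  exact ⟨φ, hφ ▸ hne⟩

theorem alg3 {F : Type*} [Field F] [CharZero F] {R : Type u} [CommRing R] [IsDomain R] [Algebra F R] (S : Subalgebra F R)
    (hS : ∀ x : R, IsIntegral S x) (y : R)
    (sep : ∀ (K : Type u) [Field K] [Algebra F K] [CharZero K] (φ ψ : R →ₐ[F] K), (∀ s ∈ S, φ s = ψ s) → φ y = ψ y) :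
    ∃ a ∈ S, ∃ b ∈ S, b ≠ 0 ∧ b * y = a := by
  let K := FractionRing R
  let ι : R →ₐ[F] K := IsScalarTower.toAlgHom F R K
  have hι : Function.Injective ι := IsFractionRing.injective R K
  let T : Subalgebra F K := S.map ι
  let E := IntermediateField.adjoin F (T : Set K)
  have hSE : ∀ s ∈ S, ι s ∈ E := fun s hs => IntermediateField.subset_adjoin F _ (show ι s ∈ T from ⟨s, hs, rfl⟩)
  have hint : ∀ x : R, IsIntegral E (ι x) := fun x => by
    obtain ⟨p, hp, h0⟩ := hS x
    let j : S →+* E := { toFun := fun s => ⟨ι s, hSE s s.2⟩, map_one' := by ext; simp, map_zero' := by ext; simp, map_add' := fun a b => by ext; simp, map_mul' := fun a b => by ext; simp }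
    refine ⟨p.map j, hp.map j, ?_⟩
    rw [Polynomial.eval₂_map]
    have h1 := congrArg ι.toRingHom h0
    rw [Polynomial.hom_eval₂, map_zero] at h1
    exact h1
  haveI : Algebra.IsIntegral E K := ⟨fun x => by
    obtain ⟨a, b, hb, rfl⟩ := IsFractionRing.div_surjective (A := R) x
    rw [div_eq_mul_inv]
    exact (hint a).mul (hint b).inv⟩
  by_cases hy : ι y ∈ E
  · obtain ⟨a, ha, b, hb, hab⟩ := IntermediateField.mem_adjoin_iff_div.1 hy
    rw [Algebra.adjoin_eq] at ha hb
    obtain ⟨a, ha, rfl⟩ := ha; obtain ⟨b, hb, rfl⟩ := hb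
    by_cases hb0 : b = 0
    · refine ⟨0, zero_mem _, 1, one_mem _, one_ne_zero, ?_⟩
      subst hb0
      rw [one_mul]; apply hι; rw [hab]; simp
    · refine ⟨a, ha, b, hb, hb0, hι ?_⟩
      rw [map_mul, hab]
      exact mul_div_cancel₀ _ fun h => hb0 (hι (h.trans (map_zero ι).symm))
  · exfalso
    have : CharZero E := charZero_of_injective_algebraMap (algebraMap F E).injective
    obtain ⟨φ, hφ⟩ := alg2 (E := E) (ι y) fun z hz => hy (by rw [← hz]; exact z.2)
    have : CharZero (AlgebraicClosure K) := charZero_of_injective_algebraMap (algebraMap F (AlgebraicClosure K)).injective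
    refine hφ ?_
    refine sep _ ((φ.restrictScalars F).comp ι) ((IsScalarTower.toAlgHom F K (AlgebraicClosure K)).comp ι) fun s hs => ?_
    change φ (ι s) = algebraMap K _ (ι s)
    exact φ.commutes ⟨ι s, hSE s hs⟩
end alg

section inv
open Finset
variable {F : Type*} [Field F] [CharZero F] [IsAlgClosed F] {g : Type*} [LieRing g] [LieAlgebra F g] {e h f : g}
  (P : PD F e h f) {R : Type*} [CommRing R] [Algebra F R]

/-- invariants as a subalgebra -/
noncomputable def PD.IS : Subalgebra F (MvPolynomial (Fin P.n) F) where
  carrier := {q | Iv P.B q}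
  mul_mem' := fun {a b} ha hb y => by rw [Derivation.leibniz, ha y, hb y]; simp
  add_mem' := fun {a b} ha hb y => by rw [map_add, ha y, hb y, add_zero]
  algebraMap_mem' := fun c y => Derivation.map_algebraMap _ _

theorem PD.fund_inv {K : Type*} [Field K] [CharZero K] : ∃ lam : Fin P.r → Fin P.r → ℤ, (∀ i, Nonempty (HW P (lam i))) ∧
    ((Matrix.of lam).map (Int.cast : ℤ → K)).det ≠ 0 := by
  choose lam hV hl0 hlp' using P.fund
  refine ⟨lam, hV, ?_⟩
  have hdet : (Matrix.of lam).det ≠ 0 := fun h0 => by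
    have h3 : (Matrix.of P.C) * (Matrix.of lam).transpose = Matrix.diagonal fun i => ∑ k, P.C i k * lam i k := by
      ext a b
      rw [Matrix.mul_apply]
      by_cases hab : a = b
      · subst hab; rw [Matrix.diagonal_apply_eq]; rfl
      · rw [Matrix.diagonal_apply_ne _ hab]; exact hl0 b a hab
    have h4 := congrArg Matrix.det h3
    rw [Matrix.det_mul, Matrix.det_transpose, h0, mul_zero, Matrix.det_diagonal] at h4
    exact (prod_pos fun i _ => hlp' i).ne h4
  have := RingHom.map_det (Int.castRingHom K) (Matrix.of lam)
  rw [RingHom.mapMatrix_apply] at this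
  exact fun h => hdet (by simpa using this.trans h)

theorem PD.root_int {lam} (V : HW P lam) : (P.res.comp P.IS.val).toRingHom.IsIntegralElem (∑ i, (lam i : MvPolynomial (Fin P.r) F) * MvPolynomial.X i) := by
  let Rr := MvPolynomial (Fin P.r) F
  let K := FractionRing Rr
  let p := (gm P.B V.ρ).charpoly
  obtain ⟨q, hq, -, hqm⟩ := Polynomial.lifts_and_natDegree_eq_and_monic (f := P.IS.val.toRingHom) (p := p)
    ((Polynomial.lifts_iff_coeff_lifts _).2 fun k => ⟨⟨_, Iv_charpoly P.B V.ρ V.lie k⟩, rfl⟩) (Matrix.charpoly_monic _)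
  refine ⟨q, hqm, ?_⟩
  have h1 : Polynomial.eval₂ (P.res.comp P.IS.val).toRingHom (∑ i, (lam i : Rr) * MvPolynomial.X i) q = Polynomial.eval₂ P.res.toRingHom (∑ i, (lam i : Rr) * MvPolynomial.X i) p := by
    rw [← hq, Polynomial.eval₂_map]; rfl
  refine h1.trans ?_
  apply IsFractionRing.injective Rr K
  rw [Polynomial.hom_eval₂, map_zero]
  have h2 := V.root1 P fun i => algebraMap Rr K (MvPolynomial.X i)
  rw [HW.M, ← V.gm_eta P] at h2
  have h3 := Matrix.charpoly_map (gm P.B V.ρ) (ev P.B (P.eta fun i => algebraMap Rr K (MvPolynomial.X i))).toRingHom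
  have h4 : (gm P.B V.ρ).map (ev P.B (P.eta fun i => algebraMap Rr K (MvPolynomial.X i))) = (gm P.B V.ρ).map (ev P.B (P.eta fun i => algebraMap Rr K (MvPolynomial.X i))).toRingHom := rfl
  rw [h4, h3, Polynomial.IsRoot, Polynomial.eval_map] at h2
  have h5 : (ev P.B (P.eta fun i => algebraMap Rr K (MvPolynomial.X i))).toRingHom = (algebraMap Rr K).comp P.res.toRingHom := RingHom.ext fun q => by
    refine (P.ev_eta _ q).trans ?_
    have h7 := MvPolynomial.comp_aeval_apply (R := F) (MvPolynomial.X : Fin P.r → Rr) (IsScalarTower.toAlgHom F Rr K) (P.res q)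
    rw [MvPolynomial.aeval_X_left_apply] at h7
    exact h7.symm
  rw [h5] at h2
  have h6 : algebraMap Rr K (∑ i, (lam i : Rr) * MvPolynomial.X i) = ∑ i, (lam i : K) * algebraMap Rr K (MvPolynomial.X i) := by simp
  rw [h6]; exact h2

theorem PD.all_int (x : MvPolynomial (Fin P.r) F) : (P.res.comp P.IS.val).toRingHom.IsIntegralElem x := by
  letI := (P.res.comp P.IS.val).toRingHom.toAlgebra
  have hF : ∀ c : F, IsIntegral P.IS (algebraMap F (MvPolynomial (Fin P.r) F) c) := fun c => by
    have : algebraMap F (MvPolynomial (Fin P.r) F) c = algebraMap P.IS (MvPolynomial (Fin P.r) F) (algebraMap F P.IS c) := ((P.res.comp P.IS.val).commutes c).symm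
    rw [this]; exact isIntegral_algebraMap
  have hX : ∀ k, IsIntegral P.IS (MvPolynomial.X k : MvPolynomial (Fin P.r) F) := fun k => by
    obtain ⟨lam, hV, hdet⟩ := P.fund_inv (K := F)
    set L := (Matrix.of lam).map (Int.cast : ℤ → F) with hL
    have h1 : (MvPolynomial.X k : MvPolynomial (Fin P.r) F) = ∑ i, algebraMap F (MvPolynomial (Fin P.r) F) (L⁻¹ k i) * ∑ j, (lam i j : MvPolynomial (Fin P.r) F) * MvPolynomial.X j := by
      have h2 : ∀ i j, (lam i j : MvPolynomial (Fin P.r) F) = algebraMap F _ (L i j) := fun i j => by simp [L]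
      simp only [h2, mul_sum, ← mul_assoc, ← map_mul]
      rw [sum_comm]
      simp only [← sum_mul, ← map_sum, ← Matrix.mul_apply]
      rw [Matrix.nonsing_inv_mul _ (isUnit_iff_ne_zero.2 hdet)]
      simp [Matrix.one_apply]
    rw [h1]
    exact IsIntegral.sum _ fun i _ => (hF _).mul (by obtain ⟨V⟩ := hV i; exact P.root_int V)
  change IsIntegral P.IS x
  induction x using MvPolynomial.induction_on with
  | C c => exact hF c
  | add p q hp hq => exact hp.add hq
  | mul_X p k hp => exact hp.mul (hX k)

theorem PD.inv_ex (y : MvPolynomial (Fin P.r) F) (hy : ∀ j, MvPolynomial.aeval (fun k => MvPolynomial.X k - (P.C j k : F) • MvPolynomial.X j) y = y) :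
    ∃ p, Iv P.B p ∧ P.res p = y := by
  obtain ⟨a, ⟨α, hα, ha⟩, b, ⟨β, hβ, hb⟩, hb0, hab⟩ := alg3 (P.IS.map P.res) (fun x => by
    obtain ⟨p, hp, h0⟩ := P.all_int x
    let j : P.IS →+* P.IS.map P.res := { toFun := fun s => ⟨P.res s, s, s.2, rfl⟩, map_one' := by ext; simp, map_zero' := by ext; simp, map_add' := fun a b => by ext; simp, map_mul' := fun a b => by ext; simp }
    exact ⟨p.map j, hp.map j, by rw [Polynomial.eval₂_map]; exact h0⟩) y (fun K _ _ _ φ ψ hs => by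
    have h1 : ∀ φ : MvPolynomial (Fin P.r) F →ₐ[F] K, ∀ q, φ q = MvPolynomial.aeval (fun i => φ (MvPolynomial.X i)) q := fun φ q => by
      rw [← MvPolynomial.comp_aeval_apply]; simp
    rw [h1 φ, h1 ψ]
    refine P.sep (fun q hq => ?_) y hy
    rw [P.ev_eta, P.ev_eta, ← h1, ← h1]
    exact hs _ ⟨q, hq, rfl⟩)
  change P.res α = a at ha
  change P.res β = b at hb
  have hβ0 : β ≠ 0 := fun h => hb0 (by rw [← hb, h, map_zero])
  obtain ⟨p, hp⟩ := alg5 (P.res.comp P.IS.val).toRingHom (fun x x' hx => Subtype.ext (sub_eq_zero.1 (P.res_inj (sub_mem x.2 x'.2 : (x : MvPolynomial (Fin P.n) F) - x' ∈ P.IS) (by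
    rw [map_sub, sub_eq_zero]; exact hx)))) P.IS.val.toRingHom Subtype.val_injective (P.all_int y) (α := ⟨α, hα⟩) (β := ⟨β, hβ⟩)
    (fun h => hβ0 (congrArg Subtype.val h)) (by change P.res β * y = P.res α; rw [hb, ha, hab])
  change α = β * p at hp
  refine ⟨p, fun u => ?_, ?_⟩
  · have h1 := hα u
    rw [hp, Derivation.leibniz, hβ u, smul_zero, add_zero, smul_eq_mul] at h1
    exact (mul_eq_zero.1 h1).resolve_left hβ0
  · have h1 := congrArg P.res hp
    rw [map_mul, ha, hb, ← hab] at h1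
    exact (mul_left_cancel₀ hb0 h1).symm
end inv

section uniq
open Finset
variable {F : Type*} [Field F] [CharZero F] [IsAlgClosed F] {g : Type*} [LieRing g] [LieAlgebra F g] {e h f : g}
  (P : PD F e h f) {R : Type*} [CommRing R] [Algebra F R]

theorem PD.uniq [FiniteDimensional F g] (hr : finrank F (cent F g f) = P.r) {s s' : R ⊗[F] g} (hs : s ∈ Sl F e f R)
    (hs' : s' ∈ Sl F e f R) (hc : Cj F (R ⊗[F] g) s s') : s = s' := by
  obtain ⟨v, y, hli, hv0, hv, hy, hcj⟩ := P.kappa hr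
  have hres : ∀ q, Iv P.B q → P.res q = MvPolynomial.aeval y (ev P.B (sig e v (MvPolynomial.X : Fin P.r → MvPolynomial (Fin P.r) F)) q) := fun q hq => by
    rw [PD.res, ← hq.cj P.B (PD.CjM.cj P hcj), ← ev_map, sig_map]; simp
  have hai : AlgebraicIndependent F y := by
    have : Algebra.IsAlgebraic (Algebra.adjoin F (Set.range y)) (MvPolynomial (Fin P.r) F) := by
      have : Algebra.IsIntegral (Algebra.adjoin F (Set.range y)) (MvPolynomial (Fin P.r) F) := ⟨fun x => by
        obtain ⟨p, hp, h0⟩ := P.all_int x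
        have hj : ∀ q : P.IS, P.res q ∈ Algebra.adjoin F (Set.range y) := fun q => by
          rw [Algebra.adjoin_range_eq_range_aeval, hres _ q.2]; exact ⟨_, rfl⟩
        let j : P.IS →+* Algebra.adjoin F (Set.range y) := { toFun := fun q => ⟨P.res q, hj q⟩, map_one' := by ext; simp, map_zero' := by ext; simp, map_add' := fun a b => by ext; simp, map_mul' := fun a b => by ext; simp }
        exact ⟨p.map j, hp.map j, by rw [Polynomial.eval₂_map]; exact h0⟩⟩
      infer_instance
    refine (Algebra.IsAlgebraic.isTranscendenceBasis_of_lift_le_trdeg_of_finite F y ?_).1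
    rw [MvPolynomial.trdeg_of_isDomain]; simp
  choose p hp hpy using fun i => P.inv_ex (y i) (hy i)
  have key : ∀ i, ev P.B (sig e v (MvPolynomial.X : Fin P.r → MvPolynomial (Fin P.r) F)) (p i) = MvPolynomial.X i := fun i =>
    hai (by rw [← hres _ (hp i), hpy, MvPolynomial.aeval_X])
  have key2 : ∀ (z : Fin P.r → R) i, ev P.B (sig e v z) (p i) = z i := fun z i => by
    have h1 := congrArg (MvPolynomial.aeval z) (key i)
    rw [← ev_map, sig_map] at h1
    simpa using h1
  obtain ⟨z, rfl⟩ := sig_ex hv hs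
  obtain ⟨z', rfl⟩ := sig_ex hv hs'
  congr 1; funext i
  rw [← key2 z i, ← key2 z' i]
  exact ((hp i).cj P.B hc).symm
end uniq

section transv
open Finset
variable {F : Type*} [Field F] [CharZero F] [IsAlgClosed F] {g : Type*} [LieRing g] [LieAlgebra F g] {e h f : g}
  (P : PD F e h f) {R : Type*} [CommRing R] [Algebra F R]

theorem rT_bil {R' : Type*} [CommRing R'] [Algebra F R'] (φ ψ χ : R →ₗ[F] R') (H : ∀ a b, φ a * ψ b = χ (a * b)) (X Y : R ⊗[F] g) :
    ⁅φ.rTensor g X, ψ.rTensor g Y⁆ = χ.rTensor g ⁅X, Y⁆ := by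
  induction X with
  | zero => simp
  | add a b ha hb => simp only [map_add, add_lie, ha, hb]
  | tmul a x =>
    induction Y with
    | zero => simp
    | add a b ha hb => simp only [map_add, lie_add, ha, hb]
    | tmul b y => simp [btm, H]

theorem dual_ex.{uu, vv} (F : Type uu) (R : Type vv) [Field F] [CommRing R] [Algebra F R] : ∃ (R' : Type vv) (_ : CommRing R') (_ : Algebra F R') (i : R →ₐ[F] R') (ε : R →ₗ[F] R')
    (s : R' →ₗ[F] R) (p : R' → R), (∀ a b, ε a * ε b = 0) ∧ (∀ a b, ε a * i b = ε (a * b)) ∧ (∀ a, s (ε a) = a) ∧ ∀ a b, ε a * b = ε (a * p b) := by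
  refine ⟨TrivSqZeroExt R R, inferInstance, inferInstance, TrivSqZeroExt.inlAlgHom F R R, (TrivSqZeroExt.inrHom R R).restrictScalars F,
    (TrivSqZeroExt.sndHom R R).restrictScalars F, TrivSqZeroExt.fst, fun a b => ?_, fun a b => ?_, fun a => ?_, fun a b => ?_⟩
  · exact TrivSqZeroExt.inr_mul_inr R a b
  · refine TrivSqZeroExt.ext ?_ ?_
    · change (0:R) * b = 0; simp
    · change (0:R) • (0:R) + MulOpposite.op b • a = a * b; simp
  · rfl
  · refine TrivSqZeroExt.ext ?_ ?_
    · change (0:R) * _ = 0; simp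
    · change (0:R) • _ + MulOpposite.op b.fst • a = a * b.fst; simp

theorem PD.transv [FiniteDimensional F g] (hr : finrank F (cent F g f) = P.r) {X : R ⊗[F] g} (hX : X ∈ Sl F e f R) :
    IsCompl (tenV (R := R) (cent F g f)) (LinearMap.range (ad F (R ⊗[F] g) X : End F (R ⊗[F] g))) := by
  constructor
  · rw [Submodule.disjoint_def]
    rintro v hv ⟨Z, hZ⟩
    obtain ⟨R', _, _, i, ε, s, p, e1, e2, e3, e4⟩ := dual_ex F R
    set X' := i.toLinearMap.rTensor g X with hX'
    set Z' := ε.rTensor g Z with hZ'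
    have h1 : ∀ Y : R' ⊗[F] g, ⁅Z', ⁅Z', Y⁆⁆ = 0 := by
      intro Y
      have h2 : ∀ Y : R' ⊗[F] g, ∃ W, ⁅Z', Y⁆ = ε.rTensor g W := by
        intro Y
        rw [hZ']; clear_value X'; clear hZ hZ'
        induction Z with
        | zero => exact ⟨0, by simp⟩
        | add a b ha hb => obtain ⟨u, hu⟩ := ha; obtain ⟨v, hv⟩ := hb; exact ⟨u + v, by simp only [map_add, add_lie, hu, hv]⟩
        | tmul a x =>
          induction Y with
          | zero => exact ⟨0, by simp⟩
          | add a b ha hb => obtain ⟨u, hu⟩ := ha; obtain ⟨v, hv⟩ := hb; exact ⟨u + v, by simp only [map_add, lie_add, hu, hv]⟩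
          | tmul b y =>
            refine ⟨(a * p b) ⊗ₜ ⁅x, y⁆, ?_⟩
            rw [LinearMap.rTensor_tmul, LinearMap.rTensor_tmul, btm, e4]
      obtain ⟨W, hW⟩ := h2 Y
      rw [hW, hZ', rT_bil ε ε 0 e1]
      simp
    have hn : (ad F (R' ⊗[F] g) Z' : End F (R' ⊗[F] g)) ^ 2 = 0 := by
      refine LinearMap.ext fun Y => ?_; rw [pow_two]; exact h1 Y
    have h3 : Cj F (R' ⊗[F] g) X' (X' + ⁅Z', X'⁆) := by
      have := Cj.step (F := F) ⟨2, hn⟩ X'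
      rw [nx_eq_sum hn] at this
      simpa [sum_range_succ] using this
    have h4 : ⁅Z', X'⁆ = - ε.rTensor g v := by
      rw [hZ', hX', rT_bil ε i.toLinearMap ε e2, ← hZ, adp, ← lie_skew Z X, map_neg]
    have h5 : ∀ (φ : R →ₗ[F] R') u, u ∈ tenV (R := R) (cent F g f) → φ.rTensor g u ∈ tenV (R := R') (cent F g f) := by
      rintro φ _ ⟨t, rfl⟩
      induction t with
      | zero => simp
      | add a b ha hb => rw [map_add, map_add]; exact add_mem ha hb
      | tmul a x => rw [TensorProduct.map_tmul]; exact tmul_tenV _ x.2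
    have hX1 : X' ∈ Sl F e f R' := by
      have := h5 i.toLinearMap _ hX
      rw [map_sub] at this
      simpa [Sl] using this
    have h6 := P.uniq hr hX1 (show X' + ⁅Z', X'⁆ ∈ Sl F e f R' from by
      have := sub_mem (show X' - _ ∈ tenV _ from hX1) (h5 ε v hv)
      change X' + ⁅Z', X'⁆ - _ ∈ tenV _
      rw [h4]; convert this using 1; abel) h3
    rw [left_eq_add, h4, neg_eq_zero] at h6
    have h7 := congrArg (s.rTensor g) h6
    rw [← lco, ← LinearMap.rTensor_comp, map_zero] at h7
    have h8 : s ∘ₗ ε = LinearMap.id := LinearMap.ext e3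
    rwa [h8, LinearMap.rTensor_id] at h7
  · rw [codisjoint_iff, eq_top_iff]
    intro Y _
    obtain ⟨v, hv, N, rfl⟩ := P.sum_top hX Y
    exact Submodule.add_mem_sup hv ⟨N, rfl⟩
end transv

section mx
open Finset
variable {F : Type*} [Field F] {V : Type*} [AddCommGroup V] [Module F V]

/-- diagonal action on the tensor square -/
noncomputable def DT (p q : End F V) : End F (V ⊗[F] V) := p.rTensor V + q.lTensor V

theorem DT_pow (p q : End F V) (n : ℕ) (x y : V) :
    (DT p q ^ n) (x ⊗ₜ y) = ∑ i ∈ range (n + 1), (n.choose i : F) • ((p ^ i) x ⊗ₜ[F] (q ^ (n - i)) y) := by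
  have hc : Commute (p.rTensor V) (q.lTensor V : End F (V ⊗[F] V)) := by
    refine LinearMap.ext fun z => ?_
    induction z with
    | zero => simp
    | add a b ha hb => rw [map_add, ha, hb, map_add]
    | tmul a b => simp
  have h1 : ∀ i (z : V ⊗[F] V), ((p.rTensor V : End F (V ⊗[F] V)) ^ i) z = (p ^ i).rTensor V z := fun i z => by rw [LinearMap.rTensor_pow]
  have h2 : ∀ i (z : V ⊗[F] V), ((q.lTensor V : End F (V ⊗[F] V)) ^ i) z = (q ^ i).lTensor V z := fun i z => by rw [LinearMap.lTensor_pow]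
  rw [DT, hc.add_pow, lsu]
  refine sum_congr rfl fun i _ => ?_
  rw [(Nat.cast_commute _ _).symm.eq, ema, ema, h2, LinearMap.lTensor_tmul, h1, LinearMap.rTensor_tmul]
  rw [Module.End.natCast_apply, Nat.cast_smul_eq_nsmul]

theorem DT_nilp {p : End F V} (hp : IsNilpotent p) : IsNilpotent (DT p p) := by
  obtain ⟨k, hk⟩ := hp
  refine ⟨k + k, LinearMap.ext fun z => ?_⟩
  induction z with
  | zero => simp
  | add a b ha hb => rw [map_add, ha, hb, map_add]
  | tmul a b =>
    rw [DT_pow, sum_eq_zero]; rfl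
    intro i _
    rcases le_total k i with h | h
    · rw [pow_eq_zero_of_le h hk]; simp
    · rw [pow_eq_zero_of_le (show k ≤ k + k - i by omega) hk]; simp

theorem DT_gen (a : End F V) {α β : F} {x y : V} (hx : x ∈ a.maxGenEigenspace α) (hy : y ∈ a.maxGenEigenspace β) :
    x ⊗ₜ[F] y ∈ (DT a a).maxGenEigenspace (α + β) := by
  rw [mge] at *
  obtain ⟨k, hk⟩ := hx
  obtain ⟨l, hl⟩ := hy
  refine ⟨k + l, ?_⟩
  have h1 : DT a a - (α + β) • (1 : End F (V ⊗[F] V)) = DT (a - α • 1) (a - β • 1) := by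
    refine LinearMap.ext fun z => ?_
    induction z with
    | zero => simp
    | add a b ha hb => rw [map_add, ha, hb, map_add]
    | tmul a b => simp [DT, TensorProduct.sub_tmul, TensorProduct.tmul_sub, add_smul, TensorProduct.smul_tmul']; abel
  rw [h1, DT_pow, sum_eq_zero]
  intro i _
  rcases le_total k i with h | h
  · rw [← Nat.sub_add_cancel h, pow_add, ema, hk]; simp
  · rw [← Nat.sub_add_cancel (show l ≤ k + l - i by omega), pow_add _ _ l, ema, hl]; simp

theorem max_eig [CharZero F] [IsAlgClosed F] [FiniteDimensional F V] [LinearOrder F] [IsOrderedAddMonoid F] (a : End F V) (μ : F) (hμ : ∀ α, a.HasEigenvalue α → α ≤ μ)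
    (U : Submodule F (V ⊗[F] V)) (hU : ∀ z ∈ U, DT a a z ∈ U) (u : V) (hu : u ⊗ₜ u ∈ U)
    (hn : u ∉ ⨆ α, ⨆ (_ : α ≠ μ), a.maxGenEigenspace α) : ∃ w, w ≠ 0 ∧ a w = μ • w ∧ w ⊗ₜ w ∈ U := by
  have htop := Module.End.iSup_maxGenEigenspace_eq_top a
  have split : ∀ x : V, ∃ x0 ∈ a.maxGenEigenspace μ, ∃ x1 ∈ ⨆ α, ⨆ (_ : α ≠ μ), a.maxGenEigenspace α, x0 + x1 = x := fun x => by
    have : x ∈ a.maxGenEigenspace μ ⊔ ⨆ α, ⨆ (_ : α ≠ μ), a.maxGenEigenspace α := by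
      have h2 : (⨆ α, a.maxGenEigenspace α) ≤ a.maxGenEigenspace μ ⊔ ⨆ α, ⨆ (_ : α ≠ μ), a.maxGenEigenspace α := iSup_le fun α => by
        by_cases h : α = μ
        · subst h; exact le_sup_left
        · exact le_sup_of_le_right (le_iSup₂_of_le α h le_rfl)
      rw [htop] at h2; exact h2 trivial
    exact Submodule.mem_sup.1 this
  obtain ⟨u0, hu0, u1, hu1, rfl⟩ := split u
  have hle : ∀ α, ∀ x ∈ a.maxGenEigenspace α, x ≠ 0 → α ≤ μ := fun α x hx h0 => hμ α (by
    have h3 : a.maxGenEigenspace α ≠ ⊥ := fun hb => h0 (by rw [hb] at hx; exact (Submodule.mem_bot F).1 hx)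
    exact Module.End.HasUnifEigenvalue.lt (k := ⊤) zero_lt_one h3)
  set M := DT a a with hM
  set W := ⨆ c, ⨆ (_ : c ≠ μ + μ), M.maxGenEigenspace c with hW
  have hW1 : ∀ α β, ∀ x ∈ a.maxGenEigenspace α, ∀ y ∈ a.maxGenEigenspace β, α ≠ μ → x ⊗ₜ[F] y ∈ W ∧ y ⊗ₜ[F] x ∈ W := fun α β x hx y hy hα => by
    by_cases hx0 : x = 0
    · subst hx0; simp
    by_cases hy0 : y = 0
    · subst hy0; simp
    have h4 : α + β ≠ μ + μ := (add_lt_add_of_lt_of_le (lt_of_le_of_ne (hle α x hx hx0) hα) (hle β y hy hy0)).ne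
    exact ⟨(le_iSup₂_of_le (α + β) h4 le_rfl : _ ≤ W) (DT_gen a hx hy), (le_iSup₂_of_le (β + α) (by rwa [add_comm]) le_rfl : _ ≤ W) (DT_gen a hy hx)⟩
  have hW2 : ∀ x ∈ ⨆ α, ⨆ (_ : α ≠ μ), a.maxGenEigenspace α, ∀ y, x ⊗ₜ[F] y ∈ W ∧ y ⊗ₜ[F] x ∈ W := fun x hx y => by
    have h5 : (⨆ α, ⨆ (_ : α ≠ μ), a.maxGenEigenspace α) ≤ W.comap ((TensorProduct.mk F V V).flip y) ⊓ W.comap (TensorProduct.mk F V V y) := by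
      refine iSup₂_le fun α hα x hx => ?_
      have h6 : (⨆ α, a.maxGenEigenspace α) ≤ W.comap (TensorProduct.mk F V V x) ⊓ W.comap ((TensorProduct.mk F V V).flip x) :=
        iSup_le fun β y hy => hW1 α β x hx y hy hα
      rw [htop] at h6
      exact h6 (x := y) trivial
    exact h5 hx
  have h7 : (u0 + u1) ⊗ₜ[F] (u0 + u1) - u0 ⊗ₜ u0 ∈ W := by
    have : (u0 + u1) ⊗ₜ[F] (u0 + u1) - u0 ⊗ₜ u0 = u1 ⊗ₜ (u0 + u1) + u0 ⊗ₜ u1 := by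
      simp only [TensorProduct.add_tmul, TensorProduct.tmul_add]; abel
    rw [this]; exact add_mem (hW2 u1 hu1 _).1 (hW2 u1 hu1 _).2
  have h8 : (u0 + u1) ⊗ₜ[F] (u0 + u1) ∈ (U ⊓ M.maxGenEigenspace (μ + μ)) ⊔ W := by
    have h9 := Submodule.inf_iSup_genEigenspace hU ⊤
    have h10 : (u0 + u1) ⊗ₜ[F] (u0 + u1) ∈ U ⊓ ⨆ c, M.genEigenspace c ⊤ := ⟨hu, by
      rw [show (⨆ c, M.genEigenspace c ⊤) = ⊤ from Module.End.iSup_maxGenEigenspace_eq_top M]; trivial⟩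
    rw [h9] at h10
    refine (iSup_le fun c => ?_ : _ ≤ (U ⊓ M.maxGenEigenspace (μ + μ)) ⊔ W) h10
    by_cases h : c = μ + μ
    · subst h; exact le_sup_left
    · exact le_sup_of_le_right (le_trans inf_le_right (le_iSup₂_of_le c h le_rfl : _ ≤ W))
  obtain ⟨t0, ht0, t1, ht1, ht⟩ := Submodule.mem_sup.1 h8
  have h11 : t0 - u0 ⊗ₜ u0 = 0 := by
    have hi := (Module.End.independent_maxGenEigenspace M) (μ + μ)
    rw [Submodule.disjoint_def] at hi
    refine hi _ (sub_mem ht0.2 (DT_gen a hu0 hu0)) ?_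
    have : t0 - u0 ⊗ₜ u0 = ((u0 + u1) ⊗ₜ[F] (u0 + u1) - u0 ⊗ₜ u0) - t1 := by rw [← ht]; abel
    rw [this]; exact sub_mem h7 ht1
  have h12 : u0 ⊗ₜ u0 ∈ U := by rw [← sub_eq_zero.1 h11]; exact ht0.1
  have hu00 : u0 ≠ 0 := fun h => hn (by rw [h, zero_add]; exact hu1)
  classical
  obtain ⟨k, hk⟩ := mge _ _ _ |>.1 hu0
  have hex : ∃ k, ((a - μ • (1 : End F V)) ^ k) u0 = 0 := ⟨k, hk⟩
  have hs := Nat.find_spec hex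
  have hpos : Nat.find hex ≠ 0 := fun h => by rw [h] at hs; exact hu00 (by simpa using hs)
  obtain ⟨m, hm⟩ := Nat.exists_eq_succ_of_ne_zero hpos
  have hmm := Nat.find_min hex (m := m) (by omega)
  rw [hm] at hs
  set ν := a - μ • (1 : End F V) with hν
  refine ⟨(ν ^ m) u0, hmm, ?_, ?_⟩
  · rw [Nat.succ_eq_add_one, pow_succ', ema] at hs
    rw [hν, lsb, sub_eq_zero] at hs
    exact hs
  · have h13 : DT ν ν = M - (μ + μ) • (1 : End F (V ⊗[F] V)) := by
      refine LinearMap.ext fun z => ?_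
      induction z with
      | zero => simp
      | add a b ha hb => rw [map_add, ha, hb, map_add]
      | tmul a b => simp [hM, hν, DT, TensorProduct.sub_tmul, TensorProduct.tmul_sub, add_smul, TensorProduct.smul_tmul']; abel
    have h14 : ∀ n : ℕ, ∀ z ∈ U, (DT ν ν ^ n) z ∈ U := by
      intro n
      induction n with
      | zero => intro z hz; simpa using hz
      | succ n ih =>
        intro z hz
        rw [pow_succ, ema]
        refine ih _ ?_
        rw [h13, lsb]
        exact sub_mem (hU z hz) (U.smul_mem _ hz)
    have h15 := h14 (2 * m) _ h12
    rw [DT_pow, sum_eq_single m] at h15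
    · rw [show 2 * m - m = m by omega] at h15
      refine (U.smul_mem_iff ?_).1 h15
      exact_mod_cast (Nat.choose_pos (by omega)).ne'
    · intro i _ hi
      rcases lt_or_gt_of_ne hi with h | h
      · rw [← Nat.sub_add_cancel (show m.succ ≤ 2 * m - i by omega), pow_add _ _ m.succ, ema, hs]; simp
      · rw [← Nat.sub_add_cancel (show m.succ ≤ i by omega), pow_add _ _ m.succ, ema, hs]; simp
    · intro h; simp at h; omega
end mx

section cas
open Finset
variable {F : Type*} [Field F] [CharZero F] [IsAlgClosed F] {g : Type*} [LieRing g] [LieAlgebra F g] [FiniteDimensional F g] [LieAlgebra.IsKilling F g] {e h f : g}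
  (P : PD F e h f)

/-- dual basis -/
noncomputable def PD.DB : Module.Basis (Fin P.n) F g := (killingForm F g).dualBasis (LieAlgebra.IsKilling.killingForm_nondegenerate F g) P.B

theorem kf_sym (x y : g) : killingForm F g x y = killingForm F g y x := LieModule.traceForm_comm F g g x y
theorem kf_inv (x y z : g) : killingForm F g ⁅x, y⁆ z = killingForm F g x ⁅y, z⁆ := LieModule.traceForm_apply_lie_apply F g g x y z

theorem PD.DB_repr (x : g) (b) : P.DB.repr x b = killingForm F g x (P.B b) := LinearMap.BilinForm.dualBasis_repr_apply _ _ x b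
theorem PD.DB_kf (b c) : killingForm F g (P.DB b) (P.B c) = if c = b then 1 else 0 := LinearMap.BilinForm.apply_dualBasis_left _ _ b c
theorem PD.B_repr (x : g) (b) : P.B.repr x b = killingForm F g x (P.DB b) := by
  conv_rhs => rw [← P.B.sum_repr x, map_sum, lsu]
  simp [kf_sym _ (P.DB b), P.DB_kf]

theorem PD.DB_wt (i b) : ⁅P.w i, P.DB b⁆ = (-(P.wt b i : F)) • P.DB b := by
  refine P.DB.repr.injective (Finsupp.ext fun c => ?_)
  rw [P.DB_repr, ← lie_skew (P.w i) (P.DB b), map_neg, LinearMap.neg_apply, kf_inv, P.wB, map_smul, map_smul, fsm, P.DB_kf, P.DB.repr_self, Finsupp.single_apply]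
  by_cases hc : c = b
  · subst hc; simp
  · simp [hc, Ne.symm hc]

theorem PD.cas {W : Type*} [AddCommGroup W] [Module F W] (β : g →ₗ[F] g →ₗ[F] W) (x : g) :
    ∑ b, (β ⁅x, P.B b⁆ (P.DB b) + β (P.B b) ⁅x, P.DB b⁆) = 0 := by
  have h1 : ∀ b, β ⁅x, P.B b⁆ (P.DB b) = ∑ c, killingForm F g ⁅x, P.B b⁆ (P.DB c) • β (P.B c) (P.DB b) := fun b => by
    conv_lhs => rw [← P.B.sum_repr ⁅x, P.B b⁆, map_sum, lsu]
    simp [P.B_repr]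
  have h2 : ∀ b, β (P.B b) ⁅x, P.DB b⁆ = ∑ c, killingForm F g ⁅x, P.DB b⁆ (P.B c) • β (P.B b) (P.DB c) := fun b => by
    conv_lhs => rw [← P.DB.sum_repr ⁅x, P.DB b⁆, map_sum]
    simp [P.DB_repr]
  simp only [h1, h2, sum_add_distrib]
  rw [sum_comm, ← sum_add_distrib]
  refine sum_eq_zero fun b _ => ?_
  rw [← sum_add_distrib]
  refine sum_eq_zero fun c _ => ?_
  rw [← add_smul, kf_inv, ← lie_skew x (P.DB b), map_neg, LinearMap.neg_apply, kf_inv, kf_sym _ ⁅x, P.B c⁆, ← kf_inv]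
  rw [kf_inv, add_neg_cancel, zero_smul]

variable {lam : Fin P.r → ℤ} (V : HW P lam)

/-- operators -/
noncomputable def HW.dl : g →ₗ[F] End F (Fin V.d → F) := (Matrix.toLin' : Matrix (Fin V.d) (Fin V.d) F ≃ₗ[F] _).toLinearMap ∘ₗ V.ρ

theorem HW.dl_apply (x : g) (u) : V.dl P x u = (V.ρ x).mulVec u := rfl

theorem HW.dl_lie (x y : g) : V.dl P ⁅x, y⁆ = V.dl P x * V.dl P y - V.dl P y * V.dl P x := by
  refine LinearMap.ext fun u => ?_
  simp only [lsb, ema, V.dl_apply, V.lie, Matrix.sub_mulVec, Matrix.mulVec_mulVec]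

theorem HW.dl_lie' (x y : g) (u) : V.dl P ⁅x, y⁆ u = V.dl P x (V.dl P y u) - V.dl P y (V.dl P x u) := by rw [V.dl_lie]; rfl

theorem HW.ent {N : g} {i} {a : F} (hN : ⁅P.w i, N⁆ = a • N) {k l} (hk : V.ρ N k l ≠ 0) : (V.wv k i : F) = a + V.wv l i := by
  have h1 := congrFun (congrFun (V.lie (P.w i) N) k) l
  rw [hN, map_smul, V.diag, Matrix.sub_apply, Matrix.diagonal_mul, Matrix.mul_diagonal, xsm, smul_eq_mul] at h1
  have h2 : (a - (V.wv k i - V.wv l i)) * V.ρ N k l = 0 := by rw [sub_mul, h1]; ring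
  have := (mul_eq_zero.1 h2).resolve_right hk
  linear_combination -this

theorem HW.entB {b k l} (hk : V.ρ (P.B b) k l ≠ 0) (i) : V.wv k i = P.wt b i + V.wv l i := by
  exact_mod_cast V.ent P (P.wB i b) hk
theorem HW.entD {b k l} (hk : V.ρ (P.DB b) k l ≠ 0) (i) : V.wv k i = - P.wt b i + V.wv l i := by
  exact_mod_cast V.ent P (P.DB_wt i b) hk

theorem HW.nilp {y N : g} {a : F} (ha : a ≠ 0) (hN : ⁅y, N⁆ = a • N) : IsNilpotent (V.dl P N) :=
  nilp_of_shift (V.dl P y) _ a ha (by rw [← V.dl_lie, hN, map_smul])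

theorem ad_nilp {y N : g} {a : F} (ha : a ≠ 0) (hN : ⁅y, N⁆ = a • N) : IsNilpotent (ad F g N : End F g) :=
  nilp_of_shift (ad F g y : End F g) _ a ha (by
    refine LinearMap.ext fun z => ?_
    simp only [lsb, ema, lsm, adp]
    rw [← lie_lie, hN, smul_lie])

/-- Casimir on the square -/
noncomputable def HW.Om : End F ((Fin V.d → F) ⊗[F] (Fin V.d → F)) := ∑ b, TensorProduct.map (V.dl P (P.B b)) (V.dl P (P.DB b))

theorem HW.Om_tmul (u v) : V.Om P (u ⊗ₜ v) = ∑ b, V.dl P (P.B b) u ⊗ₜ[F] V.dl P (P.DB b) v := by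
  rw [HW.Om, lsu]; rfl

theorem HW.Om_comm (x : g) (z) : DT (V.dl P x) (V.dl P x) (V.Om P z) = V.Om P (DT (V.dl P x) (V.dl P x) z) := by
  induction z with
  | zero => simp
  | add a b ha hb => simp only [map_add, ha, hb]
  | tmul u v =>
    have h1 := P.cas (((TensorProduct.mk F (Fin V.d → F) (Fin V.d → F)).compl₁₂ ((LinearMap.applyₗ u) ∘ₗ V.dl P) ((LinearMap.applyₗ v) ∘ₗ V.dl P))) x
    simp only [LinearMap.compl₁₂_apply, lco, LinearMap.applyₗ_apply_apply, TensorProduct.mk_apply, V.dl_lie', TensorProduct.sub_tmul, TensorProduct.tmul_sub] at h1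
    rw [← sub_eq_zero, ← h1]
    simp only [DT, lad, LinearMap.rTensor_tmul, LinearMap.lTensor_tmul, map_add, V.Om_tmul, map_sum]
    simp only [← sum_add_distrib, ← sum_sub_distrib]
    refine sum_congr rfl fun b _ => ?_
    abel

/-- eigenvalue -/
noncomputable def HW.c : F := ∑ b, V.ρ (P.B b) V.k0 V.k0 * V.ρ (P.DB b) V.k0 V.k0

theorem HW.v_apply (x : g) (k) : V.dl P x (Pi.single V.k0 1) k = V.ρ x k V.k0 := by
  rw [V.dl_apply, Matrix.mulVec_single_one]; rfl

theorem HW.Om_v : V.Om P (Pi.single V.k0 1 ⊗ₜ Pi.single V.k0 1) = V.c P • (Pi.single V.k0 (1 : F) ⊗ₜ Pi.single V.k0 (1 : F)) := by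
  rw [V.Om_tmul, HW.c, sum_smul]
  refine sum_congr rfl fun b _ => ?_
  by_cases h1 : V.dl P (P.B b) (Pi.single V.k0 1) = 0
  · rw [h1, ← V.v_apply, h1]; simp
  by_cases h2 : V.dl P (P.DB b) (Pi.single V.k0 1) = 0
  · rw [h2, ← V.v_apply P (P.DB b), h2]; simp
  obtain ⟨k, hk⟩ := Function.ne_iff.1 h1
  obtain ⟨l, hl⟩ := Function.ne_iff.1 h2
  rw [V.v_apply] at hk hl
  have h3 : ∀ i, P.wt b i = 0 := fun i => by
    have a1 := V.entB P hk i
    have a2 := V.entD P hl i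
    have a3 := V.le k i
    have a4 := V.le l i
    rw [V.top] at a1 a2
    omega
  have h4 : ∀ N : g, (∀ k, V.ρ N k V.k0 ≠ 0 → ∀ i, V.wv k i = lam i) → V.dl P N (Pi.single V.k0 1) = V.ρ N V.k0 V.k0 • Pi.single V.k0 1 := fun N hN => by
    funext k
    rw [V.v_apply]
    by_cases hk : k = V.k0
    · subst hk; simp
    · rw [Pi.smul_apply, Pi.single_eq_of_ne hk, smul_zero]
      by_contra h0
      obtain ⟨i, hi⟩ := V.ne k hk
      exact hi.ne (hN k h0 i)
  rw [h4 _ fun k hk i => by rw [V.entB P hk i, h3, V.top, zero_add], h4 _ fun k hk i => by rw [V.entD P hk i, h3, V.top, neg_zero, zero_add],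
    TensorProduct.smul_tmul_smul]

/-- the cone -/
def HW.Cone (w : Fin V.d → F) : Prop := V.Om P (w ⊗ₜ w) = V.c P • (w ⊗ₜ w)

theorem HW.Cone_nx {N : g} (hN : IsNilpotent (V.dl P N)) {w} (hw : V.Cone P w) : V.Cone P (nx (V.dl P N) w) := by
  have h1 := nx_bil (TensorProduct.mk F (Fin V.d → F) (Fin V.d → F)) hN hN (DT_nilp hN) (fun u v => by simp [DT]) w w
  have h2 := nx_comm (V.Om P) (DT_nilp hN) (DT_nilp hN) (fun z => (V.Om_comm P N z).symm) (w ⊗ₜ w)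
  rw [HW.Cone] at hw ⊢
  rw [TensorProduct.mk_apply, TensorProduct.mk_apply] at h1
  rw [← h1, h2, hw, map_smul]

theorem HW.stab (U : Submodule F (Fin V.d → F)) (he : ∀ i, ∀ u ∈ U, V.dl P (P.ee i) u ∈ U) (hf : ∀ i, ∀ u ∈ U, V.dl P (P.ff i) u ∈ U) (x : g) :
    ∀ u ∈ U, V.dl P x u ∈ U := by
  let L : Submodule F g :=
    { carrier := {x | ∀ u ∈ U, V.dl P x u ∈ U}
      add_mem' := fun {a b} ha hb u hu => by
        rw [map_add]; exact add_mem (ha u hu) (hb u hu)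
      zero_mem' := fun u hu => by simp
      smul_mem' := fun c a ha u hu => by
        rw [map_smul]; exact U.smul_mem c (ha u hu) }
  have hl : ∀ x ∈ L, ∀ y ∈ L, ⁅x, y⁆ ∈ L := fun x hx y hy u hu => by
    rw [V.dl_lie']; exact sub_mem (hx _ (hy _ hu)) (hy _ (hx _ hu))
  have h1 : L = ⊤ := P.gen L (fun k => by
    have h2 : ∑ j, ((Matrix.of P.C).adjugate k j : F) • ⁅P.ee j, P.ff j⁆ = ((Matrix.of P.C).det : F) • P.w k := by
      simp only [P.ef, if_true, smul_sum, smul_smul]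
      rw [sum_comm]
      simp only [← sum_smul]
      have h3 : ∀ l, ∑ j, ((Matrix.of P.C).adjugate k j : F) * (P.C j l : F) = if k = l then ((Matrix.of P.C).det : F) else 0 := fun l => by
        have := congrFun (congrFun (Matrix.adjugate_mul (Matrix.of P.C)) k) l
        rw [Matrix.mul_apply, xsm, Matrix.one_apply] at this
        have := congrArg (Int.cast : ℤ → F) this
        push_cast at this
        rw [show (∑ j, ((Matrix.of P.C).adjugate k j : F) * (P.C j l : F)) = ∑ j, ((Matrix.of P.C).adjugate k j : F) * ((Matrix.of P.C) j l : F) from rfl, this]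
        split_ifs <;> simp
      simp [h3]
    have h4 : ((Matrix.of P.C).det : F) ≠ 0 := Int.cast_ne_zero.2 P.Cdet
    refine (L.smul_mem_iff h4).1 ?_
    rw [← h2]
    exact L.sum_mem fun j _ => L.smul_mem _ (hl _ (he j) _ (hf j))) he hf hl
  exact (h1.symm ▸ Submodule.mem_top : x ∈ L)

theorem HW.wee_nilp (i) (t : F) : IsNilpotent (V.dl P (t • P.ee i)) ∧ IsNilpotent (V.dl P (t • P.ff i)) ∧
    IsNilpotent (ad F g (t • P.ee i) : End F g) ∧ IsNilpotent (ad F g (t • P.ff i) : End F g) := by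
  have h1 : ⁅P.w i, t • P.ee i⁆ = (1 : F) • (t • P.ee i) := by simp [P.we]
  have h2 : ⁅P.w i, t • P.ff i⁆ = (-1 : F) • (t • P.ff i) := by simp [P.wf]
  exact ⟨V.nilp P one_ne_zero h1, V.nilp P (by norm_num) h2, ad_nilp one_ne_zero h1, ad_nilp (by norm_num) h2⟩

/-- sets closed under the elementary exponentials span stable subspaces -/
theorem HW.stab2 (S : Set (Fin V.d → F)) (hS : ∀ w ∈ S, ∀ i (t : F), nx (V.dl P (t • P.ee i)) w ∈ S ∧ nx (V.dl P (t • P.ff i)) w ∈ S) (x : g) :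
    ∀ u ∈ Submodule.span F S, V.dl P x u ∈ Submodule.span F S := by
  refine V.stab P _ (fun i => ?_) (fun i => ?_) x
  · refine (sle.2 fun w hw => ?_ : Submodule.span F S ≤ (Submodule.span F S).comap (V.dl P (P.ee i)))
    have h0 := (V.wee_nilp P i 1).1
    rw [one_smul] at h0
    exact nx_span h0 _ w fun t => sss (by have := (hS w hw i t).1; rwa [map_smul] at this)
  · refine (sle.2 fun w hw => ?_ : Submodule.span F S ≤ (Submodule.span F S).comap (V.dl P (P.ff i)))
    have h0 := (V.wee_nilp P i 1).2.1
    rw [one_smul] at h0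
    exact nx_span h0 _ w fun t => sss (by have := (hS w hw i t).2; rwa [map_smul] at this)

variable [LinearOrder F] [IsOrderedAddMonoid F]
/-- good pairs -/
def HW.K (x : g) (μ : F) (y : g) (w : Fin V.d → F) : Prop := Cj F g x y ∧ V.dl P y w = μ • w ∧ w ≠ 0 ∧ V.Cone P w ∧ 
  ∀ α u, u ≠ 0 → V.dl P y u = α • u → α ≤ μ

theorem HW.K_nx {x : g} {μ : F} {y : g} {w} (hK : V.K P x μ y w) {N : g} (h1 : IsNilpotent (ad F g N : End F g)) (h2 : IsNilpotent (V.dl P N)) :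
    V.K P x μ (nx (ad F g N : End F g) y) (nx (V.dl P N) w) := by
  have h3 : ∀ (N : g) (_ : IsNilpotent (ad F g N : End F g)) (_ : IsNilpotent (V.dl P N)) (y : g) u, nx (V.dl P N) (V.dl P y u) = V.dl P (nx (ad F g N : End F g) y) (nx (V.dl P N) u) := fun N h1 h2 y u =>
    nx_bil (V.dl P) h1 h2 h2 (fun a b => by rw [adp, V.dl_lie']; abel) y u
  obtain ⟨k1, k2, k3, k4, k5⟩ := hK
  refine ⟨k1.trans (Cj.step h1 y), by rw [← h3 N h1 h2, k2, map_smul], fun h0 => k3 ?_, V.Cone_nx P h2 k4, fun α u hu hα => ?_⟩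
  · rw [← nx_neg_apply h2 w, h0, map_zero]
  · refine k5 α (nx (-V.dl P N) u) (fun h0 => hu ?_) ?_
    · rw [← nx_apply_neg h2 u, h0, map_zero]
    · have := h3 (-N) (by rw [map_neg]; exact h1.neg) (by rw [map_neg]; exact h2.neg) (nx (ad F g N : End F g) y) u
      rw [map_neg, map_neg, nx_neg_apply h1, hα, map_smul] at this
      exact this.symm

theorem HW.K_ex (x : g) : ∃ μ y w, V.K P x μ y w ∧ w V.k0 = 1 := by
  classical
  set a := V.dl P x with ha
  haveI : Nontrivial (Fin V.d → F) := ⟨⟨Pi.single V.k0 1, 0, by simp⟩⟩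
  obtain ⟨μ, hμ, hmax⟩ : ∃ μ, a.HasEigenvalue μ ∧ ∀ α, a.HasEigenvalue α → α ≤ μ := by
    obtain ⟨m0, hm0⟩ := Module.End.exists_eigenvalue a
    have hfin : {α | a.HasEigenvalue α}.Finite := Module.End.finite_hasEigenvalue a
    obtain ⟨μ, h1, h2⟩ := Set.exists_max_image _ id hfin ⟨m0, hm0⟩
    exact ⟨μ, h1, h2⟩
  have hne : (⨆ α, ⨆ (_ : α ≠ μ), a.maxGenEigenspace α) ≠ ⊤ := fun htop => by
    have hi := (Module.End.independent_maxGenEigenspace a) μ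
    rw [htop, disjoint_top] at hi
    obtain ⟨v, hv⟩ := hμ.exists_hasEigenvector
    exact hv.2 ((Submodule.mem_bot F).1 (hi ▸ (mge _ _ _).2 ⟨1, by simpa [sub_eq_zero] using hv.apply_eq_smul⟩))
  have hspan : Submodule.span F {w | V.Cone P w} = ⊤ := V.gen _ (V.stab2 P _ fun w hw i t =>
    ⟨V.Cone_nx P (V.wee_nilp P i t).1 hw, V.Cone_nx P (V.wee_nilp P i t).2.1 hw⟩) (sss (V.Om_v P))
  obtain ⟨u, hu, hun⟩ : ∃ u, V.Cone P u ∧ u ∉ ⨆ α, ⨆ (_ : α ≠ μ), a.maxGenEigenspace α := by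
    by_contra! hcon
    exact hne (top_le_iff.1 (hspan ▸ sle.2 hcon))
  obtain ⟨w, hw0, hw, hwU⟩ := max_eig a μ hmax (LinearMap.ker (V.Om P - V.c P • 1)) (fun z hz => by
    rw [LinearMap.mem_ker, lsb, sub_eq_zero] at hz ⊢
    rw [← V.Om_comm, hz]; exact map_smul (DT (V.dl P x) (V.dl P x)) (V.c P) z) u (by
      rw [LinearMap.mem_ker, lsb, sub_eq_zero]; exact hu) hun
  have hK : V.K P x μ x w := ⟨Cj.refl _, hw, hw0, by
    rw [LinearMap.mem_ker, lsb, sub_eq_zero] at hwU; exact hwU, fun α u hu hα =>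
    hmax α (Module.End.hasEigenvalue_of_hasEigenvector (x := u) ⟨mei.2 hα, hu⟩)⟩
  obtain ⟨y, w', hK', h0⟩ : ∃ y w', V.K P x μ y w' ∧ w' V.k0 ≠ 0 := by
    by_contra! hcon
    refine hw0 ?_
    have hb := V.nd (Submodule.span F {w | ∃ y, V.K P x μ y w}) (V.stab2 P _ fun w ⟨y, hw⟩ i t => ?_) ?_
    · have : w ∈ Submodule.span F {w | ∃ y, V.K P x μ y w} := sss ⟨x, hK⟩
      rw [hb] at this; exact (Submodule.mem_bot F).1 this
    · obtain ⟨n1, n2, n3, n4⟩ := V.wee_nilp P i t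
      exact ⟨⟨_, V.K_nx P hw n3 n1⟩, ⟨_, V.K_nx P hw n4 n2⟩⟩
    · exact (sle.2 fun w ⟨y, hw⟩ => hcon y w hw : Submodule.span F {w | ∃ y, V.K P x μ y w} ≤ LinearMap.ker (LinearMap.proj V.k0 : (Fin V.d → F) →ₗ[F] F))
  obtain ⟨k1, k2, k3, k4, k5⟩ := hK'
  refine ⟨μ, y, (w' V.k0)⁻¹ • w', ⟨k1, by rw [map_smul, k2, smul_comm], smul_ne_zero (inv_ne_zero h0) k3, ?_, k5⟩, by simp [h0]⟩
  rw [HW.Cone] at k4 ⊢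
  rw [TensorProduct.smul_tmul_smul, map_smul, k4, smul_comm]
end cas

section cas2
open Finset
theorem PD.tl {F : Type*} [Field F] {g : Type*} [LieRing g] [LieAlgebra F g] {e h f : g} (P : PD F e h f) (j : Fin P.r) (t : Fin P.r → F) : ⁅∑ i, t i • P.w i, P.ee j⁆ = t j • P.ee j := by
  rw [sum_lie]; simp [P.we]

variable {F : Type*} [Field F] [CharZero F] [IsAlgClosed F] {g : Type*} [LieRing g] [LieAlgebra F g] [FiniteDimensional F g] [LieAlgebra.IsKilling F g] {e h f : g}
  (P : PD F e h f)

theorem PD.kf_hh (i) : ∃ n : ℕ, killingForm F g ⁅P.ee i, P.ff i⁆ ⁅P.ee i, P.ff i⁆ = n := by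
  refine ⟨(∑ b, (∑ k, P.C i k * P.wt b k) ^ 2).toNat, ?_⟩
  have h1 : ∀ b, ⁅⁅P.ee i, P.ff i⁆, P.B b⁆ = ((∑ k, P.C i k * P.wt b k : ℤ) : F) • P.B b := fun b => by
    rw [P.ef, if_pos rfl, sum_lie]; push_cast; rw [sum_smul]
    exact sum_congr rfl fun k _ => by rw [smul_lie, P.wB, smul_smul]
  rw [killingForm_apply_apply, LinearMap.trace_eq_matrix_trace F P.B, Matrix.trace]
  have h2 : (((∑ b, (∑ k, P.C i k * P.wt b k) ^ 2).toNat : ℤ)) = ∑ b, (∑ k, P.C i k * P.wt b k) ^ 2 := Int.toNat_of_nonneg (sum_nonneg fun _ _ => sq_nonneg _)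
  rw [← Int.cast_natCast, h2]
  rw [Int.cast_sum]
  refine sum_congr rfl fun b _ => ?_
  rw [Matrix.diag_apply, LinearMap.toMatrix_apply, lco, adp, adp, h1, lie_smul, h1, smul_smul]
  simp [sq]

variable {lam : Fin P.r → ℤ} (V : HW P lam)

theorem HW.tau (hl : ∀ j, ∑ k, P.C j k * lam k = 2) : ∃ τ : Fin P.r → ℚ, (∀ i, 0 < τ i) ∧ ∑ b, V.ρ (P.DB b) V.k0 V.k0 • P.B b = ∑ i, (τ i : F) • P.w i := by
  set t := ∑ b, V.ρ (P.DB b) V.k0 V.k0 • P.B b with ht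
  have hk : ∀ y, killingForm F g t y = V.ρ y V.k0 V.k0 := fun y => by
    conv_rhs => rw [← P.DB.sum_repr y, map_sum, xsu]
    rw [ht, map_sum, lsu]
    refine sum_congr rfl fun b _ => ?_
    rw [map_smul, map_smul, lsm, xsm, P.DB_repr, kf_sym, smul_eq_mul, smul_eq_mul, mul_comm]
  have h0 : ⁅h, t⁆ = 0 := by
    rw [ht, lie_sum]
    refine sum_eq_zero fun b _ => ?_
    rw [lie_smul, P.hB]
    by_cases hb : V.ρ (P.DB b) V.k0 V.k0 = 0
    · rw [hb, zero_smul]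
    · have : P.ht b = 0 := sum_eq_zero fun i _ => by have := V.entD P hb i; omega
      simp [this]
  obtain ⟨s, hs⟩ := (mse F).1 (P.w_span t h0)
  have h1 : ∀ i, s i * killingForm F g (P.ee i) (P.ff i) = 2 := fun i => by
    have a1 := hk ⁅P.ee i, P.ff i⁆
    rw [← kf_inv, ← hs, P.tl, map_smul, lsm, smul_eq_mul, P.ef, if_pos rfl, map_sum, xsu] at a1
    rw [a1, ← Int.cast_ofNat (R := F) 2, ← hl i, Int.cast_sum]
    exact sum_congr rfl fun k _ => by rw [map_smul, V.diag, xsm, Matrix.diagonal_apply_eq, V.top]; push_cast; rfl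
  choose n hn using P.kf_hh
  have h2 : ∀ i, s i * n i = 4 := fun i => by
    rw [← hn, ← kf_inv]
    conv_lhs => rw [show ⁅⁅P.ee i, P.ff i⁆, P.ee i⁆ = (2 : F) • P.ee i by rw [P.ef, if_pos rfl, P.tl, P.Cii]; norm_num]
    rw [map_smul, lsm, smul_eq_mul]
    linear_combination 2 * h1 i
  have h3 : ∀ i, n i ≠ 0 := fun i h => by have := h2 i; rw [h] at this; norm_num at this
  refine ⟨fun i => 4 / n i, fun i => div_pos (by norm_num) (Nat.cast_pos.2 (Nat.pos_of_ne_zero (h3 i))), ?_⟩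
  rw [← hs]
  refine sum_congr rfl fun i _ => ?_
  have : (n i : F) ≠ 0 := Nat.cast_ne_zero.2 (h3 i)
  rw [eq_div_of_mul_eq this (h2 i)]
  push_cast; rfl

/-- depth -/
def HW.hv (k : Fin V.d) : ℤ := ∑ i, (lam i - V.wv k i)
theorem HW.hv_pos {k} (hk : k ≠ V.k0) : 0 < V.hv P k := by
  obtain ⟨i, hi⟩ := V.ne k hk
  exact sum_pos' (fun i _ => sub_nonneg.2 (V.le k i)) ⟨i, mem_univ i, sub_pos.2 hi⟩
theorem HW.hv0 : V.hv P V.k0 = 0 := by simp [HW.hv, V.top]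
theorem HW.hvB {b k l} (hk : V.ρ (P.B b) k l ≠ 0) : V.hv P k = V.hv P l - P.ht b := by
  rw [HW.hv, HW.hv, PD.ht, ← sum_sub_distrib]; exact sum_congr rfl fun i _ => by rw [V.entB P hk]; ring
theorem HW.hvD {b k l} (hk : V.ρ (P.DB b) k l ≠ 0) : V.hv P k = V.hv P l + P.ht b := by
  rw [HW.hv, HW.hv, PD.ht, ← sum_add_distrib]; exact sum_congr rfl fun i _ => by rw [V.entD P hk]; ring

/-- filtration -/
def HW.W (j : ℤ) : Submodule F (Fin V.d → F) where
  carrier := {z | ∀ k, V.hv P k < j → z k = 0}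
  add_mem' := fun ha hb k hk => by simp [ha k hk, hb k hk]
  zero_mem' := fun k _ => rfl
  smul_mem' := fun c a ha k hk => by simp [ha k hk]

theorem HW.mvz {M : Matrix (Fin V.d) (Fin V.d) F} {u : Fin V.d → F} {k} (hM : ∀ l, M k l ≠ 0 → u l = 0) : M.mulVec u k = 0 := by
  change ∑ l, M k l * u l = 0
  refine sum_eq_zero fun l _ => ?_
  by_cases h0 : M k l = 0
  · rw [h0, zero_mul]
  · rw [hM l h0, mul_zero]

theorem HW.W_shift {m j : ℤ} {y : g} (hy : ∀ b, P.B.repr y b ≠ 0 → P.ht b = -m) {z} (hz : z ∈ V.W P j) : V.dl P y z ∈ V.W P (j + m) := by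
  rw [← P.B.sum_repr y, map_sum, lsu]
  refine sum_mem fun b _ => ?_
  by_cases h0 : P.B.repr y b = 0
  · rw [h0, zero_smul, map_zero]; exact zero_mem _
  · rw [map_smul]
    exact ssm _ _ fun k hk => V.mvz P fun l hl => hz l (by have := V.hvB P hl; have := hy b h0; omega)

variable [LinearOrder F] [IsOrderedAddMonoid F]

theorem HW.K_step (hl : ∀ j, ∑ k, P.C j k * lam k = 2) {x : g} {μ : F} {y w} (hK : V.K P x μ y w) {m : ℤ} (hm : 1 ≤ m) (hw : w - Pi.single V.k0 1 ∈ V.W P m) :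
    ∃ y' w', V.K P x μ y' w' ∧ w' - Pi.single V.k0 1 ∈ V.W P (m + 1) := by
  classical
  obtain ⟨τ, τp, hτ⟩ := V.tau P hl
  set v : Fin V.d → F := Pi.single V.k0 1 with hv
  set u := w - v with hu
  have hwe : w = v + u := by rw [hu]; abel
  have hu0 : u V.k0 = 0 := hw _ (by rw [V.hv0]; omega)
  let th : (Fin P.r → ℤ) → F := fun a => ∑ i, (τ i : F) * a i
  have hth : ∀ k l, V.ρ (∑ b, V.ρ (P.DB b) V.k0 V.k0 • P.B b) k l = if k = l then th (V.wv k) else 0 := fun k l => by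
    rw [hτ, map_sum, xsu]
    simp only [map_smul, V.diag, xsm, Matrix.diagonal_apply]
    split_ifs with hkl
    · rfl
    · simp
  have key : ∀ k, V.hv P k = m → ∑ b, V.dl P (P.DB b) u V.k0 * V.ρ (P.B b) k V.k0 = (th lam - th (V.wv k)) * u k := fun k hk => by
    have hkk : k ≠ V.k0 := fun h0 => by rw [h0, V.hv0] at hk; omega
    have h1 : V.Cone P w := hK.2.2.2.1
    rw [HW.Cone, V.Om_tmul] at h1
    have h2 := congrArg (LinearMap.mul' F F ∘ₗ TensorProduct.map (LinearMap.proj k) (LinearMap.proj V.k0)) h1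
    simp only [map_sum, map_smul, lco, TensorProduct.map_tmul, LinearMap.mul'_apply, LinearMap.proj_apply] at h2
    have hwk : w k = u k := by rw [hwe, Pi.add_apply, hv, Pi.single_eq_of_ne hkk, zero_add]
    have hw0 : w V.k0 = 1 := by rw [hwe, Pi.add_apply, hu0, hv]; simp
    have hc : V.c P = th lam := by
      have := hth V.k0 V.k0
      rw [if_pos rfl, V.top, map_sum, xsu] at this
      rw [← this, HW.c]
      exact sum_congr rfl fun b _ => by rw [map_smul, xsm, smul_eq_mul, mul_comm]
    have h3 : ∑ b, V.ρ (P.DB b) V.k0 V.k0 * V.dl P (P.B b) u k = th (V.wv k) * u k := by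
      have : ∑ b, V.ρ (P.DB b) V.k0 V.k0 * V.dl P (P.B b) u k = V.dl P (∑ b, V.ρ (P.DB b) V.k0 V.k0 • P.B b) u k := by
        rw [map_sum, lsu, Finset.sum_apply]; simp only [map_smul, lsm, Pi.smul_apply, smul_eq_mul]
      rw [this, V.dl_apply, Matrix.mulVec, dotProduct]
      simp [hth]
    rw [hw0, mul_one, hwk, hc] at h2
    rw [sub_mul, smul_eq_mul] at *
    rw [← h2, ← h3, ← sum_sub_distrib]
    refine sum_congr rfl fun b _ => ?_
    rw [hwe, map_add, map_add, Pi.add_apply, Pi.add_apply, hv, V.v_apply, V.v_apply]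
    have e1 : V.ρ (P.B b) k V.k0 * V.ρ (P.DB b) V.k0 V.k0 = 0 := by
      by_contra h0
      have a1 := V.hvB P (left_ne_zero_of_mul h0)
      have a2 := V.hvD P (right_ne_zero_of_mul h0)
      rw [V.hv0] at a1 a2
      omega
    have e2 : V.dl P (P.B b) u k * V.dl P (P.DB b) u V.k0 = 0 := by
      by_cases hb : 0 ≤ P.ht b
      · rw [V.dl_apply P (P.DB b), V.mvz P fun l hl => hw l ?_, mul_zero]
        have := V.hvD P hl; rw [V.hv0] at this; omega
      · rw [V.dl_apply P (P.B b), V.mvz P fun l hl => hw l ?_, zero_mul]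
        have := V.hvB P hl; omega
    linear_combination - e1 - e2
  have thp : ∀ k, k ≠ V.k0 → th lam - th (V.wv k) ≠ 0 := fun k hk => by
    have h1 : th lam - th (V.wv k) = ((∑ i, τ i * (lam i - V.wv k i : ℤ) : ℚ) : F) := by
      simp only [th]; rw [← sum_sub_distrib]; push_cast; exact sum_congr rfl fun i _ => by ring
    rw [h1, Rat.cast_ne_zero]
    obtain ⟨i, hi⟩ := V.ne k hk
    exact (sum_pos' (fun i _ => mul_nonneg (τp i).le (by exact_mod_cast sub_nonneg.2 (V.le k i))) ⟨i, mem_univ i, mul_pos (τp i) (by exact_mod_cast sub_pos.2 hi)⟩).ne'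
  let y' : g := ∑ b, (if P.ht b = -m then V.dl P (P.DB b) u V.k0 * (-th (P.wt b))⁻¹ else 0) • P.B b
  have hy' : ∀ b, P.B.repr y' b = if P.ht b = -m then V.dl P (P.DB b) u V.k0 * (-th (P.wt b))⁻¹ else 0 := fun b => by
    rw [P.B.repr_sum_self]
  have hym : ∀ b, P.B.repr y' b ≠ 0 → P.ht b = -m := fun b hb => by
    rw [hy'] at hb; by_contra h0; exact hb (if_neg h0)
  have hhy : ⁅h, y'⁆ = ((2 * (-m) : ℤ) : F) • y' := by
    rw [lie_sum, smul_sum]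
    refine sum_congr rfl fun b _ => ?_
    split_ifs with hb
    · rw [lie_smul, P.hB, hb, smul_comm]
    · simp
  have hyv : ∀ k, V.hv P k ≤ m → V.dl P y' v k = u k := fun k hk => by
    rw [hv, V.v_apply, map_sum, xsu]
    simp only [map_smul, xsm, smul_eq_mul]
    rcases hk.lt_or_eq with hk | hk
    · rw [hw k hk]
      refine sum_eq_zero fun b _ => ?_
      by_contra h0
      have a1 := V.hvB P (right_ne_zero_of_mul h0)
      rw [V.hv0] at a1
      rw [if_neg (by omega), zero_mul] at h0
      exact h0 rfl
    · have hkk : k ≠ V.k0 := fun h0 => by rw [h0, V.hv0] at hk; omega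
      rw [← mul_right_inj' (thp k hkk), ← key k hk, mul_sum]
      refine sum_congr rfl fun b _ => ?_
      by_cases h0 : V.ρ (P.B b) k V.k0 = 0
      · rw [h0]; ring
      have a1 := V.hvB P h0
      rw [V.hv0] at a1
      rw [if_pos (by omega)]
      have a2 : -th (P.wt b) = th lam - th (V.wv k) := by
        simp only [th]; rw [← sum_neg_distrib, ← sum_sub_distrib]
        exact sum_congr rfl fun i _ => by rw [V.entB P h0, V.top]; push_cast; ring
      rw [a2]
      field_simp [thp k hkk]
  have hm0 : ((2 * (-m) : ℤ) : F) ≠ 0 := Int.cast_ne_zero.2 (by omega)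
  have n1 : IsNilpotent (ad F g (-y') : End F g) := ad_nilp hm0 (by rw [lie_neg, hhy, smul_neg])
  have n2 : IsNilpotent (V.dl P (-y')) := V.nilp P hm0 (by rw [lie_neg, hhy, smul_neg])
  have hsh : ∀ j, ∀ z ∈ V.W P j, V.dl P (-y') z ∈ V.W P (j + m) := fun j z hz => V.W_shift P (fun b hb => hym b (by simpa using hb)) hz
  have mono : ∀ {i j : ℤ}, i ≤ j → V.W P j ≤ V.W P i := fun hij z hz k hk => hz k (by omega)
  have all0 : ∀ z, z ∈ V.W P 0 := fun z k hk => by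
    by_cases h0 : k = V.k0
    · rw [h0, V.hv0] at hk; omega
    · have := V.hv_pos P h0; omega
  refine ⟨_, _, V.K_nx P hK n1 n2, ?_⟩
  have hp : ∀ j : ℕ, ((V.dl P (-y')) ^ (j + 2)) w ∈ V.W P (m + 1) := fun j => by
    induction j with
    | zero => rw [zero_add, pow_two, ema]; exact mono (by omega) (hsh _ _ (hsh _ _ (all0 w)))
    | succ j ih => rw [show j + 1 + 2 = j + 2 + 1 by ring, pow_succ', ema]; exact mono (by omega) (hsh _ _ ih)
  have h1 := nx_sub2 n2 _ w hp
  have h2 : w + V.dl P (-y') w - v ∈ V.W P (m + 1) := by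
    have : w + V.dl P (-y') w - v = (u - V.dl P y' v) + V.dl P (-y') u := by
      rw [hwe]; simp only [map_neg, map_add, LinearMap.neg_apply]; abel
    rw [this]
    exact add_mem (fun k hk => by rw [Pi.sub_apply, hyv k (by omega), sub_self]) (mono (by omega) (hsh _ _ hw))
  have h3 := add_mem h1 h2
  convert h3 using 1
  abel

theorem HW.K_v (hl : ∀ j, ∑ k, P.C j k * lam k = 2) (x : g) : ∃ μ y, V.K P x μ y (Pi.single V.k0 1) := by
  obtain ⟨μ, y, w, hK, h0⟩ := V.K_ex P x
  have h1 : ∀ m : ℕ, ∃ y w, V.K P x μ y w ∧ w - Pi.single V.k0 1 ∈ V.W P (m + 1) := fun m => by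
    induction m with
    | zero =>
      refine ⟨y, w, hK, fun k hk => ?_⟩
      have : k = V.k0 := by
        by_contra h1
        have := V.hv_pos P h1; push_cast at hk; omega
      rw [this]; simp [h0]
    | succ m ih =>
      obtain ⟨y, w, h1, h2⟩ := ih
      have := V.K_step P hl h1 (by omega) h2
      push_cast; exact this
  obtain ⟨y, w, h2, h3⟩ := h1 (∑ k, V.hv P k).toNat
  refine ⟨μ, y, ?_⟩
  have : w = Pi.single V.k0 1 := by
    rw [← sub_eq_zero]
    funext k
    refine h3 k ?_
    have hp : ∀ k, 0 ≤ V.hv P k := fun k => sum_nonneg fun i _ => sub_nonneg.2 (V.le k i)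
    have := single_le_sum (fun k _ => hp k) (mem_univ k)
    have := Int.self_le_toNat (∑ k, V.hv P k)
    omega
  rwa [this] at h2
end cas2

theorem Cj.cent_le {F L : Type*} [Field F] [CharZero F] [LieRing L] [LieAlgebra F L] [FiniteDimensional F L] {x y : L} (hc : Cj F L x y) :
    finrank F (cent F L x) ≤ finrank F (cent F L y) := by
  induction hc with
  | refl => exact le_rfl
  | tail _ hs ih =>
    obtain ⟨N, hN, rfl⟩ := hs
    refine ih.trans ?_
    refine LinearMap.finrank_le_finrank_of_injective (f := ((nx (ad F L N : End F L)) ∘ₗ (cent F L _).subtype).codRestrict (cent F L _) fun z => ?_) ?_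
    · rw [mem_cent, lco, ← nx_lie hN, Submodule.subtype_apply, mem_cent.1 z.2, map_zero]
    · intro a b hab
      have h1 := congrArg (fun z : cent F L _ => nx (-(ad F L N : End F L)) z.1) hab
      simp only [LinearMap.codRestrict_apply, lco, nx_neg_apply hN] at h1
      exact Subtype.ext h1

section gf
open Finset
variable {F : Type*} [Field F] [CharZero F] [IsAlgClosed F] {g : Type*} [LieRing g] [LieAlgebra F g] {e h f : g}
  (P : PD F e h f)

/-- heights at least k -/
def PD.G (k : ℤ) : Submodule F g where
  carrier := {x | ∀ b, P.ht b < k → P.B.repr x b = 0}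
  add_mem' := fun ha hb b hk => by simp [ha b hk, hb b hk]
  zero_mem' := fun b _ => by simp
  smul_mem' := fun c a ha b hk => by simp [ha b hk]

theorem PD.G_mono {k l : ℤ} (hk : k ≤ l) : P.G l ≤ P.G k := fun x hx b hb => hx b (by omega)
theorem PD.G_B {k : ℤ} {b} (hb : k ≤ P.ht b) : P.B b ∈ P.G k := fun c hc => by
  rw [P.B.repr_self, Finsupp.single_apply, if_neg]; rintro rfl; omega
theorem PD.G_hom {m k : ℤ} {x : g} (hx : ⁅h, x⁆ = ((2 * m : ℤ) : F) • x) (hk : k ≤ m) : x ∈ P.G k := fun b hb => by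
  by_contra h0; have := P.repr_h hx h0; omega
theorem PD.G_lie {k l : ℤ} {x y : g} (hx : x ∈ P.G k) (hy : y ∈ P.G l) : ⁅x, y⁆ ∈ P.G (k + l) := by
  rw [← P.B.sum_repr x, ← P.B.sum_repr y, sum_lie]
  refine sum_mem fun a _ => ?_
  rw [lie_sum]
  refine sum_mem fun b _ => ?_
  rw [smul_lie, lie_smul]
  by_cases h1 : P.B.repr x a = 0
  · rw [h1, zero_smul]; exact zero_mem _
  by_cases h2 : P.B.repr y b = 0
  · rw [h2, zero_smul, smul_zero]; exact zero_mem _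
  have h3 : k ≤ P.ht a := by by_contra h; exact h1 (hx a (by omega))
  have h4 : l ≤ P.ht b := by by_contra h; exact h2 (hy b (by omega))
  refine ssm _ _ (ssm _ _ fun c hc => ?_)
  by_contra h0
  have := P.ht_add h0; omega
theorem PD.G_pr {k : ℤ} {x : g} (hx : x ∈ P.G k) : x - P.pr k x ∈ P.G (k + 1) := fun b hb => by
  rw [map_sub, Finsupp.sub_apply, P.repr_pr]
  split_ifs with h1
  · exact sub_self _
  · rw [hx b (by omega), sub_zero]
theorem PD.pr_G {k m : ℤ} {x : g} (hx : x ∈ P.G k) (hm : m < k) : P.pr m x = 0 := by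
  refine P.B.repr.injective (Finsupp.ext fun b => ?_)
  rw [P.repr_pr, map_zero]
  split_ifs with h1
  · exact hx b (by omega)
  · rfl
theorem PD.pr0 (x : g) : ∃ c : Fin P.r → F, P.pr 0 x = ∑ i, c i • P.w i := by
  have h1 := P.h_pr 0 x
  rw [mul_zero, Int.cast_zero, zero_smul] at h1
  obtain ⟨c, hc⟩ := (mse F).1 (P.w_span _ h1)
  exact ⟨c, hc.symm⟩
theorem PD.pr1 (x : g) : ∃ a : Fin P.r → F, P.pr 1 x = ∑ i, a i • P.ee i := by
  obtain ⟨y, hy, hxy⟩ := P.pt.e_surj 2 _ (by norm_num) (P.h_pr 1 x)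
  rw [sub_self, Int.cast_zero, zero_smul] at hy
  obtain ⟨c, hc⟩ := (mse F).1 (P.w_span _ hy)
  refine ⟨fun i => - c i, ?_⟩
  rw [← hxy, ← lie_skew e y, ← hc]
  have : ⁅∑ i, c i • P.w i, e⁆ = ⁅∑ i, c i • P.w i, ∑ i, P.ee i⁆ := congrArg (fun t => ⁅∑ i, c i • P.w i, t⁆) P.e_eq
  rw [this, lie_sum, ← sum_neg_distrib]
  exact sum_congr rfl fun j _ => by rw [P.tl, neg_smul]
theorem PD.wfh (P : PD F e h f) (i) : ⁅h, P.ff i⁆ = ((2 * (-1) : ℤ) : F) • P.ff i := by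
  have : ⁅h, P.ff i⁆ = ⁅(2 : F) • ∑ i, P.w i, P.ff i⁆ := congrArg (fun t => ⁅t, P.ff i⁆) P.h_eq
  rw [this, smul_lie, sum_lie]; simp [P.wf]
theorem PD.weh (P : PD F e h f) (i) : ⁅h, P.ee i⁆ = ((2 * 1 : ℤ) : F) • P.ee i := by
  have : ⁅h, P.ee i⁆ = ⁅(2 : F) • ∑ i, P.w i, P.ee i⁆ := congrArg (fun t => ⁅t, P.ee i⁆) P.h_eq
  rw [this, smul_lie, sum_lie]; simp [P.we]
theorem PD.tf (j : Fin P.r) (t : Fin P.r → F) : ⁅∑ i, t i • P.w i, P.ff j⁆ = - t j • P.ff j := by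
  rw [sum_lie]; simp [P.wf]
theorem PD.ff0 (j : Fin P.r) : P.ff j ≠ 0 := fun h0 => P.ee0 j (by
  have h1 := P.ef j j
  rw [h0, lie_zero, if_pos rfl] at h1
  have h2 := P.tl j fun k => (P.C j k : F)
  rw [← h1, zero_lie, P.Cii] at h2
  simpa using h2.symm)
theorem PD.G_w (t : Fin P.r → F) : ∑ i, t i • P.w i ∈ P.G 0 :=
  sum_mem fun i _ => ssm _ _ (P.G_hom (m := 0) (by simp [P.hw i]) le_rfl)
theorem PD.r_cent [FiniteDimensional F g] (P : PD F e h f) : finrank F (cent F g h) = P.r := by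
  have : cent F g h = Submodule.span F (Set.range P.w) := le_antisymm (fun y hy => P.w_span y (mem_cent.1 hy))
    (sle.2 (by rintro _ ⟨i, rfl⟩; exact mem_cent.2 (P.hw i)))
  rw [this, finrank_span_eq_card P.li, Fintype.card_fin]

/-- small centralizer gives nonzero simple coefficients -/
theorem PD.reg_coef [FiniteDimensional F g] {y : g} {c a : Fin P.r → F} (hr : finrank F (cent F g y) ≤ P.r)
    (hy : y - ∑ i, c i • P.w i - ∑ i, a i • P.ee i ∈ P.G 2) (i) (hi : c i = 0) : a i ≠ 0 := fun ha => by
  have hE : ∑ i, a i • P.ee i ∈ P.G 1 := sum_mem fun j _ => ssm _ _ (P.G_hom (P.weh j) le_rfl)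
  have hy1 : y - ∑ i, c i • P.w i ∈ P.G 1 := by
    have := add_mem (P.G_mono (by norm_num : (1 : ℤ) ≤ 2) hy) hE
    rwa [sub_add_cancel] at this
  have hG0 : ∀ x ∈ P.G 1, ⁅y, x⁆ ∈ P.G 1 := fun x hx => by
    have h1 := P.G_lie (P.G_w c) hx
    have h2 := P.G_mono (by norm_num : (1 : ℤ) ≤ 1 + 1) (P.G_lie hy1 hx)
    rw [zero_add] at h1
    have := add_mem h1 h2
    rwa [← add_lie, add_sub_cancel] at this
  have hww : ∀ s : Fin P.r → F, ⁅y, ∑ i, s i • P.w i⁆ ∈ P.G 1 := fun s => by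
    have h1 := P.G_lie hy1 (P.G_w s)
    have h0 : ⁅∑ i, c i • P.w i, ∑ i, s i • P.w i⁆ = 0 := P.pt.comm0 _ _ (by simp [lie_sum, P.hw]) (by simp [lie_sum, P.hw])
    rwa [sub_lie, h0, sub_zero, add_zero] at h1
  have hff : ⁅y, P.ff i⁆ ∈ P.G 1 := by
    have h1 := P.G_lie hy (P.G_hom (P.wfh i) le_rfl)
    have h2 : ⁅∑ i, a i • P.ee i, P.ff i⁆ = 0 := by
      rw [sum_lie]; refine sum_eq_zero fun j _ => ?_
      by_cases hj : j = i
      · rw [hj, ha, zero_smul, zero_lie]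
      · rw [smul_lie, P.ef, if_neg hj, smul_zero]
    rw [sub_lie, sub_lie, h2, P.tf, hi, neg_zero, zero_smul, sub_zero, sub_zero] at h1
    exact h1
  let Φ : (P.G 1 × (Fin P.r → F) × F) →ₗ[F] g := LinearMap.coprod (P.G 1).subtype (LinearMap.coprod (Fintype.linearCombination F P.w) (LinearMap.toSpanSingleton F g (P.ff i)))
  have hΦ : ∀ n s t, Φ (n, s, t) = n.1 + (∑ i, s i • P.w i + t • P.ff i) := fun n s t => by simp [Φ, Fintype.linearCombination_apply]
  have hinj : ∀ q, Φ q = 0 → q = 0 := by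
    rintro ⟨n, s, t⟩ h0
    rw [hΦ] at h0
    have hs : ⁅h, ∑ i, s i • P.w i⁆ = ((2 * 0 : ℤ) : F) • ∑ i, s i • P.w i := by simp [lie_sum, P.hw]
    have ht : ⁅h, t • P.ff i⁆ = ((2 * (-1) : ℤ) : F) • t • P.ff i := by rw [lie_smul, P.wfh, smul_comm]
    have h1 := congrArg (P.pr (-1)) h0
    rw [map_add, map_add, map_zero, P.pr_G n.2 (by norm_num), P.pr_hom hs, P.pr_hom ht, if_neg (by norm_num), if_pos rfl, zero_add, zero_add, smul_eq_zero] at h1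
    have t0 : t = 0 := h1.resolve_right (P.ff0 i)
    have h2 := congrArg (P.pr 0) h0
    rw [map_add, map_add, map_zero, P.pr_G n.2 (by norm_num), P.pr_hom hs, if_pos rfl, t0, zero_smul, map_zero, zero_add, add_zero] at h2
    have s0 : s = 0 := funext (Fintype.linearIndependent_iff.1 P.li s h2)
    rw [h2, t0, zero_smul, add_zero, add_zero] at h0
    rw [s0, t0, (Subtype.ext h0 : n = 0)]; rfl
  let Ψ : (P.G 1 × (Fin P.r → F) × F) →ₗ[F] P.G 1 := ((ad F g y : End F g) ∘ₗ Φ).codRestrict (P.G 1) fun q => by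
    obtain ⟨n, s, t⟩ := q
    rw [lco, hΦ, adp, lie_add, lie_add, lie_smul]
    exact add_mem (hG0 _ n.2) (add_mem (hww s) (ssm _ _ hff))
  have h1 := Ψ.finrank_range_add_finrank_ker
  have h2 : finrank F (LinearMap.range Ψ) ≤ finrank F (P.G 1) := Submodule.finrank_le _
  rw [Module.finrank_prod, Module.finrank_prod, Module.finrank_fin_fun, Module.finrank_self] at h1
  have h3 : finrank F (LinearMap.ker Ψ) ≤ finrank F (cent F g y) := by
    refine LinearMap.finrank_le_finrank_of_injective (f := (Φ ∘ₗ (LinearMap.ker Ψ).subtype).codRestrict (cent F g y) fun q => ?_) ?_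
    · exact mem_cent.2 (congrArg Subtype.val q.2)
    · refine (injective_iff_map_eq_zero _).2 fun q hq => ?_
      exact Subtype.ext (hinj _ (congrArg Subtype.val hq))
  omega
end gf

section nf
open Finset
variable {F : Type*} [Field F] [CharZero F] [IsAlgClosed F] {g : Type*} [LieRing g] [LieAlgebra F g] [FiniteDimensional F g] [LieAlgebra.IsKilling F g] {e h f : g}
  (P : PD F e h f) {lam : Fin P.r → ℤ} (V : HW P lam)

theorem HW.posv {z : g} (hz : z ∈ P.G 0) : V.dl P z (Pi.single V.k0 1) = V.ρ z V.k0 V.k0 • Pi.single V.k0 1 := by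
  funext k
  rw [V.v_apply]
  by_cases hk : k = V.k0
  · subst hk; simp
  rw [Pi.smul_apply, Pi.single_eq_of_ne hk, smul_zero, ← P.B.sum_repr z, map_sum, xsu]
  refine sum_eq_zero fun b _ => ?_
  rw [map_smul, xsm, smul_eq_mul]
  by_contra h0
  have h1 := V.hvB P (right_ne_zero_of_mul h0)
  have h2 := V.hv_pos P hk
  rw [V.hv0] at h1
  exact left_ne_zero_of_mul h0 (hz b (by omega))

theorem HW.hv2 (hl : ∀ j, ∑ k, P.C j k * lam k = 2) (j) : V.dl P ⁅P.ee j, P.ff j⁆ (Pi.single V.k0 1) = (2 : F) • Pi.single V.k0 1 := by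
  rw [P.ef, if_pos rfl, V.posv P (P.G_w _), map_sum, xsu]
  congr 1
  rw [← Int.cast_ofNat (R := F) 2, ← hl j, Int.cast_sum]
  exact sum_congr rfl fun k _ => by rw [map_smul, V.diag, xsm, Matrix.diagonal_apply_eq, V.top]; push_cast; rfl

theorem HW.kill (hl : ∀ j, ∑ k, P.C j k * lam k = 2) (m : ℕ) : ∀ z : g, ⁅h, z⁆ = ((2 * (-(m + 1)) : ℤ) : F) • z → V.dl P z (Pi.single V.k0 1) = 0 → z = 0 := by
  induction m with
  | zero =>
    intro z hz h0
    obtain ⟨y, hy, hzy⟩ := P.pt.f_surj _ z (by norm_num) hz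
    norm_num at hy
    obtain ⟨c, hc⟩ := (mse F).1 (P.w_span _ hy)
    have h1 : z = ∑ j, (c j * P.d j) • P.ff j := by
      rw [← hzy, ← lie_skew f y, ← hc]
      have : ⁅∑ i, c i • P.w i, f⁆ = ⁅∑ i, c i • P.w i, ∑ i, P.d i • P.ff i⁆ := congrArg (fun t => ⁅∑ i, c i • P.w i, t⁆) P.f_eq
      rw [this, lie_sum, ← sum_neg_distrib]
      exact sum_congr rfl fun j _ => by rw [lie_smul, P.tf, smul_smul, ← neg_smul]; congr 1; ring
    have h2 : ∀ j, c j * P.d j = 0 := fun j => by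
      have h3 : ⁅P.ee j, z⁆ = (c j * P.d j) • ⁅P.ee j, P.ff j⁆ := by
        rw [h1, lie_sum, sum_eq_single j, lie_smul]
        · intro i _ hi; rw [lie_smul, P.ef, if_neg (Ne.symm hi), smul_zero]
        · simp
      have h4 := V.dl_lie' P (P.ee j) z (Pi.single V.k0 1)
      rw [h0, show V.dl P (P.ee j) (Pi.single V.k0 1) = 0 from V.hi j, map_zero, map_zero, sub_zero, h3, map_smul, lsm, V.hv2 P hl, smul_smul] at h4
      have := congrFun h4 V.k0
      simpa using this
    rw [h1]; exact sum_eq_zero fun j _ => by rw [h2, zero_smul]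
  | succ m ih =>
    intro z hz h0
    refine P.pt.e_inj _ z ?_ hz (ih _ ?_ ?_)
    · push_cast; omega
    · rw [wt_lie P.he2 hz]; congr 1; push_cast; ring
    · have he : V.dl P e (Pi.single V.k0 1) = 0 := by
        have : V.dl P e (Pi.single V.k0 1) = V.dl P (∑ i, P.ee i) (Pi.single V.k0 1) := congrArg (fun t => V.dl P t (Pi.single V.k0 1)) P.e_eq
        rw [this, map_sum, lsu]; exact sum_eq_zero fun j _ => V.hi j
      rw [V.dl_lie', h0, he, map_zero, map_zero, sub_zero]

theorem PD.normal (x : g) : ∃ (_ : LinearOrder F) (_ : IsOrderedAddMonoid F) (y : g) (c : Fin P.r → F), Cj F g x y ∧ (∀ j, 0 ≤ c j) ∧ y - ∑ j, c j • P.w j ∈ P.G 1 := by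
  obtain ⟨i1, i2⟩ := exists_ord F
  obtain ⟨lam, ⟨V⟩, hl, -⟩ := P.fundP
  obtain ⟨μ, y, hxy, hy, hv0, -, hmax⟩ := V.K_v P hl x
  set v : Fin V.d → F := Pi.single V.k0 1 with hv
  have h1 : y ∈ P.G 0 := fun b hb => by
    have hz : P.pr (P.ht b) y = 0 := by
      obtain ⟨m, hm⟩ : ∃ m : ℕ, P.ht b = -(m + 1) := ⟨(-P.ht b - 1).toNat, by omega⟩
      rw [hm]
      refine V.kill P hl m _ (P.h_pr _ _) ?_
      funext k
      rw [V.v_apply, ← P.B.sum_repr (P.pr _ y), map_sum, xsu, Pi.zero_apply]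
      by_cases hk : V.hv P k = m + 1
      · have a1 : V.dl P y v k = 0 := by
          rw [hy, Pi.smul_apply, hv, Pi.single_eq_of_ne, smul_zero]
          rintro rfl; rw [V.hv0] at hk; omega
        rw [V.v_apply, ← P.B.sum_repr y, map_sum, xsu] at a1
        rw [← a1]
        refine sum_congr rfl fun d _ => ?_
        rw [P.repr_pr, map_smul, map_smul, xsm, xsm]
        split_ifs with hd
        · rfl
        · by_cases h0 : V.ρ (P.B d) k V.k0 = 0
          · rw [h0, smul_zero, smul_zero]
          · have := V.hvB P h0; rw [V.hv0] at this; omega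
      · refine sum_eq_zero fun d _ => ?_
        rw [P.repr_pr, map_smul, xsm]
        split_ifs with hd
        · by_cases h0 : V.ρ (P.B d) k V.k0 = 0
          · rw [h0, smul_zero]
          · have := V.hvB P h0; rw [V.hv0] at this; omega
        · rw [zero_smul]
    have := P.repr_pr (P.ht b) y b
    rwa [hz, if_pos rfl, map_zero, Finsupp.zero_apply, eq_comm] at this
  obtain ⟨c, hc⟩ := P.pr0 y
  have h2 := P.G_pr h1
  rw [hc, zero_add] at h2
  refine ⟨i1, i2, y, c, hxy, fun j => ?_, h2⟩
  by_cases hcj : c j = 0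
  · rw [hcj]
  have h3 := P.G_lie h2 (P.G_hom (P.wfh j) le_rfl)
  rw [sub_lie, P.tf] at h3
  norm_num at h3
  have h4 := V.posv P h3
  rw [map_add, lad, V.dl_lie', hy, map_smul, map_smul, lsm] at h4
  set s := V.ρ (⁅y, P.ff j⁆ + c j • P.ff j) V.k0 V.k0
  have hev : V.dl P (P.ee j) (V.dl P (P.ff j) v) = (2 : F) • v := by
    rw [← V.hv2 P hl j, V.dl_lie', show V.dl P (P.ee j) v = 0 from V.hi j, map_zero, sub_zero]
  have h5 := hmax (μ - c j) (V.dl P (P.ff j) v - (c j)⁻¹ • s • v) (fun h0 => hv0 ?_) ?_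
  · exact le_of_not_gt fun h6 => by
      have := lt_sub_iff_add_lt.2 (show μ + c j < μ by simpa using h6)
      exact absurd h5 (not_le.2 this)
  · have := congrArg (V.dl P (P.ee j)) h0
    rw [map_sub, hev, map_smul, map_smul, show V.dl P (P.ee j) v = 0 from V.hi j, smul_zero, smul_zero, sub_zero, map_zero] at this
    exact (smul_eq_zero.1 this).resolve_left two_ne_zero
  · rw [map_sub, map_smul, map_smul, hy]
    have h7 : V.dl P y (V.dl P (P.ff j) v) = s • v - c j • V.dl P (P.ff j) v + μ • V.dl P (P.ff j) v := by rw [← h4]; abel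
    rw [h7]
    have h8 : s • v = c j • (c j)⁻¹ • s • v := by rw [smul_smul (c j), mul_inv_cancel₀ hcj, one_smul]
    rw [smul_sub, sub_smul, sub_smul, ← h8, smul_comm μ (c j)⁻¹, smul_comm μ s]
    abel
end nf

theorem zpow_sm {G ι : Type*} [CommGroup G] (s : Finset ι) (a : G) (n : ι → ℤ) : a ^ (∑ i ∈ s, n i) = ∏ i ∈ s, a ^ n i := by
  classical
  induction s using Finset.induction with
  | empty => simp
  | insert i s hi ih => rw [Finset.sum_insert hi, Finset.prod_insert hi, zpow_add, ih]

section torus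
open Finset
variable {F : Type*} [Field F] [CharZero F] [IsAlgClosed F] {g : Type*} [LieRing g] [LieAlgebra F g] [FiniteDimensional F g] [LieAlgebra.IsKilling F g] {e h f : g}
  (P : PD F e h f)

/-- torus element -/
noncomputable def PD.T (z : Fin P.r → Fˣ) : g →ₗ[F] g := P.B.constr F fun b => ((∏ i, z i ^ P.wt b i : Fˣ) : F) • P.B b

theorem PD.T_B (z : Fin P.r → Fˣ) (b) : P.T z (P.B b) = ((∏ i, z i ^ P.wt b i : Fˣ) : F) • P.B b := P.B.constr_basis F _ b

theorem PD.T_mul (z z' : Fin P.r → Fˣ) (x : g) : P.T (z * z') x = P.T z (P.T z' x) := by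
  refine LinearMap.congr_fun (P.B.ext fun b => ?_ : P.T (z * z') = P.T z ∘ₗ P.T z') x
  rw [lco, P.T_B, P.T_B, map_smul, P.T_B, smul_smul, ← Units.val_mul, ← prod_mul_distrib]
  simp only [Pi.mul_apply, mul_zpow, mul_comm]

theorem PD.T_one (x : g) : P.T 1 x = x := by
  refine LinearMap.congr_fun (P.B.ext fun b => ?_ : P.T 1 = LinearMap.id) x
  rw [P.T_B]; simp

theorem PD.T_repr (z : Fin P.r → Fˣ) (x : g) (b) : P.B.repr (P.T z x) b = ((∏ i, z i ^ P.wt b i : Fˣ) : F) * P.B.repr x b := repr_diag P.B _ _ (P.T_B z) x b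

theorem PD.T_wt (z : Fin P.r → Fˣ) {x : g} {n : Fin P.r → ℤ} (hx : ∀ i, ⁅P.w i, x⁆ = (n i : F) • x) : P.T z x = ((∏ i, z i ^ n i : Fˣ) : F) • x := by
  refine P.B.repr.injective (Finsupp.ext fun b => ?_)
  rw [P.T_repr, map_smul, fsm, smul_eq_mul]
  by_cases h0 : P.B.repr x b = 0
  · rw [h0, mul_zero, mul_zero]
  · rw [show P.wt b = n from funext fun i => Int.cast_inj.1 (P.repr_wt (hx i) h0)]

theorem PD.T_lie (z : Fin P.r → Fˣ) (x y : g) : P.T z ⁅x, y⁆ = ⁅P.T z x, P.T z y⁆ := by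
  rw [← P.B.sum_repr x, ← P.B.sum_repr y]
  simp only [sum_lie, lie_sum, map_sum, smul_lie, lie_smul, map_smul]
  refine sum_congr rfl fun b _ => congrArg _ (sum_congr rfl fun a _ => congrArg _ ?_)
  rw [P.T_B, P.T_B, P.T_wt z (n := fun i => P.wt a i + P.wt b i) (fun i => by rw [wt_lie (P.wB i a) (P.wB i b)]; push_cast; rfl)]
  simp only [smul_lie, lie_smul, smul_smul, zpow_add, prod_mul_distrib, Units.val_mul]
  rw [mul_comm]

theorem PD.T_G (z : Fin P.r → Fˣ) {k : ℤ} {x : g} (hx : x ∈ P.G k) : P.T z x ∈ P.G k := fun b hb => by rw [P.T_repr, hx b hb, mul_zero]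

theorem PD.T_cor (j : Fin P.r) (s : Fˣ) (x : g) : Cj F g x (P.T (fun k => s ^ P.C j k) x) := by
  obtain ⟨r, hr⟩ := IsAlgClosed.exists_pow_nat_eq (s : F) (n := 2) (by norm_num)
  have hr0 : r ≠ 0 := fun h0 => s.ne_zero (by rw [← hr, h0]; simp)
  obtain ⟨r, rfl⟩ : ∃ q : Fˣ, (q : F) = r := ⟨Units.mk0 r hr0, rfl⟩
  have hs : s = r * r := Units.ext (by rw [← hr]; push_cast; ring)
  set z : Fin P.r → Fˣ := fun k => r ^ P.C j k with hz
  have hzz : (fun k => s ^ P.C j k) = z * z := funext fun k => by rw [hs, mul_zpow]; rfl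
  set H := ⁅P.ee j, P.ff j⁆ with hH
  have He : ⁅H, P.ee j⁆ = (2 : F) • P.ee j := by rw [hH, P.ef, if_pos rfl, P.tl, P.Cii]; norm_num
  have Hf : ⁅H, P.ff j⁆ = (-2 : F) • P.ff j := by rw [hH, P.ef, if_pos rfl, P.tf, P.Cii]; norm_num
  have ne : ∀ t : F, IsNilpotent (ad F g (t • P.ee j) : End F g) := fun t => ad_nilp (y := H) two_ne_zero (by rw [lie_smul, He, smul_comm])
  have nf : ∀ t : F, IsNilpotent (ad F g (t • P.ff j) : End F g) := fun t => ad_nilp (y := H) (by norm_num : (-2 : F) ≠ 0) (by rw [lie_smul, Hf, smul_comm])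
  let E : g → End F g := fun N => nx (ad F g N : End F g)
  let W : F → F → g → g := fun t u x => E (t • P.ee j) (E (u • P.ff j) (E (t • P.ee j) x))
  have Wcj : ∀ t u x, Cj F g x (W t u x) := fun t u x => ((Cj.step (ne t) _).trans (Cj.step (nf u) _)).trans (Cj.step (ne t) _)
  have WH : W 1 (-1) H = - H := by
    have e1 : E ((1 : F) • P.ee j) H = H - (2 : F) • P.ee j := by
      simp only [E]
      rw [nx3 (ne 1)]
      · simp only [one_smul, adp, ← lie_skew (P.ee j) H, He, lie_neg, lie_smul, lie_self]; simp; abel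
      · simp only [one_smul, adp, ← lie_skew (P.ee j) H, He, lie_neg, lie_smul, lie_self]; simp
    have e2 : E ((1 : F) • P.ee j) (P.ee j) = P.ee j := by
      simp only [E]
      rw [nx3 (ne 1)] <;> simp
    have e3 : E ((-1 : F) • P.ff j) H = H - (2 : F) • P.ff j := by
      simp only [E]
      have : ⁅P.ff j, H⁆ = (2 : F) • P.ff j := by rw [← lie_skew, Hf, neg_smul, neg_neg]
      rw [nx3 (nf (-1))] <;> simp [this]
      abel
    have e4 : E ((-1 : F) • P.ff j) (P.ee j) = P.ee j + H - P.ff j := by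
      simp only [E]
      have h1 : ⁅P.ff j, H⁆ = (2 : F) • P.ff j := by rw [← lie_skew, Hf, neg_smul, neg_neg]
      have h2 : ⁅P.ff j, P.ee j⁆ = - H := by rw [← lie_skew]
      rw [nx3 (nf (-1))] <;> simp [h1, h2]
      abel
    simp only [W]
    rw [e1, map_sub, e3, map_smul, e4]
    have : H - (2 : F) • P.ff j - (2 : F) • (P.ee j + H - P.ff j) = -H - (2 : F) • P.ee j := by module
    rw [this, map_sub, map_neg, e1, map_smul, e2]; abel
  have Wl : ∀ x y : g, W 1 (-1) ⁅x, y⁆ = ⁅W 1 (-1) x, W 1 (-1) y⁆ := fun x y => by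
    simp only [W, E]; rw [nx_lie (ne 1), nx_lie (nf (-1)), nx_lie (ne 1)]
  have HB : ∀ b, ⁅H, P.B b⁆ = ((∑ k, P.C j k * P.wt b k : ℤ) : F) • P.B b := fun b => by
    rw [hH, P.ef, if_pos rfl, sum_lie]; push_cast; rw [sum_smul]
    exact sum_congr rfl fun k _ => by rw [smul_lie, P.wB, smul_smul]
  have zp : ∀ n : Fin P.r → ℤ, ∏ k, z k ^ n k = r ^ (∑ k, P.C j k * n k) := fun n => by
    rw [zpow_sm]; exact prod_congr rfl fun k _ => by rw [hz, zpow_mul]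
  have TH : ∀ (n : ℤ) (x : g), ⁅H, x⁆ = (n : F) • x → P.T z x = ((r ^ n : Fˣ) : F) • x := fun n x hx => by
    refine P.B.repr.injective (Finsupp.ext fun b => ?_)
    rw [P.T_repr, map_smul, fsm, smul_eq_mul, zp]
    by_cases h0 : P.B.repr x b = 0
    · rw [h0, mul_zero, mul_zero]
    · have h1 := repr_diag P.B (ad F g H) _ HB x b
      rw [adp, hx, map_smul, fsm, smul_eq_mul] at h1
      rw [Int.cast_inj.1 (mul_right_cancel₀ h0 h1)]
  have TW : ∀ x, P.T z (W 1 (-1) (P.T z x)) = W 1 (-1) x := fun x => by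
    refine LinearMap.congr_fun (P.B.ext fun b => ?_ : P.T z ∘ₗ (E ((1 : F) • P.ee j) ∘ₗ E ((-1 : F) • P.ff j) ∘ₗ E ((1 : F) • P.ee j)) ∘ₗ P.T z = E ((1 : F) • P.ee j) ∘ₗ E ((-1 : F) • P.ff j) ∘ₗ E ((1 : F) • P.ee j)) x
    simp only [lco]
    rw [TH _ _ (HB b)]
    simp only [map_smul]
    change _ • P.T z (W 1 (-1) (P.B b)) = W 1 (-1) (P.B b)
    rw [TH (-∑ k, P.C j k * P.wt b k) _ ?_, smul_smul, ← Units.val_mul, ← zpow_add, add_neg_cancel]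
    · simp
    · have := Wl H (P.B b)
      rw [WH, HB, neg_lie] at this
      rw [← neg_eq_iff_eq_neg.2 this]
      simp only [W, map_smul, Int.cast_neg, neg_smul]
  have TW' : ∀ x, P.T z (W 1 (-1) x) = W (r ^ 2 : Fˣ) (-(r ^ (-2 : ℤ) : Fˣ)) (P.T z x) := fun x => by
    have te : P.T z (P.ee j) = ((r ^ 2 : Fˣ) : F) • P.ee j := by have := TH 2 _ (by rw [He]; norm_num); simpa using this
    have tf : P.T z (P.ff j) = ((r ^ (-2 : ℤ) : Fˣ) : F) • P.ff j := TH (-2) _ (by rw [Hf]; norm_num)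
    have c1 : ∀ x, P.T z (E ((1 : F) • P.ee j) x) = E (((r ^ 2 : Fˣ) : F) • P.ee j) (P.T z x) := fun x =>
      nx_comm (P.T z) (ne 1) (ne _) (fun v => by rw [adp, P.T_lie, one_smul, te]; rfl) x
    have c2 : ∀ x, P.T z (E ((-1 : F) • P.ff j) x) = E ((-((r ^ (-2 : ℤ) : Fˣ) : F)) • P.ff j) (P.T z x) := fun x =>
      nx_comm (P.T z) (nf _) (nf _) (fun v => by rw [adp, P.T_lie, map_smul, tf, smul_smul, neg_one_mul]; rfl) x
    simp only [W]
    rw [c1, c2, c1]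
  rw [hzz, P.T_mul]
  refine (Wcj 1 (-1) x).trans ?_
  rw [← TW, TW']
  exact (Wcj _ _ _).symm

theorem PD.T_cj (z : Fin P.r → Fˣ) : ∀ x, Cj F g x (P.T z x) := by
  classical
  set D := (Matrix.of P.C).det with hD
  have hb : ∀ a : Fˣ, ∃ b : Fˣ, b ^ D = a := fun a => by
    have h1 : ∀ n : ℕ, 0 < n → ∃ b : Fˣ, b ^ n = a := fun n hn => by
      obtain ⟨r, hr⟩ := IsAlgClosed.exists_pow_nat_eq (a : F) hn
      have hr0 : r ≠ 0 := fun h0 => a.ne_zero (by rw [← hr, h0, zero_pow hn.ne'])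
      exact ⟨Units.mk0 r hr0, Units.ext hr⟩
    obtain ⟨b, hb⟩ := h1 D.natAbs (Int.natAbs_pos.2 P.Cdet)
    rcases Int.natAbs_eq D with h2 | h2
    · exact ⟨b, by rw [h2, zpow_natCast, hb]⟩
    · exact ⟨b⁻¹, by rw [h2, zpow_neg, zpow_natCast, inv_pow, inv_inv, hb]⟩
  choose b hb using fun i => hb (z i)
  have hz : z = ∏ j, fun k => (∏ i, b i ^ (Matrix.of P.C).adjugate i j) ^ P.C j k := funext fun k => by
    rw [Finset.prod_apply]
    simp only [← Finset.prod_zpow, ← zpow_mul]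
    rw [prod_comm]
    have : ∀ i, ∏ j, b i ^ ((Matrix.of P.C).adjugate i j * P.C j k) = if i = k then z i else 1 := fun i => by
      rw [← zpow_sm]
      have := congrFun (congrFun (Matrix.adjugate_mul (Matrix.of P.C)) i) k
      rw [Matrix.mul_apply, xsm, Matrix.one_apply] at this
      change ∑ j, (Matrix.of P.C).adjugate i j * P.C j k = _ at this
      rw [this]
      split_ifs
      · rw [smul_eq_mul, mul_one, hb]
      · simp
    simp [this]
  rw [hz]
  refine prod_induction _ (fun z => ∀ x, Cj F g x (P.T z x)) (fun z z' h1 h2 x => ?_) (fun x => ?_) (fun j _ x => P.T_cor j _ x)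
  · rw [P.T_mul]; exact (h2 x).trans (h1 _)
  · rw [P.T_one]; exact Cj.refl _
end torus

theorem Cj.equiv {F L L' : Type*} [Field F] [CharZero F] [LieRing L] [LieAlgebra F L] [LieRing L'] [LieAlgebra F L'] (m : L ≃ₗ[F] L')
    (hm : ∀ x y : L, m ⁅x, y⁆ = ⁅m x, m y⁆) {x y : L} (hc : Cj F L x y) : Cj F L' (m x) (m y) := by
  induction hc with
  | refl => exact Cj.refl _
  | tail _ hs ih =>
    obtain ⟨N, hN, rfl⟩ := hs
    have hN' : IsNilpotent (ad F L' (m N) : End F L') := by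
      obtain ⟨k, hk⟩ := hN
      have h1 : ∀ (k : ℕ) (z : L), ((ad F L' (m N) : End F L') ^ k) (m z) = m (((ad F L N : End F L) ^ k) z) := fun k => by
        induction k with
        | zero => intro z; simp
        | succ k ih => intro z; rw [pow_succ, pow_succ, ema, ema, adp, adp, ← hm, ih]
      refine ⟨k, LinearMap.ext fun z => ?_⟩
      have := h1 k (m.symm z)
      rw [m.apply_symm_apply, hk] at this
      rw [this]; simp
    refine ih.trans ?_
    have h3 : ∀ v, m (nx (ad F L N : End F L) v) = nx (ad F L' (m N) : End F L') (m v) :=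
      nx_comm m.toLinearMap hN hN' (fun v => hm N v)
    rw [h3]
    exact Cj.step hN' _

section nf2
open Finset
variable {F : Type*} [Field F] [CharZero F] [IsAlgClosed F] {g : Type*} [LieRing g] [LieAlgebra F g] [FiniteDimensional F g] {e h f : g}
  (P : PD F e h f)

theorem PD.G_bot : ∃ k : ℤ, P.G k = ⊥ := by
  refine ⟨∑ b, |P.ht b| + 1, ?_⟩
  refine (Submodule.eq_bot_iff _).2 fun x hx => P.B.repr.injective (Finsupp.ext fun b => ?_)
  rw [hx b ?_, map_zero, Finsupp.zero_apply]
  have h1 := single_le_sum (f := fun b => |P.ht b|) (fun b _ => abs_nonneg _) (mem_univ b)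
  have h2 := le_abs_self (P.ht b)
  omega

theorem PD.G_nilp {l : ℤ} (hl : 1 ≤ l) {N : g} (hN : N ∈ P.G l) : IsNilpotent (ad F g N : End F g) := by
  obtain ⟨k, hk⟩ := P.G_bot
  have h0 : ∀ x, x ∈ P.G (-∑ b, |P.ht b|) := fun x b hb => by
    have h1 := single_le_sum (f := fun b => |P.ht b|) (fun b _ => abs_nonneg _) (mem_univ b)
    have h2 := neg_abs_le (P.ht b)
    omega
  have h1 : ∀ (n : ℕ) x, ((ad F g N : End F g) ^ n) x ∈ P.G (-∑ b, |P.ht b| + n) := fun n x => by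
    induction n with
    | zero => simpa using h0 x
    | succ n ih =>
      rw [pow_succ', ema, adp]
      exact P.G_mono (by push_cast; omega) (P.G_lie hN ih)
  refine ⟨(k + ∑ b, |P.ht b|).toNat, LinearMap.ext fun x => ?_⟩
  have := P.G_mono (by have := Int.self_le_toNat (k + ∑ b, |P.ht b|); omega) (h1 (k + ∑ b, |P.ht b|).toNat x) (k := k)
  rw [hk] at this
  exact (Submodule.mem_bot F).1 this

theorem PD.jstep {l k : ℤ} (hl : 1 ≤ l) {N D Y : g} (hN : N ∈ P.G l) (hY : Y ∈ P.G k) (hD : ⁅D, N⁆ - Y ∈ P.G (k + 1)) :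
    ∃ Y' ∈ P.G (k + 1), Cj F g (D + Y) (D + Y') := by
  have nn := P.G_nilp hl hN
  have h1 : ⁅N, Y⁆ ∈ P.G (k + 1) := P.G_mono (by omega) (P.G_lie hN hY)
  have h2 : ⁅N, D⁆ ∈ P.G k := by
    rw [← lie_skew]; refine neg_mem ?_
    have := add_mem (P.G_mono (by omega : k ≤ k + 1) hD) hY
    rwa [sub_add_cancel] at this
  have h3 : ∀ j : ℕ, ((ad F g N : End F g) ^ (j + 2)) (D + Y) ∈ P.G (k + 1) := fun j => by
    induction j with
    | zero =>
      rw [zero_add, pow_two, ema, adp, adp, lie_add]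
      exact P.G_mono (by omega) (P.G_lie hN (add_mem h2 (P.G_mono (by omega) h1)))
    | succ j ih =>
      rw [show j + 1 + 2 = j + 2 + 1 by ring, pow_succ' (ad F g N : End F g), ema, adp]
      exact P.G_mono (by omega) (P.G_lie hN ih)
  have h4 := nx_sub2 nn _ _ h3
  refine ⟨nx (ad F g N : End F g) (D + Y) - D, ?_, by rw [add_sub_cancel]; exact Cj.step nn _⟩
  have h5 := add_mem (sub_mem h4 hD) h1
  convert h5 using 1
  rw [adp, lie_add, ← lie_skew D N]; abel

theorem PD.he_eq (P : PD F e h f) (x : g) : ⁅e, x⁆ = ∑ i, ⁅P.ee i, x⁆ := by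
  rw [← sum_lie]; exact congrArg (fun t => ⁅t, x⁆) P.e_eq

theorem PD.jnf [LinearOrder F] [IsOrderedAddMonoid F] {c : Fin P.r → F} (hc : ∀ i, 0 ≤ c i) {a : Fin P.r → F} (ha : ∀ i, c i = 0 → a i = 1) {y : g}
    (hy : y - ∑ i, c i • P.w i - ∑ i, a i • P.ee i ∈ P.G 2) : Cj F g y (∑ i, c i • P.w i + e) := by
  set H := ∑ i, c i • P.w i with hH
  have He : ∀ i, ⁅H, P.ee i⁆ = c i • P.ee i := fun i => P.tl i c
  have H0 : ∀ {k : ℤ} {x : g}, x ∈ P.G k → ⁅H, x⁆ ∈ P.G k := fun hx => by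
    have := P.G_lie (P.G_w c) hx; rwa [zero_add] at this
  have hE : ∀ {k : ℤ} {x : g}, x ∈ P.G k → ⁅e, x⁆ ∈ P.G (k + 1) := fun hx => by
    have := P.G_lie (P.G_hom P.he2 le_rfl) hx; rwa [add_comm] at this
  have eG : ∀ i, P.ee i ∈ P.G 1 := fun i => P.G_hom (P.weh i) le_rfl
  let cw : Fin P.n → F := fun b => ∑ i, c i * P.wt b i
  have HB : ∀ b, ⁅H, P.B b⁆ = cw b • P.B b := fun b => by
    rw [hH, sum_lie, sum_smul]; exact sum_congr rfl fun k _ => by rw [smul_lie, P.wB, smul_smul]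
  have Hr : ∀ (x : g) b, P.B.repr ⁅H, x⁆ b = cw b * P.B.repr x b := repr_diag P.B (ad F g H) cw HB
  have cwp : ∀ b, 1 ≤ P.ht b → 0 ≤ cw b := fun b hb => sum_nonneg fun i _ => by
    have h1 : 0 ≤ P.wt b i := by
      rcases P.sgn b with h | h
      · exact h i
      · have : P.ht b ≤ 0 := sum_nonpos fun i _ => h i
        omega
    obtain ⟨n, hn⟩ := izl h1
    rw [hn, Int.cast_natCast, mul_comm, ← nsmul_eq_mul]
    exact nsmul_nonneg (hc i) n
  have main : ∀ k : ℕ, ∃ Y ∈ P.G (k + 2), Cj F g y (H + e + Y) := fun k => by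
    induction k with
    | zero =>
      have h1 : y = H + e + (y - H - e) := by abel
      obtain ⟨Y', h2, h3⟩ := P.jstep (l := 1) (k := 1) le_rfl (N := ∑ i, ((a i - 1) * (c i)⁻¹) • P.ee i) (D := H + e) (Y := y - H - e)
        (sum_mem fun i _ => ssm _ _ (eG i)) (by
          have := add_mem (P.G_mono (by norm_num : (1 : ℤ) ≤ 2) hy) (sum_mem (t := univ) fun i _ => ssm (P.G 1) (a i) (eG i))
          rw [sub_add_cancel] at this
          exact sub_mem this (P.G_hom P.he2 le_rfl)) (by
          have h2 : ⁅H, ∑ i, ((a i - 1) * (c i)⁻¹) • P.ee i⁆ = ∑ i, a i • P.ee i - ∑ i, P.ee i := by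
            rw [lie_sum, ← sum_sub_distrib]
            refine sum_congr rfl fun i _ => ?_
            rw [lie_smul, He, smul_smul]
            by_cases h0 : c i = 0
            · rw [h0, ha i h0]; simp
            · rw [inv_mul_cancel_right₀ h0, sub_smul, one_smul]
          have h3 : ⁅e, ∑ i, ((a i - 1) * (c i)⁻¹) • P.ee i⁆ ∈ P.G 2 := hE (sum_mem fun i _ => ssm _ _ (eG i))
          have h4 := sub_mem h3 hy
          rw [show (1 : ℤ) + 1 = 2 by norm_num]
          convert h4 using 1
          rw [add_lie, h2]
          have h5 : y - H - e = y - H - ∑ i, P.ee i := congrArg (fun t => y - H - t) P.e_eq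
          rw [h5]; abel)
      rw [← h1] at h3
      exact ⟨Y', by simpa using h2, h3⟩
    | succ k ih =>
      obtain ⟨Y, hY, hcj⟩ := ih
      obtain ⟨y', hy', hyy⟩ := P.pt.e_surj (2 * (k + 2)) _ (by omega) (P.h_pr (k + 2) Y)
      rw [show (2 * ((k : ℤ) + 2) - 2) = 2 * (k + 1) by ring] at hy'
      let z'' : g := ∑ b, (if cw b = 0 then P.B.repr y' b else 0) • P.B b
      have z1 : ⁅H, z''⁆ = 0 := by
        rw [lie_sum]; refine sum_eq_zero fun b _ => ?_
        rw [lie_smul, HB]; split_ifs with h0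
        · rw [h0, zero_smul, smul_zero]
        · rw [zero_smul]
      have z2 : ∀ b, P.B.repr z'' b = if cw b = 0 then P.B.repr y' b else 0 := fun b => by rw [P.B.repr_sum_self]
      have z3 : z'' ∈ P.G (k + 1) := fun b hb => by
        rw [z2, P.G_hom hy' le_rfl b hb, ite_self]
      have z4 : ∀ d, cw d = 0 → P.B.repr ⁅e, y' - z''⁆ d = 0 := fun d hd => by
        rw [← P.B.sum_repr (y' - z''), lie_sum, map_sum, Finsupp.finsetSum_apply]
        refine sum_eq_zero fun b _ => ?_
        rw [lie_smul, map_smul, fsm, smul_eq_mul, map_sub, Finsupp.sub_apply, z2]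
        split_ifs with h0
        · rw [sub_self, zero_mul]
        rw [sub_zero]
        by_cases h1 : P.B.repr y' b = 0
        · rw [h1, zero_mul]
        have hb : P.ht b = k + 1 := P.repr_h hy' h1
        rw [P.he_eq, map_sum, Finsupp.finsetSum_apply, sum_eq_zero, mul_zero]
        intro i _
        have h2 := Hr ⁅P.ee i, P.B b⁆ d
        rw [wt_lie (He i) (HB b), hd, zero_mul, map_smul, fsm, smul_eq_mul] at h2
        refine (mul_eq_zero.1 h2).resolve_left fun h3 => h0 ?_
        exact ((add_eq_zero_iff_of_nonneg (hc i) (cwp b (by omega))).1 h3).2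
      set q := P.pr (k + 2) Y - ⁅e, z''⁆ with hq
      have q0 : ∀ d, cw d = 0 → P.B.repr q d = 0 := fun d hd => by
        rw [hq, ← hyy, ← lie_sub]; exact z4 d hd
      have qG : q ∈ P.G (k + 2) := sub_mem (P.G_hom (P.h_pr _ _) le_rfl) (P.G_mono (by omega) (hE z3))
      let z' : g := ∑ b, ((cw b)⁻¹ * P.B.repr q b) • P.B b
      have z5 : ∀ b, P.B.repr z' b = (cw b)⁻¹ * P.B.repr q b := fun b => by rw [P.B.repr_sum_self]
      have z6 : z' ∈ P.G (k + 2) := fun b hb => by rw [z5, qG b hb, mul_zero]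
      have z7 : ⁅H, z'⁆ = q := P.B.repr.injective (Finsupp.ext fun b => by
        rw [Hr, z5]
        by_cases h0 : cw b = 0
        · rw [h0, zero_mul, q0 b h0]
        · rw [mul_inv_cancel_left₀ h0])
      obtain ⟨Y', h2, h3⟩ := P.jstep (l := k + 1) (k := k + 2) (by omega) (N := z'' + z') (D := H + e) (Y := Y)
        (add_mem z3 (P.G_mono (by omega) z6)) hY (by
          have h4 := sub_mem (hE z6) (P.G_pr hY)
          convert h4 using 1
          rw [add_lie, lie_add, lie_add, z1, z7, hq]; abel)
      exact ⟨Y', by push_cast; rwa [show (k : ℤ) + 1 + 2 = k + 2 + 1 by ring], hcj.trans h3⟩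
  obtain ⟨k, hk⟩ := P.G_bot
  obtain ⟨Y, h1, h2⟩ := main k.toNat
  have h3 := P.G_mono (by have := Int.self_le_toNat k; omega) h1 (k := k)
  rw [hk, Submodule.mem_bot] at h3
  rwa [h3, add_zero] at h2

theorem PD.kostant [LieAlgebra.IsKilling F g] {x : g} (hr : finrank F (cent F g x) ≤ P.r) : ∃ s, Cj F g x s ∧ s - e ∈ cent F g f := by
  obtain ⟨_, _, y, c, hxy, hc, hy⟩ := P.normal x
  obtain ⟨a, ha⟩ := P.pr1 (y - ∑ j, c j • P.w j)
  have hy2 := P.G_pr hy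
  rw [ha] at hy2
  have ha0 := P.reg_coef (hxy.symm.cent_le.trans hr) hy2
  classical
  let z : Fin P.r → Fˣ := fun i => if h0 : a i = 0 then 1 else (Units.mk0 (a i) h0)⁻¹
  have h1 := P.T_cj z y
  have h2 := P.T_G z hy2
  rw [map_sub, map_sub, map_sum, map_sum] at h2
  have h3 : ∀ j, P.T z (c j • P.w j) = c j • P.w j := fun j => by
    rw [map_smul, P.T_wt z (n := 0) fun i => by simp [P.pt.comm0 _ _ (P.hw i) (P.hw j)]]; simp
  have h4 : ∀ j, P.T z (a j • P.ee j) = (z j * a j) • P.ee j := fun j => by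
    rw [map_smul, P.T_wt z (n := fun i => if i = j then 1 else 0) fun i => by rw [P.we]; split_ifs <;> simp]
    simp [smul_smul, mul_comm]
  simp only [h3, h4] at h2
  have h5 := P.jnf hc (fun i hi => by simp [z, ha0 i hi]) h2
  obtain ⟨Y, h6, h7⟩ := P.gauge (P.eta_Fil (R := F) c)
  have h8 := (h6.cj P).equiv (TensorProduct.lid F g) (fun X Y => by
    induction X with
    | zero => simp
    | add _ _ h1 h2 => rw [add_lie, map_add, map_add, h1, h2, add_lie]
    | tmul r x =>
      induction Y with
      | zero => simp
      | add _ _ h1 h2 => rw [lie_add, map_add, map_add, h1, h2, lie_add]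
      | tmul s y => rw [btm]; simp [smul_smul, mul_comm s r])
  have h9 : TensorProduct.lid F g (P.eta c) = ∑ i, c i • P.w i + e := by
    rw [PD.eta, map_add, map_sum, TensorProduct.lid_tmul, one_smul, add_comm]; simp
  rw [h9] at h8
  refine ⟨_, ((hxy.trans h1).trans h5).trans h8, ?_⟩
  have h10 : TensorProduct.lid F g (Y - 1 ⊗ₜ e) ∈ cent F g f := by
    have : (tenV (R := F) (cent F g f)) ≤ (cent F g f).comap (TensorProduct.lid F g).toLinearMap := by
      rintro _ ⟨q, rfl⟩
      induction q with
      | zero => simp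
      | add _ _ h1 h2 => rw [map_add]; exact add_mem h1 h2
      | tmul r v => simpa using ssm _ r v.2
    exact this h7
  rwa [map_sub, TensorProduct.lid_tmul, one_smul] at h10
end nf2

section trn
open Finset MvPolynomial
variable {F : Type*} [Field F] {ℓ : ℕ} {μ : Fin ℓ → ℕ}

theorem mem_tr {f : MvPolynomial (Fin ℓ) F} : f ∈ truncIdeal F μ ↔ ∀ b ∈ f.support, ∃ i, μ i < b i := by
  have : truncIdeal F μ = Ideal.span ((fun s => monomial s (1 : F)) '' {b : Fin ℓ →₀ ℕ | ∃ i, μ i < b i}) := by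
    unfold truncIdeal
    congr 1
    ext q
    constructor
    · rintro ⟨ω, h1, rfl⟩
      obtain ⟨i, hi⟩ := not_forall.1 h1
      exact ⟨_, ⟨i, by simpa using hi⟩, rfl⟩
    · rintro ⟨b, ⟨i, hi⟩, rfl⟩
      exact ⟨b, fun h1 => (h1 i).not_gt hi, by simp⟩
  rw [this, mem_ideal_span_monomial_image]
  refine forall₂_congr fun b _ => ⟨fun ⟨c, ⟨i, hi⟩, hc⟩ => ⟨i, hi.trans_le (hc i)⟩, fun h => ⟨b, h, le_rfl⟩⟩

/-- exponent vectors -/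
noncomputable def xpo (a : ∀ i, Fin (μ i + 1)) : Fin ℓ →₀ ℕ := Finsupp.equivFunOnFinite.symm fun i => (a i : ℕ)

theorem xpo_ap (a : ∀ i, Fin (μ i + 1)) (i) : xpo a i = a i := rfl

theorem xpo_inj {a b : ∀ i, Fin (μ i + 1)} (h : xpo a = xpo b) : a = b :=
  funext fun i => Fin.ext (by rw [← xpo_ap, h, xpo_ap])

/-- quotient map -/
noncomputable def qm (F : Type*) [Field F] {ℓ : ℕ} (μ : Fin ℓ → ℕ) : MvPolynomial (Fin ℓ) F →ₐ[F] trunc F μ := Ideal.Quotient.mkₐ F _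

theorem qm_surj : Function.Surjective (qm F μ) := Ideal.Quotient.mkₐ_surjective F _

theorem qm_zero {f : MvPolynomial (Fin ℓ) F} : qm F μ f = 0 ↔ ∀ b ∈ f.support, ∃ i, μ i < b i := by
  rw [← mem_tr]; exact Ideal.Quotient.eq_zero_iff_mem

theorem qm_mon {b : Fin ℓ →₀ ℕ} {i} (h : μ i < b i) (c : F) : qm F μ (monomial b c) = 0 :=
  qm_zero.2 fun _ hd => by rw [mem_singleton.1 (support_monomial_subset hd)]; exact ⟨i, h⟩

theorem tr_equiv : Nonempty (trunc F μ ≃ₗ[F] ((∀ i, Fin (μ i + 1)) → F)) := by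
  let Φ : MvPolynomial (Fin ℓ) F →ₗ[F] ((∀ i, Fin (μ i + 1)) → F) := LinearMap.pi fun a => lcoeff F (xpo a)
  have hΦ : Function.Surjective Φ := fun v => ⟨∑ a, monomial (xpo a) (v a), funext fun a => by
    simp only [Φ, LinearMap.pi_apply, map_sum, lcoeff_apply, coeff_monomial]
    rw [sum_eq_single a (fun b _ hb => if_neg fun h => hb (xpo_inj h)) (fun h => absurd (mem_univ _) h), if_pos rfl]⟩
  have hk : LinearMap.ker (qm F μ).toLinearMap = LinearMap.ker Φ := by
    ext f
    rw [LinearMap.mem_ker, LinearMap.mem_ker]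
    refine qm_zero.trans ⟨fun h => funext fun a => ?_, fun h b hb => ?_⟩
    · by_contra h0
      obtain ⟨i, hi⟩ := h (xpo a) (mem_support_iff.2 h0)
      rw [xpo_ap] at hi; omega
    · by_contra h0
      push Not at h0
      refine mem_support_iff.1 hb ?_
      have := congrFun h fun i => ⟨b i, Nat.lt_succ_of_le (h0 i)⟩
      have h2 : xpo (μ := μ) (fun i => ⟨b i, Nat.lt_succ_of_le (h0 i)⟩) = b := Finsupp.ext fun i => rfl
      simp only [Φ, LinearMap.pi_apply, lcoeff_apply, h2] at this
      exact this
  exact ⟨((qm F μ).toLinearMap.quotKerEquivOfSurjective qm_surj).symm.trans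
    ((Submodule.quotEquivOfEq _ _ hk).trans (Φ.quotKerEquivOfSurjective hΦ))⟩

instance : FiniteDimensional F (trunc F μ) := tr_equiv.some.symm.finiteDimensional

theorem tr_fr : finrank F (trunc F μ) = Fintype.card (∀ i, Fin (μ i + 1)) := by
  rw [tr_equiv.some.finrank_eq, Module.finrank_fintype_fun_eq_card]

/-- augmentation -/
noncomputable def aug (F : Type*) [Field F] {ℓ : ℕ} (μ : Fin ℓ → ℕ) : trunc F μ →ₐ[F] F :=
  Ideal.Quotient.liftₐ _ (aeval (fun _ => (0 : F))) fun f hf => by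
    change aeval _ f = 0
    have : f.coeff 0 = 0 := by
      by_contra h0
      obtain ⟨i, hi⟩ := mem_tr.1 hf 0 (mem_support_iff.2 h0)
      simp at hi
    rw [show (fun _ => (0 : F)) = (0 : Fin ℓ → F) from rfl, aeval_zero]
    simpa [constantCoeff_eq] using this

theorem aug_qm (f : MvPolynomial (Fin ℓ) F) : aug F μ (qm F μ f) = aeval (fun _ => (0 : F)) f := rfl

theorem aug_nil : IsNilpotent (RingHom.ker (aug F μ)) := by
  have hn : IsNoetherianRing (trunc F μ) := inferInstance
  rw [Ideal.FG.isNilpotent_iff_le_nilradical ((isNoetherianRing_iff_ideal_fg _).1 hn _)]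
  intro x hx
  obtain ⟨f, rfl⟩ := qm_surj x
  have h0 : f.coeff 0 = 0 := by
    have : aeval (fun _ => (0 : F)) f = 0 := hx
    rw [show (fun _ => (0 : F)) = (0 : Fin ℓ → F) from rfl, aeval_zero] at this
    simpa [constantCoeff_eq] using this
  rw [f.as_sum, map_sum]
  refine Ideal.sum_mem _ fun b hb => ?_
  have hb0 : b ≠ 0 := by rintro rfl; exact mem_support_iff.1 hb h0
  obtain ⟨i, hi⟩ := Finsupp.ne_iff.1 hb0
  rw [mem_nilradical]
  refine ⟨μ i + 1, ?_⟩
  rw [← map_pow, monomial_pow]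
  refine qm_mon (i := i) ?_ _
  have : 1 ≤ b i := Nat.one_le_iff_ne_zero.2 hi
  simp only [fsm, smul_eq_mul]
  nlinarith

/-- weights -/
theorem vand [CharZero F] (m : ℕ) : ∃ W : Fin (m + 1) → Fin (m + 1) → F, ∀ a b : Fin (m + 1), ∑ k, W a k * (k : F) ^ (b : ℕ) = if a = b then 1 else 0 := by
  let V := Matrix.vandermonde fun k : Fin (m + 1) => ((k : ℕ) : F)
  have h1 : IsUnit V.det := isUnit_iff_ne_zero.2 (Matrix.det_vandermonde_ne_zero_iff.2 fun a b h => Fin.ext (by exact_mod_cast h))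
  refine ⟨fun a k => V⁻¹ a k, fun a b => ?_⟩
  have := congrFun (congrFun (Matrix.nonsing_inv_mul V h1) a) b
  rw [Matrix.mul_apply, Matrix.one_apply] at this
  simpa [V, Matrix.vandermonde_apply] using this

/-- deformation to distinct points -/
theorem defo [CharZero F] (μ : Fin ℓ → ℕ) : ∃ (τ : F → MvPolynomial (Fin ℓ) F →ₗ[F] trunc F μ) (u : F → (∀ i, Fin (μ i + 1)) → trunc F μ),
    (∀ f, τ 0 f = qm F μ f) ∧ (∀ s ≠ 0, ∀ f, τ s f = ∑ p, aeval (fun i => s * ((p i : ℕ) : F)) f • u s p) ∧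
    ∀ f (α : trunc F μ →ₗ[F] F), ∃ P : Polynomial F, ∀ s, α (τ s f) = P.eval s := by
  choose W hW using fun i => vand (F := F) (μ i)
  let c : (∀ i, Fin (μ i + 1)) → (Fin ℓ →₀ ℕ) → F := fun a b => ∏ i, ∑ k, W i (a i) k * (k : F) ^ b i
  have c0 : ∀ {a b}, c a b ≠ 0 → xpo a ≤ b := fun {a b} h i => by
    by_contra h1
    rw [xpo_ap] at h1
    refine h (prod_eq_zero (mem_univ i) ?_)
    have := hW i (a i) ⟨b i, by have := (a i).2; omega⟩
    rw [if_neg (fun h2 => h1 (by rw [h2]))] at this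
    exact this
  have c1 : ∀ a, c a (xpo a) = 1 := fun a => prod_eq_one fun i _ => by
    have := hW i (a i) (a i)
    rwa [if_pos rfl] at this
  have cw : ∀ a b, c a b = ∑ p : ∀ i, Fin (μ i + 1), (∏ i, W i (a i) (p i)) * ∏ i, ((p i : ℕ) : F) ^ b i := fun a b => by
    simp only [c]
    rw [prod_univ_sum]
    simp [prod_mul_distrib, Fintype.piFinset_univ]
  let T : (∀ i, Fin (μ i + 1)) → trunc F μ := fun a => qm F μ (monomial (xpo a) 1)
  let τ : F → MvPolynomial (Fin ℓ) F →ₗ[F] trunc F μ := fun s =>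
    (basisMonomials (Fin ℓ) F).constr F fun b => ∑ a, (c a b * s ^ (b.degree - (xpo a).degree)) • T a
  have tm : ∀ s b, τ s (monomial b 1) = ∑ a, (c a b * s ^ (b.degree - (xpo a).degree)) • T a := fun s b => by
    have := (basisMonomials (Fin ℓ) F).constr_basis F (fun b => ∑ a, (c a b * s ^ (b.degree - (xpo a).degree)) • T a) b
    rwa [coe_basisMonomials] at this
  have lx : ∀ (l₁ l₂ : MvPolynomial (Fin ℓ) F →ₗ[F] trunc F μ), (∀ b, l₁ (monomial b 1) = l₂ (monomial b 1)) → l₁ = l₂ := fun l₁ l₂ h =>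
    (basisMonomials (Fin ℓ) F).ext fun b => by rw [coe_basisMonomials]; exact h b
  refine ⟨τ, fun s p => ∑ a, ((s ^ (xpo a).degree)⁻¹ * ∏ i, W i (a i) (p i)) • T a, ?_, ?_, ?_⟩
  · refine fun f => LinearMap.congr_fun (lx (τ 0) (qm F μ).toLinearMap fun b => ?_) f
    rw [tm, AlgHom.toLinearMap_apply]
    have hne : ∀ a, xpo a ≠ b → (c a b * 0 ^ (b.degree - (xpo a).degree)) • T a = 0 := fun a ha => by
      by_cases h1 : c a b = 0
      · rw [h1, zero_mul, zero_smul]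
      have h2 := (c0 h1).lt_of_ne ha
      have h3 : (xpo a).degree < b.degree := by
        obtain ⟨d, rfl⟩ := exists_add_of_le (c0 h1)
        rw [map_add]
        have : d.degree ≠ 0 := fun h => ha (by rw [(Finsupp.degree_eq_zero_iff d).1 h, add_zero])
        omega
      rw [zero_pow (by omega), mul_zero, zero_smul]
    by_cases hb : ∃ i, μ i < b i
    · obtain ⟨i, hi⟩ := hb
      rw [qm_mon hi]
      exact sum_eq_zero fun a _ => hne a (by rintro rfl; rw [xpo_ap] at hi; omega)
    · push Not at hb
      let a : ∀ i, Fin (μ i + 1) := fun i => ⟨b i, Nat.lt_succ_of_le (hb i)⟩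
      have hab : xpo a = b := Finsupp.ext fun i => rfl
      rw [sum_eq_single a (fun a' _ h => hne a' fun h1 => h (xpo_inj (h1.trans hab.symm))) (fun h => absurd (mem_univ _) h)]
      simp only [T, ← hab, c1, Nat.sub_self, pow_zero, one_mul, one_smul]
  · intro s hs f
    let l₂ : MvPolynomial (Fin ℓ) F →ₗ[F] trunc F μ := ∑ p : ∀ i, Fin (μ i + 1),
      (aeval (R := F) fun i => s * ((p i : ℕ) : F)).toLinearMap.smulRight (∑ a, ((s ^ (xpo a).degree)⁻¹ * ∏ i, W i (a i) (p i)) • T a)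
    have := LinearMap.congr_fun (lx (τ s) l₂ fun b => ?_) f
    · rw [this]; simp [l₂]
    · rw [tm]
      simp only [l₂, lsu, LinearMap.smulRight_apply, AlgHom.toLinearMap_apply, aeval_monomial, smul_sum, smul_smul]
      rw [sum_comm]
      refine sum_congr rfl fun a _ => ?_
      rw [← sum_smul]
      congr 1
      have h1 : ∀ p : ∀ i, Fin (μ i + 1), (b.prod fun i k => (s * ((p i : ℕ) : F)) ^ k) = s ^ b.degree * ∏ i, ((p i : ℕ) : F) ^ b i := fun p => by
        rw [Finsupp.prod_fintype _ _ (fun i => pow_zero _)]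
        simp only [mul_pow]
        rw [prod_mul_distrib, prod_pow_eq_pow_sum, Finsupp.degree_eq_sum]
      simp only [h1, map_one, one_mul]
      by_cases h2 : c a b = 0
      · rw [h2, zero_mul]
        have : s ^ b.degree * (s ^ (xpo a).degree)⁻¹ * c a b = 0 := by rw [h2, mul_zero]
        rw [← this, cw, mul_sum]
        exact sum_congr rfl fun p _ => by ring
      · have h3 : (xpo a).degree ≤ b.degree := by
          obtain ⟨d, rfl⟩ := exists_add_of_le (c0 h2)
          rw [map_add]; omega
        rw [pow_sub₀ s hs h3, cw, sum_mul]
        exact sum_congr rfl fun p _ => by ring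
  · intro f α
    refine ⟨∑ b ∈ f.support, Polynomial.C (f.coeff b) * ∑ a, Polynomial.C (c a b * α (T a)) * Polynomial.X ^ (b.degree - (xpo a).degree), fun s => ?_⟩
    have h1 : τ s f = ∑ b ∈ f.support, f.coeff b • τ s (monomial b 1) := by
      conv_lhs => rw [f.as_sum, map_sum]
      refine sum_congr rfl fun b _ => ?_
      rw [← map_smul, smul_monomial, smul_eq_mul, mul_one]
    rw [h1, map_sum, Polynomial.eval_finset_sum]
    refine sum_congr rfl fun b _ => ?_
    rw [map_smul, tm, map_sum, smul_eq_mul, Polynomial.eval_mul, Polynomial.eval_C, Polynomial.eval_finset_sum]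
    congr 1
    refine sum_congr rfl fun a _ => ?_
    rw [map_smul, smul_eq_mul]; simp; ring
end trn

section r0
open Finset
variable {F : Type*} [Field F] {g : Type*} [LieRing g] [LieAlgebra F g] {R R' : Type*} [CommRing R] [Algebra F R] [CommRing R'] [Algebra F R']

/-- evaluation of `R ⊗ g` -/
noncomputable def evl (g : Type*) [LieRing g] [LieAlgebra F g] (φ : R →ₐ[F] F) : R ⊗[F] g →ₗ[F] g :=
  (TensorProduct.lid F g).toLinearMap ∘ₗ LinearMap.rTensor g φ.toLinearMap

theorem evl_tmul (φ : R →ₐ[F] F) (r : R) (x : g) : evl g φ (r ⊗ₜ x) = φ r • x := by simp [evl]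

theorem evl_lie (φ : R →ₐ[F] F) (X Y : R ⊗[F] g) : evl g φ ⁅X, Y⁆ = ⁅evl g φ X, evl g φ Y⁆ := by
  induction X with
  | zero => simp
  | add _ _ h1 h2 => rw [add_lie, map_add, map_add, h1, h2, add_lie]
  | tmul r x =>
    induction Y with
    | zero => simp
    | add _ _ h1 h2 => rw [lie_add, map_add, map_add, h1, h2, lie_add]
    | tmul s y => rw [btm, evl_tmul, evl_tmul, evl_tmul, map_mul, smul_lie, lie_smul, smul_smul]

theorem rTn_lie (α : R →ₐ[F] R') (X Y : R ⊗[F] g) :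
    LinearMap.rTensor g α.toLinearMap ⁅X, Y⁆ = ⁅LinearMap.rTensor g α.toLinearMap X, LinearMap.rTensor g α.toLinearMap Y⁆ := by
  induction X with
  | zero => simp
  | add _ _ h1 h2 => rw [add_lie, map_add, map_add, h1, h2, add_lie]
  | tmul r x =>
    induction Y with
    | zero => simp
    | add _ _ h1 h2 => rw [lie_add, map_add, map_add, h1, h2, lie_add]
    | tmul s y => simp [btm]

theorem rk_nul {L : Type*} [LieRing L] [LieAlgebra F L] [FiniteDimensional F L] (x : L) :
    finrank F (LinearMap.range (ad F L x : End F L)) + finrank F (cent F L x) = finrank F L := by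
  rw [show cent F L x = LinearMap.ker (ad F L x : End F L) from Submodule.ext fun y => Iff.rfl]
  exact LinearMap.finrank_range_add_finrank_ker _

theorem dualb {M : Type*} [AddCommGroup M] [Module F M] [FiniteDimensional F M] (W : Submodule F M) :
    ∃ (b : Fin (finrank F W) → M) (α : Fin (finrank F W) → M →ₗ[F] F), (∀ i, b i ∈ W) ∧ ∀ i j, α j (b i) = if i = j then 1 else 0 := by
  obtain ⟨q, hq⟩ := LinearMap.exists_leftInverse_of_injective W.subtype (Submodule.ker_subtype _)
  let b := Module.finBasis F W
  refine ⟨fun i => b i, fun j => b.coord j ∘ₗ q, fun i => (b i).2, fun i j => ?_⟩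
  have : q (b i) = b i := LinearMap.congr_fun hq (b i)
  rw [lco, this, Module.Basis.coord_apply, Module.Basis.repr_self, Finsupp.single_apply]

variable {ℓ : ℕ} {μ : Fin ℓ → ℕ}

/-- rank of a commutator over the truncated ring is bounded by ranks at distinct points -/
theorem rk_bd [CharZero F] [FiniteDimensional F g] (X : trunc F μ ⊗[F] g) : ∃ Z : (∀ i, Fin (μ i + 1)) → g, Z 0 = evl g (aug F μ) X ∧
    finrank F (LinearMap.range (ad F (trunc F μ ⊗[F] g) X : End F (trunc F μ ⊗[F] g))) ≤
      ∑ p, finrank F (LinearMap.range (ad F g (Z p) : End F g)) := by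
  obtain ⟨τ, u, t0, ts, tp⟩ := defo (F := F) μ
  set aX : End F (trunc F μ ⊗[F] g) := ad F (trunc F μ ⊗[F] g) X with haX
  set ρ := finrank F (LinearMap.range aX) with hρ
  obtain ⟨b, α, hb, hα⟩ := dualb (LinearMap.range aX)
  have hsur : Function.Surjective (LinearMap.rTensor g (qm F μ).toLinearMap) := LinearMap.rTensor_surjective g qm_surj
  obtain ⟨X', hX'⟩ := hsur X
  have hz : ∀ i, ∃ z, LinearMap.rTensor g (qm F μ).toLinearMap ⁅X', z⁆ = b i := fun i => by
    obtain ⟨y, hy⟩ := hb i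
    obtain ⟨z, rfl⟩ := hsur y
    exact ⟨z, by rw [rTn_lie, hX', ← hy]; rfl⟩
  choose z hz using hz
  have hP : ∀ (β : (trunc F μ ⊗[F] g) →ₗ[F] F) (Y : MvPolynomial (Fin ℓ) F ⊗[F] g), ∃ P : Polynomial F, ∀ s, β (LinearMap.rTensor g (τ s) Y) = P.eval s := fun β Y => by
    induction Y with
    | zero => exact ⟨0, fun s => by simp⟩
    | add _ _ h1 h2 =>
      obtain ⟨P, hP⟩ := h1
      obtain ⟨Q, hQ⟩ := h2
      exact ⟨P + Q, fun s => by rw [map_add, map_add, hP, hQ, Polynomial.eval_add]⟩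
    | tmul r x =>
      obtain ⟨P, hP⟩ := tp r (β ∘ₗ (TensorProduct.mk F (trunc F μ) g).flip x)
      exact ⟨P, fun s => by rw [← hP s]; rfl⟩
  choose Pm hPm using fun i j => hP (α j) ⁅X', z i⁆
  let D : Polynomial F := (Matrix.of Pm).det
  have hD : ∀ s, D.eval s = (Matrix.of fun i j => α j (LinearMap.rTensor g (τ s) ⁅X', z i⁆)).det := fun s => by
    rw [← Polynomial.coe_evalRingHom, RingHom.map_det]
    congr 1; ext i j; exact (hPm i j s).symm
  have hD0 : D.eval 0 = 1 := by
    rw [hD, show τ 0 = (qm F μ).toLinearMap from LinearMap.ext t0]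
    refine (congrArg Matrix.det (Matrix.ext fun i j => ?_)).trans (Matrix.det_one (n := Fin ρ) (R := F))
    rw [Matrix.of_apply, hz, hα, Matrix.one_apply]
  obtain ⟨s, hs0, hs⟩ : ∃ s, s ≠ 0 ∧ D.eval s ≠ 0 := by
    by_contra h1
    push Not at h1
    have h2 : Polynomial.X * D = 0 := Polynomial.funext fun s => by
      by_cases h : s = 0
      · simp [h]
      · simp [h1 s h]
    rcases mul_eq_zero.1 h2 with h | h
    · exact Polynomial.X_ne_zero h
    · rw [h] at hD0; simp at hD0
  let E : (p : ∀ i, Fin (μ i + 1)) → MvPolynomial (Fin ℓ) F ⊗[F] g →ₗ[F] g := fun p => evl g (MvPolynomial.aeval fun i => s * ((p i : ℕ) : F))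
  refine ⟨fun p => E p X', ?_, ?_⟩
  · have : ∀ Y, E 0 Y = evl g (aug F μ) (LinearMap.rTensor g (qm F μ).toLinearMap Y) := fun Y => by
      induction Y with
      | zero => simp
      | add _ _ h1 h2 => rw [map_add, h1, h2, map_add, map_add]
      | tmul r x => simp [E, evl_tmul, aug_qm]
    simp only [this, hX']
  · have hE : ∀ Y, LinearMap.rTensor g (τ s) Y = ∑ p, u s p ⊗ₜ[F] E p Y := fun Y => by
      induction Y with
      | zero => simp
      | add _ _ h1 h2 => rw [map_add, h1, h2, ← sum_add_distrib]; simp [TensorProduct.tmul_add]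
      | tmul r x =>
        rw [LinearMap.rTensor_tmul, ts s hs0, TensorProduct.sum_tmul]
        exact sum_congr rfl fun p _ => by simp only [E, evl_tmul]; rw [TensorProduct.smul_tmul]
    let v : Fin ρ → (p : ∀ i, Fin (μ i + 1)) → LinearMap.range (ad F g (E p X') : End F g) := fun i p =>
      ⟨E p ⁅X', z i⁆, ⟨E p (z i), by simp only [E, evl_lie]; rfl⟩⟩
    have hv : LinearIndependent F v := by
      rw [Fintype.linearIndependent_iff]
      intro c hc
      have h1 : ∑ i, c i • LinearMap.rTensor g (τ s) ⁅X', z i⁆ = 0 := by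
        simp only [hE, smul_sum]
        rw [sum_comm]
        refine sum_eq_zero fun p _ => ?_
        have h2 : ∑ i, c i • E p ⁅X', z i⁆ = 0 := by
          have := congrArg (Subtype.val) (congrFun hc p)
          simpa [v] using this
        calc _ = u s p ⊗ₜ[F] ∑ i, c i • E p ⁅X', z i⁆ := by
              rw [TensorProduct.tmul_sum]; exact sum_congr rfl fun i _ => by rw [TensorProduct.tmul_smul]
          _ = 0 := by rw [h2, TensorProduct.tmul_zero]
      rw [hD] at hs
      have h3 : Matrix.vecMul c (Matrix.of fun i j => α j (LinearMap.rTensor g (τ s) ⁅X', z i⁆)) = 0 := funext fun j => by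
        have := congrArg (α j) h1
        rw [map_sum, map_zero] at this
        simpa [Matrix.vecMul, dotProduct] using this
      exact fun i => congrFun (Matrix.eq_zero_of_vecMul_eq_zero hs h3) i
    have := hv.fintype_card_le_finrank
    rwa [Fintype.card_fin, Module.finrank_pi_fintype] at this

theorem PD.reg0 [CharZero F] [FiniteDimensional F g] [IsAlgClosed F] {e h f : g} (P : PD F e h f) (hr : finrank F (cent F g f) = P.r)
    (hm : ∀ z : g, P.r ≤ finrank F (cent F g z)) {X : trunc F μ ⊗[F] g}
    (hX : finrank F (cent F (trunc F μ ⊗[F] g) X) ≤ finrank F (cent F (trunc F μ ⊗[F] g) (1 ⊗ₜ e))) :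
    finrank F (cent F g (evl g (aug F μ) X)) ≤ P.r := by
  obtain ⟨Z, Z0, hZ⟩ := rk_bd X
  by_contra h0
  push Not at h0
  have h1 := Submodule.finrank_add_eq_of_isCompl (P.transv hr (X := (1 : trunc F μ) ⊗ₜ[F] e) (by
    rw [Sl, Set.mem_setOf_eq, sub_self]; exact zero_mem _))
  have h2 := rk_nul (F := F) ((1 : trunc F μ) ⊗ₜ[F] e)
  have h3 := rk_nul (F := F) X
  have h4 : finrank F (tenV (R := trunc F μ) (cent F g f)) ≤ finrank F (trunc F μ) * P.r := by
    refine (LinearMap.finrank_range_le _).trans ?_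
    rw [Module.finrank_tensorProduct, hr]
  have h5 : ∑ p, finrank F (LinearMap.range (ad F g (Z p) : End F g)) + ∑ p : ∀ i, Fin (μ i + 1), P.r
      < ∑ p : ∀ i, Fin (μ i + 1), finrank F g := by
    rw [← sum_add_distrib]
    refine sum_lt_sum (fun p _ => ?_) ⟨0, mem_univ _, ?_⟩
    · have := rk_nul (F := F) (Z p)
      have := hm (Z p)
      omega
    · have := rk_nul (F := F) (Z 0)
      rw [← Z0] at h0
      omega
  rw [Module.finrank_tensorProduct] at h1 h2 h3
  rw [tr_fr] at h1 h2 h3 h4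
  simp only [sum_const, card_univ, smul_eq_mul] at h5
  omega
end r0

section fin
variable {F : Type*} [Field F] {g : Type*} [LieRing g] [LieAlgebra F g] {R : Type*} [CommRing R] [Algebra F R]

theorem evl_tenV (φ : R →ₐ[F] F) {V : Submodule F g} {v : R ⊗[F] g} (hv : v ∈ tenV (R := R) V) : evl g φ v ∈ V := by
  obtain ⟨q, rfl⟩ := hv
  induction q with
  | zero => simp
  | add _ _ h1 h2 => rw [map_add, map_add]; exact add_mem h1 h2
  | tmul r v => rw [TensorProduct.map_tmul, evl_tmul]; exact ssm _ _ v.2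

theorem evl_co {n : ℕ} (B : Module.Basis (Fin n) F g) (φ : R →ₐ[F] F) (Y : R ⊗[F] g) (b) : φ (co B b Y) = B.repr (evl g φ Y) b := by
  induction Y with
  | zero => simp
  | add _ _ h1 h2 => rw [map_add, map_add, map_add, map_add, h1, h2]; rfl
  | tmul r x => rw [co_tmul, evl_tmul, map_smul, map_smul, fsm, smul_eq_mul, smul_eq_mul, mul_comm]

theorem PD.ex_slice [CharZero F] [IsAlgClosed F] [FiniteDimensional F g] [LieAlgebra.IsKilling F g] {e h f : g} (P : PD F e h f)
    (φ : R →ₐ[F] F) (hn : IsNilpotent (RingHom.ker φ)) {X : R ⊗[F] g} (hX : finrank F (cent F g (evl g φ X)) ≤ P.r) :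
    ∃ Y, Cj F (R ⊗[F] g) X Y ∧ Y ∈ Sl F e f R := by
  obtain ⟨s, hs, hsf⟩ := P.kostant hX
  obtain ⟨X', h1, h2⟩ := hs.lift X (evl g φ) φ (evl_tmul φ) rfl
  obtain ⟨Y, h3, h4⟩ := formal P.B (cent F g f) s (fun x => by
    obtain ⟨v, hv, N, hN⟩ := P.sum_top (R := F) (s := 1 ⊗ₜ s) (by
      rw [Sl, Set.mem_setOf_eq, ← TensorProduct.tmul_sub]; exact tmul_tenV 1 hsf) (1 ⊗ₜ x)
    refine ⟨_, evl_tenV (AlgHom.id F F) hv, evl g (AlgHom.id F F) N, ?_⟩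
    have := congrArg (evl g (AlgHom.id F F)) hN
    rw [map_add, evl_lie, evl_tmul, evl_tmul, map_one, one_smul, one_smul] at this
    exact this) hn X' (fun b => by
    rw [RingHom.mem_ker]
    refine (evl_co P.B φ _ b).trans ?_
    rw [map_sub, h1, evl_tmul, map_one, one_smul, sub_self, map_zero, Finsupp.zero_apply])
  refine ⟨Y, h2.trans h3, ?_⟩
  have := add_mem h4 (tmul_tenV (R := R) 1 hsf)
  rw [TensorProduct.tmul_sub, sub_add_sub_cancel] at this
  exact this
end fin

set_option synthInstance.maxHeartbeats 1000000 in
/-- Let `g` be a semisimple Lie algebra over an algebraically closed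
field `F` of characteristic zero, `μ ∈ ℕ^ℓ`, `A = F[t₁,…,t_ℓ]/⟨t^ω : ω ≰ μ⟩`, and let
`(x₊, x₋, h)` be a principal `sl₂`-triple of `g`.  Then the orbit under the adjoint group
of every regular element of `g ⊗ A` intersects `t = x₊ ⊗ 1 + g^{x₋} ⊗ A` at exactly one
point, and this intersection is transversal:
`g ⊗ A = (g^{x₋} ⊗ A) ⊕ [g ⊗ A, X]` for all `X ∈ t` (expressed by `IsCompl` of the
corresponding submodules, where `[g ⊗ A, X]` is the range of the adjoint action
`ad X`). -/
theorem statement17 {F : Type*} [Field F] [CharZero F] [IsAlgClosed F]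
    {g : Type*} [LieRing g] [LieAlgebra F g] [FiniteDimensional F g]
    [LieAlgebra.IsSemisimple F g]
    {ℓ : ℕ} (μ : Fin ℓ → ℕ)
    (xp xm h : g)
    (hhp : ⁅h, xp⁆ = 2 • xp) (hhm : ⁅h, xm⁆ = -(2 • xm)) (hpm : ⁅xp, xm⁆ = h)
    (hpreg : isRegular F g xp) (hmreg : isRegular F g xm) (hhreg : isRegular F g h) :
    (∀ X : trunc F μ ⊗[F] g, isRegular F (trunc F μ ⊗[F] g) X →
        ∃! Y, reach F (trunc F μ ⊗[F] g) X Y ∧ Y ∈ tSlice F xp xm)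
      ∧ ∀ X ∈ tSlice (F := F) (A := trunc F μ) xp xm,
          IsCompl (centSub F xm)
            (LinearMap.range
              (LieAlgebra.ad F (trunc F μ ⊗[F] g) X : Module.End F (trunc F μ ⊗[F] g))) := by
  obtain ⟨P⟩ := PD.exist (PT.of hhp hhm hpm hpreg hhreg) hhreg
  have rc := P.r_cent
  have hr : Module.finrank F (cent F g xm) = P.r := by
    rw [← rc]; exact le_antisymm (isRegular_le hmreg _) (isRegular_le hhreg _)
  haveI : LieAlgebra.IsKilling F g := inferInstance
  refine ⟨fun X hX => ?_, fun X hX => P.transv hr hX⟩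
  have h0 := P.reg0 hr (fun z => rc ▸ isRegular_le hhreg z) (isRegular_le hX _)
  obtain ⟨Y, h1, h2⟩ := P.ex_slice (aug F μ) aug_nil h0
  refine ⟨Y, ⟨(reach_iff X Y).2 h1, h2⟩, fun Y' ⟨h3, h4⟩ => ?_⟩
  exact P.uniq hr h4 h2 (((reach_iff X Y').1 h3).symm.trans h1)
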